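/- For every ε > 0 there exists a constant C(ε) > 0 such that for all real T ≥ 2 and all α with 0 ≤ α ≤ 1, ∑_{q ≤ T} ∑*_{χ (mod q)} N(α, T, χ) ≤ C(ε)·T^{(15+ε)(1−α)}, where the inner sum ∑* runs over primitive Dirichlet characters χ mod q. -/

import Mathlib

open Real

open scoped Classical in
/-- `zerosCount χ α T` is the number of zeros `ρ = β + iγ` of `L(s, χ)` with
`α ≤ β ≤ 1` and `|γ| ≤ T`. -/
noncomputable def zerosCount {q : ℕ} [NeZero q] (χ : DirichletCharacter ℂ q)
    (α T : ℝ) : ℕ :=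
  Set.ncard {s : ℂ | DirichletCharacter.LFunction χ s = 0 ∧
    α ≤ s.re ∧ s.re ≤ 1 ∧ |s.im| ≤ T}

namespace ZeroDensity

theorem sum_Ioc_mul_eq {R : Type*} [CommRing R] (a f : ℕ → R) {M N : ℕ} (h : M ≤ N) :
    ∑ n ∈ Finset.Ioc M N, a n * f n = (∑ n ∈ Finset.Ioc M N, a n) * f (N + 1) +
      ∑ n ∈ Finset.Ioc M N, (∑ k ∈ Finset.Ioc M n, a k) * (f n - f (n + 1)) := by
  induction N, h using Nat.le_induction with
  | base => simp
  | succ N h ih =>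
    simp only [Finset.sum_Ioc_succ_top h, ih]
    ring

/-- Abel's inequality for weights of controlled variation. -/
theorem norm_sum_Ioc_mul_le {R : Type*} [NormedCommRing R] (a f : ℕ → R) (g : ℕ → ℝ)
    {B K : ℝ} (M N : ℕ)
    (hA : ∀ n ≤ N, ‖∑ k ∈ Finset.Ioc M n, a k‖ ≤ B)
    (hf : ∀ n, M < n → ‖f n‖ ≤ K * g n)
    (hfg : ∀ n, M < n → ‖f n - f (n + 1)‖ ≤ K * (g n - g (n + 1))) :
    ‖∑ n ∈ Finset.Ioc M N, a n * f n‖ ≤ B * (K * g (M + 1)) := by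
  have hg : 0 ≤ K * g (M + 1) := (norm_nonneg _).trans (hf _ (by omega))
  have hB : 0 ≤ B := (norm_nonneg _).trans (hA 0 (Nat.zero_le _))
  rcases lt_or_ge N M with h | h
  · rw [Finset.Ioc_eq_empty_of_le h.le]
    simpa using mul_nonneg hB hg
  have key : ∀ n, M ≤ n → ∑ k ∈ Finset.Ioc M n, (g k - g (k + 1)) = g (M + 1) - g (n + 1) := by
    intro n hn
    induction n, hn using Nat.le_induction with
    | base => simp
    | succ n hn ih =>
      rw [Finset.sum_Ioc_succ_top hn, ih]
      ring
  rw [sum_Ioc_mul_eq a f h]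
  calc _ ≤ ‖(∑ n ∈ Finset.Ioc M N, a n) * f (N + 1)‖ +
        ∑ n ∈ Finset.Ioc M N, ‖(∑ k ∈ Finset.Ioc M n, a k) * (f n - f (n + 1))‖ :=
        (norm_add_le _ _).trans (add_le_add_right (norm_sum_le _ _) _)
    _ ≤ B * (K * g (N + 1)) + ∑ n ∈ Finset.Ioc M N, B * (K * (g n - g (n + 1))) := by
        refine add_le_add ((norm_mul_le _ _).trans ?_) (Finset.sum_le_sum fun n hn ↦
          (norm_mul_le _ _).trans ?_)
        · exact mul_le_mul (hA N le_rfl) (hf _ (by omega)) (norm_nonneg _) hB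
        · rw [Finset.mem_Ioc] at hn
          exact mul_le_mul (hA n hn.2) (hfg _ (by omega)) (norm_nonneg _) hB
    _ = B * (K * g (M + 1)) := by
        rw [← Finset.mul_sum, ← Finset.mul_sum, key N h]; ring

theorem norm_cpow_neg {a : ℝ} (ha : 0 < a) (s : ℂ) : ‖(a : ℂ) ^ (-s)‖ = a ^ (-s.re) := by
  simp [Complex.norm_cpow_eq_rpow_re_of_pos ha]

theorem norm_cpow_neg_sub_le {a b : ℝ} (ha : 0 < a) (hab : a ≤ b) {s : ℂ} (hs : 0 < s.re) :
    ‖(a : ℂ) ^ (-s) - (b : ℂ) ^ (-s)‖ ≤ ‖s‖ / s.re * (a ^ (-s.re) - b ^ (-s.re)) := by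
  have h0 : s ≠ 0 := by rintro rfl; simp at hs
  have hne : ∀ x ∈ Set.Icc a b, x ≠ 0 := fun x hx ↦ (ha.trans_le hx.1).ne'
  have hd : ∀ x ∈ Set.Icc a b, HasDerivAt (fun x : ℝ ↦ (x : ℂ) ^ (-s) - (a : ℂ) ^ (-s))
      (-s * (x : ℂ) ^ (-s - 1)) x := fun x hx ↦
    ((hasDerivAt_ofReal_cpow_const (hne x hx) (neg_ne_zero.2 h0))).sub_const _
  have hB : ∀ x ∈ Set.Icc a b, HasDerivAt
      (fun x : ℝ ↦ ‖s‖ / s.re * (a ^ (-s.re) - x ^ (-s.re))) (‖s‖ * x ^ (-s.re - 1)) x := by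
    intro x hx
    refine (((Real.hasDerivAt_rpow_const (p := -s.re) (Or.inl (hne x hx))).const_sub
      (a ^ (-s.re))).const_mul (‖s‖ / s.re)).congr_deriv ?_
    rw [neg_mul, neg_neg, ← mul_assoc, div_mul_cancel₀ _ hs.ne']
  rw [norm_sub_rev]
  refine image_norm_le_of_norm_deriv_right_le_deriv_boundary' (a := a) (b := b)
    (f := fun x : ℝ ↦ (x : ℂ) ^ (-s) - (a : ℂ) ^ (-s))
    (f' := fun x : ℝ ↦ -s * (x : ℂ) ^ (-s - 1))
    (fun x hx ↦ (hd x hx).continuousAt.continuousWithinAt)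
    (fun x hx ↦ (hd x ⟨hx.1, hx.2.le⟩).hasDerivWithinAt) (by simp)
    (fun x hx ↦ (hB x hx).continuousAt.continuousWithinAt)
    (fun x hx ↦ (hB x ⟨hx.1, hx.2.le⟩).hasDerivWithinAt) ?_ ⟨hab, le_rfl⟩
  intro x hx
  rw [norm_mul, norm_neg, Complex.norm_cpow_eq_rpow_re_of_pos (ha.trans_le hx.1)]
  simp

end ZeroDensity

namespace ZeroDensity
open ArithmeticFunction ArithmeticFunction.Moebius

theorem sum_Ioc_filter_dvd {M : Type*} [AddCommMonoid M] (f : ℕ → M) (N : ℕ) {m : ℕ}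
    (hm : 0 < m) :
    ∑ e ∈ Finset.Ioc 0 N with m ∣ e, f e = ∑ e ∈ Finset.Ioc 0 (N / m), f (m * e) := by
  symm
  refine Finset.sum_bij (fun e _ ↦ m * e) ?_ ?_ ?_ ?_
  · intro e he
    simp only [Finset.mem_filter, Finset.mem_Ioc, dvd_mul_right, and_true] at he ⊢
    exact ⟨Nat.mul_pos hm he.1, (Nat.mul_le_mul_left m he.2).trans (Nat.mul_div_le N m)⟩
  · intro a _ b _ h
    exact Nat.eq_of_mul_eq_mul_left hm h
  · rintro e he
    simp only [Finset.mem_filter, Finset.mem_Ioc] at he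
    obtain ⟨⟨h0, h1⟩, j, rfl⟩ := he
    exact ⟨j, Finset.mem_Ioc.2 ⟨Nat.pos_of_mul_pos_left h0,
      (Nat.le_div_iff_mul_le hm).2 (by linarith)⟩, rfl⟩
  · simp

theorem abs_moebius_cast_le (n : ℕ) : |((μ n : ℤ) : ℝ)| ≤ 1 := by
  exact_mod_cast abs_moebius_le_one (n := n)

theorem abs_sum_moebius_div_le (N : ℕ) : |∑ e ∈ Finset.Ioc 0 N, ((μ e : ℤ) : ℝ) / e| ≤ 1 := by
  rcases Nat.eq_zero_or_pos N with rfl | hN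
  · simp
  have h1 : ∑ e ∈ Finset.Ioc 0 N, ((μ e : ℤ) : ℝ) * ((N / e : ℕ) : ℝ) = 1 := by
    have := sum_Ioc_mul_zeta_eq_sum (R := ℝ) (μ : ArithmeticFunction ℝ) N
    rw [coe_moebius_mul_coe_zeta] at this
    simp only [intCoe_apply] at this
    rw [← this, Finset.sum_eq_single 1] <;> simp +contextual [one_apply]
    omega
  have h2 : (N : ℝ) * ∑ e ∈ Finset.Ioc 0 N, ((μ e : ℤ) : ℝ) / e =
      1 + ∑ e ∈ Finset.Ioc 0 N, ((μ e : ℤ) : ℝ) * ((N : ℝ) / e - ((N / e : ℕ) : ℝ)) := by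
    rw [← h1, ← Finset.sum_add_distrib, Finset.mul_sum]
    exact Finset.sum_congr rfl fun e _ ↦ by ring
  have h3 : |∑ e ∈ Finset.Ioc 0 N, ((μ e : ℤ) : ℝ) * ((N : ℝ) / e - ((N / e : ℕ) : ℝ))| ≤
      N - 1 := by
    have hsplit : Finset.Ioc 0 N = insert 1 (Finset.Ioc 1 N) := by
      ext; simp; omega
    rw [hsplit, Finset.sum_insert (by simp)]
    simp only [Nat.cast_one, div_one, Nat.div_one, sub_self, mul_zero, zero_add]
    refine (Finset.abs_sum_le_sum_abs _ _).trans ?_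
    calc _ ≤ ∑ e ∈ Finset.Ioc 1 N, (1 : ℝ) := by
          refine Finset.sum_le_sum fun e he ↦ ?_
          rw [Finset.mem_Ioc] at he
          have he0 : (0 : ℝ) < e := by exact_mod_cast (by omega : 0 < e)
          have ha : ((N / e : ℕ) : ℝ) ≤ (N : ℝ) / e := Nat.cast_div_le
          have hb : (N : ℝ) / e < ((N / e : ℕ) : ℝ) + 1 := by
            rw [div_lt_iff₀ he0]
            rw [mul_comm]
            exact_mod_cast Nat.lt_mul_div_succ N (by omega : 0 < e)
          rw [abs_mul]
          refine mul_le_one₀ (abs_moebius_cast_le e) (abs_nonneg _) ?_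
          rw [abs_le]
          constructor <;> linarith
      _ = N - 1 := by simp [Nat.cast_sub hN]
  have hN' : (0 : ℝ) < N := by exact_mod_cast hN
  have h4 : |(N : ℝ) * ∑ e ∈ Finset.Ioc 0 N, ((μ e : ℤ) : ℝ) / e| ≤ N * 1 := by
    rw [h2]
    refine (abs_add_le _ _).trans ?_
    rw [abs_one]
    linarith
  rw [abs_mul, abs_of_pos hN'] at h4
  exact le_of_mul_le_mul_left h4 hN'

theorem abs_sum_moebius_rpow_le (N : ℕ) {s : ℝ} (hs : 1 ≤ s) :
    |∑ e ∈ Finset.Ioc 0 N, ((μ e : ℤ) : ℝ) * (e : ℝ) ^ (-s)| ≤ 1 := by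
  have h := norm_sum_Ioc_mul_le (R := ℝ) (fun e ↦ ((μ e : ℤ) : ℝ) / e)
    (fun e ↦ (e : ℝ) ^ (1 - s)) (fun e ↦ (e : ℝ) ^ (1 - s)) (B := 1) (K := 1) 0 N
    (fun n _ ↦ abs_sum_moebius_div_le n)
    (fun n hn ↦ by
      rw [one_mul, Real.norm_of_nonneg (by positivity)])
    (fun n hn ↦ by
      rw [one_mul, Real.norm_of_nonneg]
      refine sub_nonneg.2 (Real.rpow_le_rpow_of_nonpos (by exact_mod_cast hn) ?_ (by linarith))
      exact_mod_cast Nat.le_succ n)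
  simp only [zero_add, Nat.cast_one, one_rpow, mul_one, Real.norm_eq_abs] at h
  convert h using 3 with e he
  have he0 : (0 : ℝ) < e := by exact_mod_cast (Finset.mem_Ioc.1 he).1
  rw [sub_eq_add_neg, Real.rpow_add he0, Real.rpow_one]
  field_simp

/-- `ℓ` is the primitive `∫_1^y t^{-s} dt`, described by the only inequality that is used. -/
structure IsLogWeight (s : ℝ) (ℓ : ℝ → ℝ) : Prop where
  one_le : 1 ≤ s
  map_one : ℓ 1 = 0
  sub_mem : ∀ a b : ℝ, 1 ≤ a → a ≤ b →
    (b - a) * b ^ (-s) ≤ ℓ b - ℓ a ∧ ℓ b - ℓ a ≤ (b - a) * a ^ (-s)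

theorem isLogWeight_of_hasDerivAt {s : ℝ} {ℓ : ℝ → ℝ} (hs : 1 ≤ s) (h1 : ℓ 1 = 0)
    (hd : ∀ x, 1 ≤ x → HasDerivAt ℓ (x ^ (-s)) x) : IsLogWeight s ℓ := by
  refine ⟨hs, h1, fun a b ha hab ↦ ?_⟩
  rcases hab.eq_or_lt with rfl | hab
  · simp
  obtain ⟨c, hc, h⟩ := exists_hasDerivAt_eq_slope ℓ (fun x ↦ x ^ (-s)) hab
    (fun x hx ↦ (hd x (ha.trans hx.1)).continuousAt.continuousWithinAt)
    (fun x hx ↦ hd x (ha.trans hx.1.le))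
  have hba : 0 < b - a := sub_pos.2 hab
  rw [eq_div_iff hba.ne', mul_comm] at h
  have hc0 : 0 < c := by linarith [hc.1]
  rw [← h]
  exact ⟨mul_le_mul_of_nonneg_left (Real.rpow_le_rpow_of_nonpos hc0 hc.2.le (by linarith)) hba.le,
    mul_le_mul_of_nonneg_left (Real.rpow_le_rpow_of_nonpos (by linarith) hc.1.le (by linarith))
      hba.le⟩

theorem isLogWeight_log : IsLogWeight 1 Real.log :=
  isLogWeight_of_hasDerivAt le_rfl Real.log_one fun x hx ↦ by
    rw [Real.rpow_neg_one]; exact Real.hasDerivAt_log (by linarith)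

theorem isLogWeight_rpow {δ : ℝ} (hδ : 0 < δ) :
    IsLogWeight (1 + δ) (fun y ↦ (1 - y ^ (-δ)) / δ) :=
  isLogWeight_of_hasDerivAt (by linarith) (by simp) fun x hx ↦ by
    refine (((Real.hasDerivAt_rpow_const (p := -δ) (Or.inl (by linarith))).const_sub 1).div_const
      δ).congr_deriv ?_
    rw [neg_mul, neg_neg, mul_div_cancel_left₀ _ hδ.ne']
    congr 1; ring

namespace IsLogWeight
variable {s : ℝ} {ℓ : ℝ → ℝ}

theorem mono (h : IsLogWeight s ℓ) {a b : ℝ} (ha : 1 ≤ a) (hab : a ≤ b) : ℓ a ≤ ℓ b := by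
  have := (h.sub_mem a b ha hab).1
  have h2 : 0 ≤ (b - a) * b ^ (-s) := mul_nonneg (by linarith) (Real.rpow_nonneg (by linarith) _)
  linarith

/-- The partial sums of `∑ j^{-s}` are `ℓ y + c + O(y^{-s})`. -/
theorem exists_sum_rpow_eq (h : IsLogWeight s ℓ) : ∃ c : ℝ, |c| ≤ 1 ∧ ∀ y : ℝ, 1 ≤ y →
    |∑ j ∈ Finset.Ioc 0 ⌊y⌋₊, (j : ℝ) ^ (-s) - ℓ y - c| ≤ y ^ (-s) := by
  have hs := h.one_le
  set u : ℕ → ℝ := fun N ↦ ∑ j ∈ Finset.Ioc 0 N, (j : ℝ) ^ (-s) - ℓ (N + 1) with hu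
  have hstep : ∀ N : ℕ, u N ≤ u (N + 1) ∧
      u (N + 1) + ((N + 1 + 1 : ℕ) : ℝ) ^ (-s) ≤ u N + ((N + 1 : ℕ) : ℝ) ^ (-s) := by
    intro N
    have h1 := h.sub_mem (N + 1) (N + 1 + 1) (by linarith [N.cast_nonneg (α := ℝ)]) (by linarith)
    simp only [hu, Finset.sum_Ioc_succ_top (Nat.zero_le N)]
    push_cast
    rw [add_sub_cancel_left, one_mul, one_mul] at h1
    constructor <;> linarith
  have hmono : Monotone u := monotone_nat_of_le_succ fun N ↦ (hstep N).1
  have hanti : Antitone fun N : ℕ ↦ u N + ((N + 1 : ℕ) : ℝ) ^ (-s) :=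
    antitone_nat_of_succ_le fun N ↦ (hstep N).2
  have hle : ∀ M N : ℕ, u M ≤ u N + ((N + 1 : ℕ) : ℝ) ^ (-s) := by
    intro M N
    rcases le_total M N with hMN | hMN
    · have : (0 : ℝ) ≤ ((N + 1 : ℕ) : ℝ) ^ (-s) := by positivity
      linarith [hmono hMN]
    · have : (0 : ℝ) ≤ ((M + 1 : ℕ) : ℝ) ^ (-s) := by positivity
      have := hanti hMN
      simp only at this
      linarith
  have hbdd : BddAbove (Set.range u) := ⟨u 0 + ((0 + 1 : ℕ) : ℝ) ^ (-s), by
    rintro _ ⟨M, rfl⟩; exact hle M 0⟩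
  have hu0 : u 0 = 0 := by simp [hu, h.map_one]
  have hc1 : ∀ N, u N ≤ ⨆ N, u N := fun N ↦ le_ciSup hbdd N
  have hc2 : ∀ N, ⨆ N, u N ≤ u N + ((N + 1 : ℕ) : ℝ) ^ (-s) := fun N ↦ ciSup_le fun M ↦ hle M N
  refine ⟨⨆ N, u N, ?_, fun y hy ↦ ?_⟩
  · have a := hc1 0
    have b := hc2 0
    simp only [hu0, zero_add, Nat.cast_one, one_rpow] at a b
    exact abs_le.2 ⟨by linarith, b⟩
  · have a := hc1 ⌊y⌋₊
    have b := hc2 ⌊y⌋₊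
    have hy1 : y ≤ ⌊y⌋₊ + 1 := (Nat.lt_floor_add_one y).le
    have hy2 : (⌊y⌋₊ : ℝ) ≤ y := Nat.floor_le (by linarith)
    have c := h.mono hy hy1
    have d := (h.sub_mem y (⌊y⌋₊ + 1) hy hy1).2
    have hpos : (0 : ℝ) ≤ y ^ (-s) := by positivity
    have d' : ℓ (⌊y⌋₊ + 1) - ℓ y ≤ y ^ (-s) := d.trans (by nlinarith)
    have e : ((⌊y⌋₊ + 1 : ℕ) : ℝ) ^ (-s) ≤ y ^ (-s) :=
      Real.rpow_le_rpow_of_nonpos (by linarith) (by push_cast; exact hy1) (by linarith)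
    simp only [hu] at a b
    rw [abs_le]
    constructor <;> linarith

end IsLogWeight

end ZeroDensity

namespace ZeroDensity
open ArithmeticFunction ArithmeticFunction.Moebius ArithmeticFunction.zeta

/-- `∑_{e ≤ x, (e, k) = 1} μ(e) e^{-s} ℓ(x / e)`. -/
noncomputable def coprimeSum (s : ℝ) (ℓ : ℝ → ℝ) (k : ℕ) (x : ℝ) : ℝ :=
  ∑ e ∈ Finset.Ioc 0 ⌊x⌋₊ with e.Coprime k, ((μ e : ℤ) : ℝ) * (e : ℝ) ^ (-s) * ℓ (x / e)

/-- `∏_{p ∣ k} (1 - 1/p)⁻¹`. -/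
noncomputable def totientRatio (k : ℕ) : ℝ := ∏ p ∈ k.primeFactors, (1 - (p : ℝ)⁻¹)⁻¹

theorem IsLogWeight.abs_sum_moebius_mul_le {s : ℝ} {ℓ : ℝ → ℝ} (h : IsLogWeight s ℓ) (x : ℝ) :
    |coprimeSum s ℓ 1 x| ≤ 3 := by
  have hs := h.one_le
  rcases lt_or_ge x 1 with hx | hx
  · simp [coprimeSum, Nat.floor_eq_zero.2 hx]
  obtain ⟨c, hc, hF⟩ := h.exists_sum_rpow_eq
  have hN : 0 < ⌊x⌋₊ := Nat.floor_pos.2 hx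
  set N := ⌊x⌋₊ with hNdef
  have h1 : ∑ e ∈ Finset.Ioc 0 N, ((μ e : ℤ) : ℝ) * (e : ℝ) ^ (-s) *
      ∑ j ∈ Finset.Ioc 0 (N / e), (j : ℝ) ^ (-s) = 1 := by
    let f : ArithmeticFunction ℝ := ⟨fun e ↦ ((μ e : ℤ) : ℝ) * (e : ℝ) ^ (-s), by simp⟩
    let g : ArithmeticFunction ℝ := ⟨fun e ↦ if e = 0 then 0 else (e : ℝ) ^ (-s), by simp⟩
    have hfg : f * g = 1 := by
      ext n
      rcases Nat.eq_zero_or_pos n with rfl | hn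
      · simp
      have h0 := congrArg (fun F : ArithmeticFunction ℝ ↦ F n) (coe_moebius_mul_coe_zeta (R := ℝ))
      simp only [mul_apply, one_apply] at h0 ⊢
      have : ∀ x ∈ n.divisorsAntidiagonal, f x.1 * g x.2 =
          (n : ℝ) ^ (-s) * ((μ : ArithmeticFunction ℝ) x.1 * (ζ : ArithmeticFunction ℝ) x.2) := by
        intro x hx
        obtain ⟨hx1, hx2⟩ := Nat.mem_divisorsAntidiagonal.1 hx
        have h2 : x.2 ≠ 0 := by rintro h; simp [h] at hx1; omega
        simp only [f, g, coe_mk, h2, if_false, intCoe_apply, natCoe_apply, zeta_apply, ← hx1]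
        push_cast
        rw [Real.mul_rpow (by positivity) (by positivity)]
        ring
      rw [Finset.sum_congr rfl this, ← Finset.mul_sum, h0]
      split_ifs with h3
      · simp [h3]
      · simp
    have := sum_Ioc_mul_eq_sum_sum f g N
    rw [hfg, Finset.sum_eq_single 1 (by simp +contextual [one_apply]) (by simp; omega)] at this
    rw [one_apply, if_pos rfl] at this
    rw [this]
    refine Finset.sum_congr rfl fun e he ↦ ?_
    simp only [f, coe_mk]
    congr 1
    refine Finset.sum_congr rfl fun j hj ↦ ?_
    have := (Finset.mem_Ioc.1 hj).1
    simp only [g, coe_mk]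
    rw [if_neg (by omega)]
  have hG : coprimeSum s ℓ 1 x =
      ∑ e ∈ Finset.Ioc 0 N, ((μ e : ℤ) : ℝ) * (e : ℝ) ^ (-s) * ℓ (x / e) := by
    simp [coprimeSum, hNdef]
  have h2 : coprimeSum s ℓ 1 x = 1 - c * ∑ e ∈ Finset.Ioc 0 N, ((μ e : ℤ) : ℝ) * (e : ℝ) ^ (-s) -
      ∑ e ∈ Finset.Ioc 0 N, ((μ e : ℤ) : ℝ) * (e : ℝ) ^ (-s) *
        (∑ j ∈ Finset.Ioc 0 ⌊x / e⌋₊, (j : ℝ) ^ (-s) - ℓ (x / e) - c) := by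
    rw [hG, ← h1, Finset.mul_sum, ← Finset.sum_sub_distrib, ← Finset.sum_sub_distrib]
    refine Finset.sum_congr rfl fun e he ↦ ?_
    rw [Nat.floor_div_natCast]
    ring
  have h3 : |∑ e ∈ Finset.Ioc 0 N, ((μ e : ℤ) : ℝ) * (e : ℝ) ^ (-s) *
        (∑ j ∈ Finset.Ioc 0 ⌊x / e⌋₊, (j : ℝ) ^ (-s) - ℓ (x / e) - c)| ≤ 1 := by
    refine (Finset.abs_sum_le_sum_abs _ _).trans ?_
    calc _ ≤ ∑ e ∈ Finset.Ioc 0 N, x ^ (-s) := by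
          refine Finset.sum_le_sum fun e he ↦ ?_
          have he' := Finset.mem_Ioc.1 he
          have he0 : (0 : ℝ) < e := by exact_mod_cast he'.1
          have hex : (e : ℝ) ≤ x := (Nat.le_floor_iff (by linarith)).1 he'.2
          rw [abs_mul, abs_mul, abs_of_nonneg (by positivity : (0 : ℝ) ≤ (e : ℝ) ^ (-s))]
          calc _ ≤ 1 * (e : ℝ) ^ (-s) * (x / e) ^ (-s) := by
                gcongr
                · exact abs_moebius_cast_le e
                · exact hF _ ((one_le_div he0).2 hex)
            _ = x ^ (-s) := by
                rw [one_mul, ← Real.mul_rpow he0.le (by positivity), mul_div_cancel₀ _ he0.ne']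
      _ = N * x ^ (-s) := by simp
      _ ≤ x ^ (1 : ℝ) * x ^ (-s) := by
          rw [Real.rpow_one]
          gcongr
          exact Nat.floor_le (by linarith)
      _ ≤ 1 := by
          rw [← Real.rpow_add (by linarith)]
          exact Real.rpow_le_one_of_one_le_of_nonpos hx (by linarith)
  have h4 := abs_sum_moebius_rpow_le N hs
  rw [h2]
  refine (abs_sub _ _).trans ?_
  have h5 : |1 - c * ∑ e ∈ Finset.Ioc 0 N, ((μ e : ℤ) : ℝ) * (e : ℝ) ^ (-s)| ≤ 2 := by
    refine (abs_sub _ _).trans ?_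
    rw [abs_mul, abs_one]
    have := mul_le_one₀ hc (abs_nonneg _) h4
    linarith
  linarith

theorem coprimeSum_eq_sub {s : ℝ} {ℓ : ℝ → ℝ} {p k : ℕ} (hp : p.Prime) (hpk : ¬ p ∣ k) (x : ℝ) :
    coprimeSum s ℓ k x =
      coprimeSum s ℓ (p * k) x - (p : ℝ) ^ (-s) * coprimeSum s ℓ (p * k) (x / p) := by
  have hcop : ∀ e : ℕ, e.Coprime (p * k) ↔ ¬ p ∣ e ∧ e.Coprime k := fun e ↦ by
    rw [Nat.coprime_mul_iff_right, Nat.coprime_comm, hp.coprime_iff_not_dvd]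
  have h1 : ∑ e ∈ Finset.Ioc 0 ⌊x⌋₊ with p ∣ e, (if e.Coprime k then
      ((μ e : ℤ) : ℝ) * (e : ℝ) ^ (-s) * ℓ (x / e) else 0) =
      - ((p : ℝ) ^ (-s) * coprimeSum s ℓ (p * k) (x / p)) := by
    rw [sum_Ioc_filter_dvd _ _ hp.pos, coprimeSum, Nat.floor_div_natCast, Finset.sum_filter,
      Finset.mul_sum, ← Finset.sum_neg_distrib]
    refine Finset.sum_congr rfl fun e he ↦ ?_
    have hpk' : p.Coprime k := (Nat.Prime.coprime_iff_not_dvd hp).2 hpk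
    by_cases hpe : p ∣ e
    · have : μ (p * e) = 0 := moebius_eq_zero_of_not_squarefree fun hsq ↦
        hp.one_lt.ne' (Nat.isUnit_iff.1 (hsq p (mul_dvd_mul_left p hpe)))
      simp [this, hcop, hpe]
    · have hcp : p.Coprime e := (Nat.Prime.coprime_iff_not_dvd hp).2 hpe
      rw [isMultiplicative_moebius.map_mul_of_coprime hcp, moebius_apply_prime hp]
      have hiff : (p * e).Coprime k ↔ e.Coprime k := by
        rw [Nat.coprime_mul_iff_left]; exact and_iff_right hpk'
      simp only [hcop, hpe, not_false_eq_true, true_and, hiff]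
      split_ifs
      · push_cast
        rw [Real.mul_rpow (by positivity) (by positivity), div_div]
        ring
      · simp
  have h2 : ∑ e ∈ Finset.Ioc 0 ⌊x⌋₊ with ¬ p ∣ e, (if e.Coprime k then
      ((μ e : ℤ) : ℝ) * (e : ℝ) ^ (-s) * ℓ (x / e) else 0) = coprimeSum s ℓ (p * k) x := by
    rw [coprimeSum, ← Finset.sum_filter, Finset.filter_filter]
    simp only [hcop]
  rw [sub_eq_add_neg, ← h1, ← h2, add_comm, Finset.sum_filter_add_sum_filter_not, coprimeSum,
    Finset.sum_filter]

theorem one_sub_inv_prime_pos {p : ℕ} (hp : p.Prime) : 0 < 1 - (p : ℝ)⁻¹ := by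
  have h1 : (1 : ℝ) < p := by exact_mod_cast hp.one_lt
  have := inv_lt_one_of_one_lt₀ h1
  linarith

theorem totientRatio_nonneg (k : ℕ) : 0 ≤ totientRatio k :=
  Finset.prod_nonneg fun _ hp ↦
    (inv_pos.2 (one_sub_inv_prime_pos (Nat.prime_of_mem_primeFactors hp))).le

theorem totientRatio_prime_mul {p k : ℕ} (hp : p.Prime) (hk : k ≠ 0) (hpk : ¬ p ∣ k) :
    totientRatio (p * k) = (1 - (p : ℝ)⁻¹)⁻¹ * totientRatio k := by
  rw [totientRatio, Nat.primeFactors_mul hp.ne_zero hk, hp.primeFactors,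
    ← Finset.insert_eq, Finset.prod_insert (by simp [hpk]), totientRatio]

theorem IsLogWeight.abs_coprimeSum_le {s : ℝ} {ℓ : ℝ → ℝ} (h : IsLogWeight s ℓ) {k : ℕ}
    (hk : Squarefree k) : ∀ x : ℝ, |coprimeSum s ℓ k x| ≤ 3 * totientRatio k := by
  induction k using induction_on_primes with
  | zero => exact absurd hk not_squarefree_zero
  | one => simpa [totientRatio] using h.abs_sum_moebius_mul_le
  | prime_mul p k hp ih =>
    have hk' : Squarefree k := hk.squarefree_of_dvd (dvd_mul_left k p)
    have hpk : ¬ p ∣ k := fun hd ↦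
      hp.one_lt.ne' (Nat.isUnit_iff.1 (hk p (mul_dvd_mul_left p hd)))
    have ih := ih hk'
    have hpos := one_sub_inv_prime_pos hp
    have hB := totientRatio_nonneg k
    rw [totientRatio_prime_mul hp hk'.ne_zero hpk]
    have key : ∀ n : ℕ, ∀ x : ℝ, ⌊x⌋₊ = n →
        |coprimeSum s ℓ (p * k) x| ≤ 3 * ((1 - (p : ℝ)⁻¹)⁻¹ * totientRatio k) := by
      intro n
      induction n using Nat.strong_induction_on with
      | _ n ihn =>
        intro x hx
        rcases Nat.eq_zero_or_pos n with rfl | hn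
        · simp only [coprimeSum, hx, Finset.Ioc_self, Finset.filter_empty, Finset.sum_empty,
            abs_zero]
          positivity
        · have h1 := ihn (n / p) (Nat.div_lt_self hn hp.one_lt) (x / p)
            (by rw [Nat.floor_div_natCast, hx])
          have h2 := coprimeSum_eq_sub (s := s) (ℓ := ℓ) hp hpk x
          have h3 : (p : ℝ) ^ (-s) ≤ (p : ℝ)⁻¹ := by
            rw [← Real.rpow_neg_one]
            exact Real.rpow_le_rpow_of_exponent_le (by exact_mod_cast hp.one_lt.le)
              (by linarith [h.one_le])
          have h4 : coprimeSum s ℓ (p * k) x = coprimeSum s ℓ k x +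
              (p : ℝ) ^ (-s) * coprimeSum s ℓ (p * k) (x / p) := by linarith
          rw [h4]
          refine (abs_add_le _ _).trans ?_
          rw [abs_mul, abs_of_nonneg (by positivity : (0 : ℝ) ≤ (p : ℝ) ^ (-s))]
          calc _ ≤ 3 * totientRatio k +
                (p : ℝ)⁻¹ * (3 * ((1 - (p : ℝ)⁻¹)⁻¹ * totientRatio k)) := by
                gcongr
                exact ih x
            _ = 3 * ((1 - (p : ℝ)⁻¹)⁻¹ * totientRatio k) := by
                have := hpos.ne'
                generalize (p : ℝ)⁻¹ = r at *
                field_simp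
                ring
    exact fun x ↦ key _ x rfl

end ZeroDensity

namespace ZeroDensity
open ArithmeticFunction ArithmeticFunction.Moebius

theorem sum_divisors_prod_primeFactors (g : ℕ → ℝ) {n : ℕ} (hn : Squarefree n) :
    ∑ d ∈ n.divisors, ∏ p ∈ d.primeFactors, g p = ∏ p ∈ n.primeFactors, (1 + g p) := by
  have h := (IsMultiplicative.prodPrimeFactors g).prodPrimeFactors_one_add_of_squarefree hn
  calc _ = ∑ d ∈ n.divisors, prodPrimeFactors g d :=
        Finset.sum_congr rfl fun d hd ↦
          (prodPrimeFactors_apply (Nat.pos_of_mem_divisors hd).ne').symm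
    _ = _ := by
        rw [← h]
        refine Finset.prod_congr rfl fun p hp ↦ ?_
        have hp := Nat.prime_of_mem_primeFactors hp
        rw [prodPrimeFactors_apply hp.ne_zero, hp.primeFactors, Finset.prod_singleton]

theorem prod_primeFactors_rpow {n : ℕ} (hn : Squarefree n) (s : ℝ) :
    ∏ p ∈ n.primeFactors, (p : ℝ) ^ s = (n : ℝ) ^ s := by
  rw [Real.finsetProd_rpow _ _ fun _ _ ↦ Nat.cast_nonneg _]
  rw [← Nat.cast_prod, Nat.prod_primeFactors_of_squarefree hn]

/-- `∑_{d, d'} w(d) w(d') [d, d']^{-s}`. -/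
noncomputable def lcmForm (s : ℝ) (N : ℕ) (w : ℕ → ℝ) : ℝ :=
  ∑ d ∈ Finset.Ioc 0 N, ∑ e ∈ Finset.Ioc 0 N, w d * w e * ((d.lcm e : ℕ) : ℝ) ^ (-s)

theorem lcmForm_le {s : ℝ} (hs : 1 ≤ s) (N : ℕ) (w : ℕ → ℝ) (hw : ∀ d, ¬ Squarefree d → w d = 0) :
    lcmForm s N w ≤ ∑ m ∈ Finset.Ioc 0 N with Squarefree m,
      (m : ℝ) ^ s * (∑ d ∈ Finset.Ioc 0 N with m ∣ d, w d * (d : ℝ) ^ (-s)) ^ 2 := by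
  set J : ℕ → ℝ := fun m ↦ ∏ p ∈ m.primeFactors, ((p : ℝ) ^ s - 1) with hJ
  have hpow : ∀ m : ℕ, ∀ p ∈ m.primeFactors, (1 : ℝ) ≤ (p : ℝ) ^ s := fun m p hp ↦
    Real.one_le_rpow (by exact_mod_cast (Nat.prime_of_mem_primeFactors hp).one_lt.le) (by linarith)
  have hJle : ∀ m : ℕ, Squarefree m → J m ≤ (m : ℝ) ^ s := fun m hm ↦ by
    rw [← prod_primeFactors_rpow hm]
    exact Finset.prod_le_prod (fun p hp ↦ by linarith [hpow m p hp]) fun p hp ↦ by linarith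
  have hterm : ∀ d ∈ Finset.Ioc 0 N, ∀ e ∈ Finset.Ioc 0 N,
      w d * w e * ((d.lcm e : ℕ) : ℝ) ^ (-s) = ∑ m ∈ Finset.Ioc 0 N with Squarefree m,
        J m * (if m ∣ d then w d * (d : ℝ) ^ (-s) else 0) *
          (if m ∣ e then w e * (e : ℝ) ^ (-s) else 0) := by
    intro d hd e he
    rw [Finset.mem_Ioc] at hd he
    by_cases hsd : Squarefree d
    swap
    · simp [hw d hsd]
    have hg : 0 < d.gcd e := Nat.gcd_pos_of_pos_left e hd.1
    have hsg : Squarefree (d.gcd e) := hsd.squarefree_of_dvd (Nat.gcd_dvd_left d e)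
    have h1 : ∑ m ∈ (d.gcd e).divisors, J m = ((d.gcd e : ℕ) : ℝ) ^ s := by
      rw [hJ, sum_divisors_prod_primeFactors _ hsg, ← prod_primeFactors_rpow hsg]
      exact Finset.prod_congr rfl fun p _ ↦ by ring
    have h2 : ((d.lcm e : ℕ) : ℝ) ^ (-s) =
        ((d.gcd e : ℕ) : ℝ) ^ s * ((d : ℝ) ^ (-s) * (e : ℝ) ^ (-s)) := by
      have hgl : ((d.gcd e : ℕ) : ℝ) * ((d.lcm e : ℕ) : ℝ) = d * e := by
        exact_mod_cast Nat.gcd_mul_lcm d e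
      have hg' : (0 : ℝ) < ((d.gcd e : ℕ) : ℝ) := by exact_mod_cast hg
      rw [← Real.mul_rpow (by positivity) (by positivity), ← hgl,
        Real.mul_rpow (by positivity) (by positivity), ← mul_assoc, ← Real.rpow_add hg']
      simp
    rw [h2, ← h1, Finset.sum_mul, Finset.mul_sum]
    have hsub : (d.gcd e).divisors ⊆ {m ∈ Finset.Ioc 0 N | Squarefree m} := by
      intro m hm
      have hmd := Nat.dvd_of_mem_divisors hm
      rw [Finset.mem_filter, Finset.mem_Ioc]
      exact ⟨⟨Nat.pos_of_mem_divisors hm, ((Nat.le_of_dvd hg hmd).trans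
        (Nat.gcd_le_left e hd.1)).trans hd.2⟩, hsg.squarefree_of_dvd hmd⟩
    refine Finset.sum_subset_zero_on_sdiff hsub (fun m hm ↦ ?_) fun m hm ↦ ?_
    · rw [Finset.mem_sdiff, Nat.mem_divisors, Nat.dvd_gcd_iff] at hm
      have : ¬ (m ∣ d ∧ m ∣ e) := fun h ↦ hm.2 ⟨h, hg.ne'⟩
      split_ifs <;> simp_all
    · have hmd := Nat.dvd_of_mem_divisors hm
      rw [if_pos (hmd.trans (Nat.gcd_dvd_left d e)), if_pos (hmd.trans (Nat.gcd_dvd_right d e))]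
      ring
  calc lcmForm s N w = ∑ m ∈ Finset.Ioc 0 N with Squarefree m,
        J m * (∑ d ∈ Finset.Ioc 0 N with m ∣ d, w d * (d : ℝ) ^ (-s)) ^ 2 := by
        rw [lcmForm, Finset.sum_congr rfl fun d hd ↦ Finset.sum_congr rfl (hterm d hd)]
        rw [Finset.sum_congr rfl fun d _ ↦ Finset.sum_comm, Finset.sum_comm]
        refine Finset.sum_congr rfl fun m _ ↦ ?_
        rw [sq, Finset.sum_filter, Finset.sum_mul_sum, Finset.mul_sum]
        refine Finset.sum_congr rfl fun d _ ↦ ?_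
        rw [Finset.mul_sum]
        exact Finset.sum_congr rfl fun e _ ↦ by ring
    _ ≤ _ := Finset.sum_le_sum fun m hm ↦
        mul_le_mul_of_nonneg_right (hJle m (Finset.mem_filter.1 hm).2) (sq_nonneg _)

theorem sum_inv_Ioc_le (N : ℕ) : ∑ j ∈ Finset.Ioc 0 N, (j : ℝ)⁻¹ ≤ 1 + Real.log N := by
  have := harmonic_le_one_add_log N
  rw [harmonic_eq_sum_Icc] at this
  push_cast at this
  exact this

theorem sum_inv_sq_le (S : Finset ℕ) : ∑ p ∈ S, 6 * ((p : ℝ) ^ 2)⁻¹ ≤ 12 := by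
  have h1 : ∑ p ∈ S, ((p : ℝ) ^ 2)⁻¹ ≤ ∑' p : ℕ, ((p : ℝ) ^ 2)⁻¹ :=
    (Real.summable_nat_pow_inv.2 (by norm_num)).sum_le_tsum S fun _ _ ↦ by positivity
  have h2 : ∑' p : ℕ, ((p : ℝ) ^ 2)⁻¹ = π ^ 2 / 6 := by
    rw [← hasSum_zeta_two.tsum_eq]; simp
  have h3 : π ^ 2 ≤ 3.15 ^ 2 := by gcongr; exact Real.pi_lt_d2.le
  rw [← Finset.mul_sum]
  linarith

theorem sum_squarefree_prod_le (N : ℕ) : ∑ d ∈ Finset.Ioc 0 N with Squarefree d,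
    ∏ p ∈ d.primeFactors, 6 * ((p : ℝ) ^ 2)⁻¹ ≤ Real.exp 12 := by
  have h1 : ∑ d ∈ Finset.Ioc 0 N with Squarefree d,
      ∏ p ∈ d.primeFactors, 6 * ((p : ℝ) ^ 2)⁻¹ ≤
      ∑ t ∈ (Finset.Ioc 0 N).powerset, ∏ p ∈ t, 6 * ((p : ℝ) ^ 2)⁻¹ := by
    rw [← Finset.sum_image (s := {d ∈ Finset.Ioc 0 N | Squarefree d}) (g := Nat.primeFactors)
      (f := fun t : Finset ℕ ↦ ∏ p ∈ t, 6 * ((p : ℝ) ^ 2)⁻¹)]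
    · refine Finset.sum_le_sum_of_subset_of_nonneg ?_ fun t _ _ ↦
        Finset.prod_nonneg fun p _ ↦ by positivity
      intro t ht
      obtain ⟨d, hd, rfl⟩ := Finset.mem_image.1 ht
      rw [Finset.mem_filter, Finset.mem_Ioc] at hd
      rw [Finset.mem_powerset]
      intro p hp
      exact Finset.mem_Ioc.2 ⟨(Nat.prime_of_mem_primeFactors hp).pos,
        (Nat.le_of_dvd hd.1.1 (Nat.dvd_of_mem_primeFactors hp)).trans hd.1.2⟩
    · intro a ha b hb hab
      have ha := (Finset.mem_filter.1 ha).2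
      have hb := (Finset.mem_filter.1 hb).2
      rw [← Nat.prod_primeFactors_of_squarefree ha, ← Nat.prod_primeFactors_of_squarefree hb, hab]
  refine h1.trans ?_
  rw [← Finset.prod_one_add]
  refine (Finset.prod_le_prod (g := fun p : ℕ ↦ Real.exp (6 * ((p : ℝ) ^ 2)⁻¹))
    (fun _ _ ↦ by positivity)
    (fun p _ ↦ by rw [add_comm]; exact Real.add_one_le_exp _)).trans ?_
  rw [← Real.exp_sum]
  exact Real.exp_le_exp.2 (sum_inv_sq_le _)

theorem totientRatio_sq_le {m : ℕ} (hm : Squarefree m) :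
    totientRatio m ^ 2 ≤ ∑ d ∈ m.divisors, ∏ p ∈ d.primeFactors, 6 * (p : ℝ)⁻¹ := by
  rw [sum_divisors_prod_primeFactors _ hm, totientRatio, ← Finset.prod_pow]
  refine Finset.prod_le_prod (fun p _ ↦ by positivity) fun p hp ↦ ?_
  have hp := Nat.prime_of_mem_primeFactors hp
  have h2 : (p : ℝ)⁻¹ ≤ 2⁻¹ := by gcongr; exact_mod_cast hp.two_le
  have h0 : (0 : ℝ) ≤ (p : ℝ)⁻¹ := by positivity
  generalize (p : ℝ)⁻¹ = r at *
  rw [inv_pow, inv_le_iff_one_le_mul₀ (by nlinarith)]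
  nlinarith [mul_nonneg h0 (sub_nonneg.2 h2), mul_nonneg (mul_nonneg h0 h0) h0,
    mul_nonneg (mul_nonneg h0 (sub_nonneg.2 h2)) (sub_nonneg.2 h2)]

theorem sum_totientRatio_sq_le (N : ℕ) : ∑ m ∈ Finset.Ioc 0 N with Squarefree m,
    totientRatio m ^ 2 * (m : ℝ)⁻¹ ≤ Real.exp 12 * (1 + Real.log N) := by
  rcases Nat.eq_zero_or_pos N with rfl | hN
  · simp; positivity
  set g : ℕ → ℝ := fun d ↦ ∏ p ∈ d.primeFactors, 6 * (p : ℝ)⁻¹ with hg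
  have hg0 : ∀ d, 0 ≤ g d := fun d ↦ Finset.prod_nonneg fun p _ ↦ by positivity
  calc _ ≤ ∑ m ∈ Finset.Ioc 0 N with Squarefree m, ∑ d ∈ Finset.Ioc 0 N with Squarefree d,
        if d ∣ m then g d * (m : ℝ)⁻¹ else 0 := by
        refine Finset.sum_le_sum fun m hm ↦ ?_
        rw [Finset.mem_filter, Finset.mem_Ioc] at hm
        refine (mul_le_mul_of_nonneg_right (totientRatio_sq_le hm.2) (by positivity)).trans ?_
        rw [Finset.sum_mul, ← Finset.sum_filter]
        refine Finset.sum_le_sum_of_subset_of_nonneg (fun d hd ↦ ?_) fun d _ _ ↦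
          mul_nonneg (hg0 d) (by positivity)
        have hdm := Nat.dvd_of_mem_divisors hd
        rw [Finset.mem_filter, Finset.mem_filter, Finset.mem_Ioc]
        exact ⟨⟨⟨Nat.pos_of_mem_divisors hd, (Nat.le_of_dvd hm.1.1 hdm).trans hm.1.2⟩,
          hm.2.squarefree_of_dvd hdm⟩, hdm⟩
    _ ≤ ∑ m ∈ Finset.Ioc 0 N, ∑ d ∈ Finset.Ioc 0 N with Squarefree d,
        if d ∣ m then g d * (m : ℝ)⁻¹ else 0 :=
        Finset.sum_le_sum_of_subset_of_nonneg (Finset.filter_subset _ _) fun m _ _ ↦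
          Finset.sum_nonneg fun d _ ↦ by
            split_ifs
            · exact mul_nonneg (hg0 d) (by positivity)
            · rfl
    _ = ∑ d ∈ Finset.Ioc 0 N with Squarefree d,
        ∑ j ∈ Finset.Ioc 0 (N / d), g d * ((d * j : ℕ) : ℝ)⁻¹ := by
        rw [Finset.sum_comm]
        refine Finset.sum_congr rfl fun d hd ↦ ?_
        rw [Finset.mem_filter, Finset.mem_Ioc] at hd
        rw [← Finset.sum_filter, sum_Ioc_filter_dvd _ _ hd.1.1]
    _ ≤ ∑ d ∈ Finset.Ioc 0 N with Squarefree d, g d * (d : ℝ)⁻¹ * (1 + Real.log N) := by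
        refine Finset.sum_le_sum fun d hd ↦ ?_
        have h1 : ∑ j ∈ Finset.Ioc 0 (N / d), (j : ℝ)⁻¹ ≤ 1 + Real.log N :=
          (Finset.sum_le_sum_of_subset_of_nonneg
            (Finset.Ioc_subset_Ioc_right (Nat.div_le_self N d)) fun _ _ _ ↦ by positivity).trans
            (sum_inv_Ioc_le N)
        refine le_trans (le_of_eq ?_) (mul_le_mul_of_nonneg_left h1
          (mul_nonneg (hg0 d) (by positivity : (0 : ℝ) ≤ (d : ℝ)⁻¹)))
        rw [Finset.mul_sum]
        exact Finset.sum_congr rfl fun j _ ↦ by push_cast; rw [mul_inv]; ring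
    _ = (∑ d ∈ Finset.Ioc 0 N with Squarefree d, ∏ p ∈ d.primeFactors, 6 * ((p : ℝ) ^ 2)⁻¹) *
        (1 + Real.log N) := by
        rw [Finset.sum_mul]
        refine Finset.sum_congr rfl fun d hd ↦ ?_
        have hsq := (Finset.mem_filter.1 hd).2
        congr 1
        have h1 := prod_primeFactors_rpow hsq (-1)
        simp only [Real.rpow_neg_one] at h1
        rw [← h1, hg, ← Finset.prod_mul_distrib]
        exact Finset.prod_congr rfl fun p _ ↦ by rw [sq, mul_inv]; ring
    _ ≤ _ := mul_le_mul_of_nonneg_right (sum_squarefree_prod_le N)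
        (by have := Real.log_natCast_nonneg N; linarith)

/-- The quadratic form at the weights `μ(d) ℓ(z / d)` is `O(1 + log z)`. -/
theorem IsLogWeight.lcmForm_le {s : ℝ} {ℓ : ℝ → ℝ} (h : IsLogWeight s ℓ) {z : ℝ} (hz : 1 ≤ z)
    {N : ℕ} (hN : ⌊z⌋₊ ≤ N) :
    lcmForm s N (fun d ↦ if d ≤ ⌊z⌋₊ then ((μ d : ℤ) : ℝ) * ℓ (z / d) else 0) ≤
      9 * Real.exp 12 * (1 + Real.log z) := by
  have hs := h.one_le
  refine (ZeroDensity.lcmForm_le hs _ _ fun d hd ↦ ?_).trans ?_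
  · simp [moebius_eq_zero_of_not_squarefree hd]
  have hbound : ∀ m ∈ {m ∈ Finset.Ioc 0 N | Squarefree m}, (m : ℝ) ^ s *
      (∑ d ∈ Finset.Ioc 0 N with m ∣ d,
        (if d ≤ ⌊z⌋₊ then ((μ d : ℤ) : ℝ) * ℓ (z / d) else 0) * (d : ℝ) ^ (-s)) ^ 2 ≤
        if m ≤ ⌊z⌋₊ then 9 * (totientRatio m ^ 2 * (m : ℝ)⁻¹) else 0 := by
    intro m hm
    rw [Finset.mem_filter, Finset.mem_Ioc] at hm
    have hm0 : (0 : ℝ) < m := by exact_mod_cast hm.1.1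
    have hm1 : (1 : ℝ) ≤ m := by exact_mod_cast hm.1.1
    have h1 : ∑ d ∈ Finset.Ioc 0 N with m ∣ d,
        (if d ≤ ⌊z⌋₊ then ((μ d : ℤ) : ℝ) * ℓ (z / d) else 0) * (d : ℝ) ^ (-s) =
        ((μ m : ℤ) : ℝ) * (m : ℝ) ^ (-s) * coprimeSum s ℓ m (z / m) := by
      calc _ = ∑ d ∈ Finset.Ioc 0 ⌊z⌋₊ with m ∣ d,
            ((μ d : ℤ) : ℝ) * ℓ (z / d) * (d : ℝ) ^ (-s) := by
            simp only [ite_mul, zero_mul]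
            rw [← Finset.sum_filter]
            refine Finset.sum_congr ?_ fun _ _ ↦ rfl
            ext d
            simp only [Finset.mem_filter, Finset.mem_Ioc]
            constructor
            · rintro ⟨⟨⟨a, b⟩, c⟩, d⟩; exact ⟨⟨a, d⟩, c⟩
            · rintro ⟨⟨a, b⟩, c⟩; exact ⟨⟨⟨a, b.trans hN⟩, c⟩, b⟩
        _ = _ := by
          rw [sum_Ioc_filter_dvd _ _ hm.1.1, coprimeSum, Nat.floor_div_natCast, Finset.sum_filter,
            Finset.mul_sum]
          refine Finset.sum_congr rfl fun e _ ↦ ?_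
          split_ifs with hc
          · rw [isMultiplicative_moebius.map_mul_of_coprime (Nat.coprime_comm.1 hc)]
            push_cast
            rw [Real.mul_rpow (by positivity) (by positivity), div_div]
            ring
          · rw [moebius_eq_zero_of_not_squarefree fun hsq ↦
              hc (Nat.coprime_comm.1 (Nat.squarefree_mul_iff.1 hsq).1)]
            simp
    rw [h1]
    split_ifs with hmz
    · have hG := h.abs_coprimeSum_le hm.2 (z / m)
      have hT := totientRatio_nonneg m
      have hG2 : coprimeSum s ℓ m (z / m) ^ 2 ≤ (3 * totientRatio m) ^ 2 :=
        sq_le_sq' (abs_le.1 hG).1 (abs_le.1 hG).2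
      have hmu : ((μ m : ℤ) : ℝ) ^ 2 ≤ 1 := by
        rw [sq_le_one_iff_abs_le_one]; exact abs_moebius_cast_le m
      have hpow : (m : ℝ) ^ s * ((m : ℝ) ^ (-s)) ^ 2 ≤ (m : ℝ)⁻¹ := by
        rw [sq, ← mul_assoc, ← Real.rpow_add hm0, add_neg_cancel, Real.rpow_zero, one_mul,
          ← Real.rpow_neg_one]
        exact Real.rpow_le_rpow_of_exponent_le hm1 (by linarith)
      calc _ = ((m : ℝ) ^ s * ((m : ℝ) ^ (-s)) ^ 2) * ((μ m : ℤ) : ℝ) ^ 2 *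
            coprimeSum s ℓ m (z / m) ^ 2 := by ring
        _ ≤ (m : ℝ)⁻¹ * 1 * (3 * totientRatio m) ^ 2 := by gcongr
        _ = _ := by ring
    · have : ⌊z / m⌋₊ = 0 := by
        rw [Nat.floor_div_natCast, Nat.div_eq_zero_iff]; right; omega
      simp [coprimeSum, this]
  refine (Finset.sum_le_sum hbound).trans ?_
  rw [← Finset.sum_filter, Finset.filter_filter]
  have : {m ∈ Finset.Ioc 0 N | Squarefree m ∧ m ≤ ⌊z⌋₊} =
      {m ∈ Finset.Ioc 0 ⌊z⌋₊ | Squarefree m} := by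
    ext m; simp only [Finset.mem_filter, Finset.mem_Ioc]
    constructor
    · rintro ⟨⟨a, b⟩, c, d⟩; exact ⟨⟨a, d⟩, c⟩
    · rintro ⟨⟨a, b⟩, c⟩; exact ⟨⟨a, b.trans hN⟩, c, b⟩
  rw [this, ← Finset.mul_sum, mul_assoc]
  refine mul_le_mul_of_nonneg_left ((sum_totientRatio_sq_le _).trans ?_) (by norm_num)
  gcongr
  · exact_mod_cast Nat.floor_pos.2 hz
  · exact Nat.floor_le (by linarith)

end ZeroDensity

namespace ZeroDensity
open ArithmeticFunction ArithmeticFunction.Moebius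

/-- `∑_{d ∣ n} w(d)`. -/
def divSum (w : ℕ → ℝ) (n : ℕ) : ℝ := ∑ d ∈ n.divisors, w d

theorem divSum_eq {w : ℕ → ℝ} {N : ℕ} (hw : ∀ d, N < d → w d = 0) {n : ℕ} (hn : 0 < n) :
    divSum w n = ∑ d ∈ Finset.Ioc 0 N with d ∣ n, w d := by
  rw [divSum]
  symm
  refine Finset.sum_subset (fun d hd ↦ ?_) fun d hd hd' ↦ hw d ?_
  · rw [Finset.mem_filter] at hd
    exact Nat.mem_divisors.2 ⟨hd.2, hn.ne'⟩
  · rw [Finset.mem_filter, Finset.mem_Ioc] at hd'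
    have h1 := Nat.pos_of_mem_divisors hd
    have h2 := Nat.dvd_of_mem_divisors hd
    by_contra h
    exact hd' ⟨⟨h1, by omega⟩, h2⟩

theorem divSum_sq_eq {w : ℕ → ℝ} {N : ℕ} (hw : ∀ d, N < d → w d = 0) {n : ℕ} (hn : 0 < n) :
    divSum w n ^ 2 = ∑ d ∈ Finset.Ioc 0 N, ∑ e ∈ Finset.Ioc 0 N,
      if d.lcm e ∣ n then w d * w e else 0 := by
  rw [divSum_eq hw hn, sq, Finset.sum_filter, Finset.sum_mul_sum]
  refine Finset.sum_congr rfl fun d _ ↦ Finset.sum_congr rfl fun e _ ↦ ?_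
  by_cases h1 : d ∣ n <;> by_cases h2 : e ∣ n <;> simp [Nat.lcm_dvd_iff, h1, h2]

theorem hasSum_dvd_rpow {s : ℝ} (hs : 1 < s) {g : ℕ} (hg : 0 < g) :
    HasSum (fun n : ℕ ↦ if g ∣ n then (n : ℝ) ^ (-s) else 0)
      ((g : ℝ) ^ (-s) * ∑' n : ℕ, (n : ℝ) ^ (-s)) := by
  have h1 : HasSum (fun n : ℕ ↦ (n : ℝ) ^ (-s)) (∑' n : ℕ, (n : ℝ) ^ (-s)) :=
    (Real.summable_nat_rpow.2 (by linarith)).hasSum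
  have hinj : Function.Injective fun j : ℕ ↦ g * j := fun a b h ↦ Nat.eq_of_mul_eq_mul_left hg h
  rw [← hinj.hasSum_iff]
  · have : ((fun n : ℕ ↦ if g ∣ n then (n : ℝ) ^ (-s) else 0) ∘ fun j : ℕ ↦ g * j) =
        fun j : ℕ ↦ (g : ℝ) ^ (-s) * (j : ℝ) ^ (-s) := by
      funext j
      rw [Function.comp_apply, if_pos (dvd_mul_right g j), Nat.cast_mul,
        Real.mul_rpow (by positivity) (by positivity)]
    rw [this]
    exact h1.mul_left _
  · intro n hn
    rw [if_neg]
    rintro ⟨j, rfl⟩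
    exact hn ⟨j, rfl⟩

theorem sum_divSum_sq_le {s : ℝ} (hs : 1 < s) {w : ℕ → ℝ} {N : ℕ} (hw : ∀ d, N < d → w d = 0)
    (X : ℕ) : ∑ n ∈ Finset.Ioc 0 X, divSum w n ^ 2 * (n : ℝ) ^ (-s) ≤
      (∑' n : ℕ, (n : ℝ) ^ (-s)) * lcmForm s N w := by
  have h : HasSum (fun n : ℕ ↦ divSum w n ^ 2 * (n : ℝ) ^ (-s))
      (∑ d ∈ Finset.Ioc 0 N, ∑ e ∈ Finset.Ioc 0 N,
        w d * w e * (((d.lcm e : ℕ) : ℝ) ^ (-s) * ∑' n : ℕ, (n : ℝ) ^ (-s))) := by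
    have : (fun n : ℕ ↦ divSum w n ^ 2 * (n : ℝ) ^ (-s)) = fun n : ℕ ↦
        ∑ d ∈ Finset.Ioc 0 N, ∑ e ∈ Finset.Ioc 0 N,
          w d * w e * (if d.lcm e ∣ n then (n : ℝ) ^ (-s) else 0) := by
      funext n
      rcases Nat.eq_zero_or_pos n with rfl | hn
      · have : (0 : ℝ) ^ (-s) = 0 := Real.zero_rpow (by linarith)
        simp [this]
      · rw [divSum_sq_eq hw hn, Finset.sum_mul]
        refine Finset.sum_congr rfl fun d _ ↦ ?_
        rw [Finset.sum_mul]
        exact Finset.sum_congr rfl fun e _ ↦ by split_ifs <;> simp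
    rw [this]
    refine hasSum_sum fun d hd ↦ hasSum_sum fun e he ↦ (hasSum_dvd_rpow hs ?_).mul_left _
    exact Nat.lcm_pos (Finset.mem_Ioc.1 hd).1 (Finset.mem_Ioc.1 he).1
  refine (sum_le_hasSum _ (fun n _ ↦ by positivity) h).trans (le_of_eq ?_)
  rw [lcmForm, Finset.mul_sum]
  refine Finset.sum_congr rfl fun d _ ↦ ?_
  rw [Finset.mul_sum]
  exact Finset.sum_congr rfl fun e _ ↦ by ring

theorem tsum_rpow_le {δ : ℝ} (hδ : 0 < δ) : ∑' n : ℕ, (n : ℝ) ^ (-(1 + δ)) ≤ 2 + 1 / δ := by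
  refine Real.tsum_le_of_sum_range_le (fun n ↦ by positivity) fun n ↦ ?_
  obtain ⟨c, hc, h⟩ := (isLogWeight_rpow hδ).exists_sum_rpow_eq
  have h1 := h (n + 1) (by linarith [n.cast_nonneg (α := ℝ)])
  have h2 : ∑ i ∈ Finset.range n, (i : ℝ) ^ (-(1 + δ)) ≤
      ∑ i ∈ Finset.Ioc 0 ⌊(n + 1 : ℝ)⌋₊, (i : ℝ) ^ (-(1 + δ)) := by
    have hfl : ⌊(n + 1 : ℝ)⌋₊ = n + 1 := by exact_mod_cast Nat.floor_natCast (R := ℝ) (n + 1)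
    rw [hfl]
    calc _ ≤ ∑ i ∈ insert 0 (Finset.Ioc 0 (n + 1)), (i : ℝ) ^ (-(1 + δ)) :=
          Finset.sum_le_sum_of_subset_of_nonneg (fun i hi ↦ by
            simp only [Finset.mem_range, Finset.mem_insert, Finset.mem_Ioc] at hi ⊢; omega)
            fun i _ _ ↦ by positivity
      _ = _ := by
          rw [Finset.sum_insert (by simp), Nat.cast_zero, Real.zero_rpow (by linarith), zero_add]
  have h3 : ((n : ℝ) + 1) ^ (-(1 + δ)) ≤ 1 :=
    Real.rpow_le_one_of_one_le_of_nonpos (by linarith [n.cast_nonneg (α := ℝ)]) (by linarith)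
  have h4 : (1 - ((n : ℝ) + 1) ^ (-δ)) / δ ≤ 1 / δ := by
    gcongr
    have : 0 ≤ ((n : ℝ) + 1) ^ (-δ) := by positivity
    linarith
  have h5 := (abs_le.1 h1).2
  have h6 := (abs_le.1 hc).2
  linarith

/-- The weights `μ(d)`, cut off smoothly on `T^{15/4} < d ≤ T^{19/5}`. -/
noncomputable def mainWeight (T : ℝ) (d : ℕ) : ℝ :=
  ((μ d : ℤ) : ℝ) * if d ≤ ⌊T ^ (15 / 4 : ℝ)⌋₊ then 1 else if d ≤ ⌊T ^ (19 / 5 : ℝ)⌋₊ then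
    (exp (19 / 5) - (d : ℝ) ^ (1 / log T)) / (exp (19 / 5) - exp (15 / 4)) else 0

theorem rpow_rpow_inv_log {T : ℝ} (hT : 1 < T) (a : ℝ) : (T ^ a) ^ (1 / log T) = exp a := by
  have h := Real.log_pos hT
  rw [← Real.rpow_mul (by linarith), Real.rpow_def_of_pos (by linarith)]
  congr 1
  field_simp

theorem mainWeight_eq_zero {T : ℝ} {d : ℕ} (hT : 1 ≤ T) (hd : ⌊T ^ (19 / 5 : ℝ)⌋₊ < d) :
    mainWeight T d = 0 := by
  have : ⌊T ^ (15 / 4 : ℝ)⌋₊ ≤ ⌊T ^ (19 / 5 : ℝ)⌋₊ :=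
    Nat.floor_mono (Real.rpow_le_rpow_of_exponent_le hT (by norm_num))
  simp [mainWeight, not_le.2 hd, not_le.2 (this.trans_lt hd)]

theorem exp_sub_exp_pos : (0 : ℝ) < exp (19 / 5) - exp (15 / 4) :=
  sub_pos.2 (Real.exp_lt_exp.2 (by norm_num))

theorem rpow_inv_log_mem {T : ℝ} (hT : 1 < T) {d : ℕ} {a : ℝ} (ha : 0 < T ^ a) :
    (d ≤ ⌊T ^ a⌋₊ → (d : ℝ) ^ (1 / log T) ≤ exp a) ∧
    (⌊T ^ a⌋₊ < d → exp a ≤ (d : ℝ) ^ (1 / log T)) := by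
  have hL : 0 ≤ 1 / log T := (one_div_pos.2 (Real.log_pos hT)).le
  constructor <;> intro h
  · rw [← rpow_rpow_inv_log hT]
    exact Real.rpow_le_rpow (by positivity) ((Nat.le_floor_iff ha.le).1 h) hL
  · rw [← rpow_rpow_inv_log hT]
    exact Real.rpow_le_rpow ha.le (Nat.lt_of_floor_lt h).le hL

theorem abs_mainWeight_le {T : ℝ} (hT : 1 < T) (d : ℕ) : |mainWeight T d| ≤ 1 := by
  have hpos := exp_sub_exp_pos
  rw [mainWeight, abs_mul]
  refine mul_le_one₀ (abs_moebius_cast_le d) (abs_nonneg _) ?_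
  split_ifs with h1 h2
  · simp
  · have h3 := (rpow_inv_log_mem hT (Real.rpow_pos_of_pos (by linarith) _)).1 h2
    have h4 := (rpow_inv_log_mem hT (Real.rpow_pos_of_pos (by linarith) _)).2 (not_le.1 h1)
    rw [abs_of_nonneg (div_nonneg (by linarith) hpos.le), div_le_one hpos]
    linarith
  · simp

theorem divSum_mainWeight_one {T : ℝ} (hT : 1 ≤ T) : divSum (mainWeight T) 1 = 1 := by
  have : 1 ≤ ⌊T ^ (15 / 4 : ℝ)⌋₊ :=
    (Nat.one_le_floor_iff _).2 (Real.one_le_rpow hT (by norm_num))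
  simp [divSum, mainWeight, this]

theorem sum_divisors_moebius {n : ℕ} (hn : 1 < n) : ∑ d ∈ n.divisors, ((μ d : ℤ) : ℝ) = 0 := by
  have h0 := congrArg (fun F : ArithmeticFunction ℝ ↦ F n) (coe_moebius_mul_coe_zeta (R := ℝ))
  simp only [one_apply] at h0
  rw [coe_mul_zeta_apply, if_neg (by omega)] at h0
  simpa using h0

theorem divSum_mainWeight_eq_zero {T : ℝ} {n : ℕ} (hn : 1 < n) (hnT : n ≤ ⌊T ^ (15 / 4 : ℝ)⌋₊) :
    divSum (mainWeight T) n = 0 := by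
  rw [← sum_divisors_moebius hn, divSum]
  refine Finset.sum_congr rfl fun d hd ↦ ?_
  have : d ≤ ⌊T ^ (15 / 4 : ℝ)⌋₊ := (Nat.divisor_le hd).trans hnT
  simp [mainWeight, this]

theorem exists_sum_mainWeight_le : ∃ C : ℝ, 0 < C ∧ ∀ T : ℝ, exp 1 ≤ T →
    ∑ n ∈ Finset.Ioc 0 ⌊T ^ (37 / 5 : ℝ)⌋₊, divSum (mainWeight T) n ^ 2 / n ≤ C := by
  set E : ℝ := exp (19 / 5) - exp (15 / 4) with hE
  have hEpos : 0 < E := exp_sub_exp_pos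
  refine ⟨exp (37 / 5) * (2 * (exp (19 / 5) / E) ^ 2 * (3 * (9 * exp 12 * 5)) +
    2 * (exp (15 / 4) / E) ^ 2 * (3 * (9 * exp 12 * 5))), by positivity, fun T hT ↦ ?_⟩
  have hT1 : 1 < T := by have := Real.add_one_lt_exp (x := 1) (by norm_num); linarith
  have hT0 : 0 < T := by linarith
  set L := log T with hL
  have hL1 : 1 ≤ L := (Real.le_log_iff_exp_le hT0).2 hT
  have hL0 : 0 < L := by linarith
  have hδ : 0 < 1 / L := by positivity
  set δ := 1 / L with hδdef
  set ℓ : ℝ → ℝ := fun y ↦ (1 - y ^ (-δ)) / δ with hℓ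
  have hW : IsLogWeight (1 + δ) ℓ := isLogWeight_rpow hδ
  have hz : ∀ a : ℝ, 0 ≤ a → 1 ≤ T ^ a := fun a ha ↦ Real.one_le_rpow hT1.le ha
  have hab : ⌊T ^ (15 / 4 : ℝ)⌋₊ ≤ ⌊T ^ (19 / 5 : ℝ)⌋₊ :=
    Nat.floor_mono (Real.rpow_le_rpow_of_exponent_le hT1.le (by norm_num))
  set N := ⌊T ^ (19 / 5 : ℝ)⌋₊ with hN
  set U : ℝ → ℕ → ℝ := fun a d ↦
    if d ≤ ⌊T ^ a⌋₊ then ((μ d : ℤ) : ℝ) * ℓ (T ^ a / d) else 0 with hU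
  have hUsum : ∀ a : ℝ, 0 ≤ a → a ≤ 4 → ⌊T ^ a⌋₊ ≤ N →
      ∑ n ∈ Finset.Ioc 0 ⌊T ^ (37 / 5 : ℝ)⌋₊, divSum (U a) n ^ 2 * (n : ℝ) ^ (-(1 + δ)) ≤
        3 * (9 * exp 12 * 5) * L ^ 2 := by
    intro a ha0 ha4 haN
    refine (sum_divSum_sq_le (by linarith) (N := N) (fun d hd ↦ ?_) _).trans ?_
    · simp only [hU]
      rw [if_neg (by omega)]
    have h1 := hW.lcmForm_le (hz a ha0) haN
    have h2 := tsum_rpow_le hδ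
    have h3 : Real.log (T ^ a) ≤ 4 * L := by
      rw [Real.log_rpow hT0]; exact mul_le_mul_of_nonneg_right ha4 hL0.le
    have h4 : (∑' n : ℕ, (n : ℝ) ^ (-(1 + δ))) ≤ 3 * L := by
      have : 1 / δ = L := by simp [hδdef]
      rw [this] at h2
      linarith
    have h5 : lcmForm (1 + δ) N (U a) ≤ 9 * exp 12 * 5 * L := by
      refine h1.trans ?_
      rw [mul_assoc (9 * exp 12)]
      gcongr
      linarith
    have h6 : (0 : ℝ) ≤ ∑' n : ℕ, (n : ℝ) ^ (-(1 + δ)) := tsum_nonneg fun n ↦ by positivity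
    calc _ ≤ (∑' n : ℕ, (n : ℝ) ^ (-(1 + δ))) * (9 * exp 12 * 5 * L) :=
          mul_le_mul_of_nonneg_left h5 h6
      _ ≤ 3 * L * (9 * exp 12 * 5 * L) := by gcongr
      _ = _ := by ring
  have hmain : ∀ d : ℕ, 0 < d → mainWeight T d =
      exp (19 / 5) / E * δ * U (19 / 5) d - exp (15 / 4) / E * δ * U (15 / 4) d := by
    intro d hd
    have hd0 : (0 : ℝ) < d := by exact_mod_cast hd
    have hℓz : ∀ a : ℝ, exp a * δ * ℓ (T ^ a / d) = exp a - (d : ℝ) ^ δ := by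
      intro a
      have hTa : 0 < T ^ a := Real.rpow_pos_of_pos hT0 a
      have h1 : (T ^ a / d) ^ (-δ) = (d : ℝ) ^ δ / exp a := by
        have hexp : (T ^ a) ^ δ = exp a := rpow_rpow_inv_log hT1 a
        rw [← hexp, Real.div_rpow hTa.le hd0.le, Real.rpow_neg hTa.le,
          Real.rpow_neg hd0.le]
        field_simp
      simp only [hℓ, h1]
      have := (Real.exp_pos a).ne'
      field_simp
    have hsub : ∀ a : ℝ, exp a / E * δ * (((μ d : ℤ) : ℝ) * ℓ (T ^ a / d)) =
        ((μ d : ℤ) : ℝ) * ((exp a - (d : ℝ) ^ δ) / E) := fun a ↦ by rw [← hℓz a]; ring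
    simp only [mainWeight, hU]
    by_cases h1 : d ≤ ⌊T ^ (15 / 4 : ℝ)⌋₊
    · rw [if_pos h1, if_pos h1, if_pos (h1.trans hab), hsub, hsub, ← mul_sub, ← sub_div]
      rw [sub_sub_sub_cancel_right, ← hE, div_self hEpos.ne']
    · by_cases h2 : d ≤ N
      · rw [if_neg h1, if_neg h1, if_pos h2, if_pos h2, hsub, mul_zero, sub_zero]
      · rw [if_neg h1, if_neg h1, if_neg h2, if_neg h2]; simp
  have hdiv : ∀ n : ℕ, divSum (mainWeight T) n = exp (19 / 5) / E * δ * divSum (U (19 / 5)) n -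
      exp (15 / 4) / E * δ * divSum (U (15 / 4)) n := by
    intro n
    rw [divSum, divSum, divSum, Finset.mul_sum, Finset.mul_sum, ← Finset.sum_sub_distrib]
    exact Finset.sum_congr rfl fun d hd ↦ hmain d (Nat.pos_of_mem_divisors hd)
  have hpt : ∀ n ∈ Finset.Ioc 0 ⌊T ^ (37 / 5 : ℝ)⌋₊, divSum (mainWeight T) n ^ 2 / n ≤
      exp (37 / 5) * (2 * (exp (19 / 5) / E * δ) ^ 2 *
        (divSum (U (19 / 5)) n ^ 2 * (n : ℝ) ^ (-(1 + δ))) +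
      2 * (exp (15 / 4) / E * δ) ^ 2 * (divSum (U (15 / 4)) n ^ 2 * (n : ℝ) ^ (-(1 + δ)))) := by
    intro n hn
    rw [Finset.mem_Ioc] at hn
    have hn0 : (0 : ℝ) < n := by exact_mod_cast hn.1
    have h1 : (n : ℝ)⁻¹ ≤ exp (37 / 5) * (n : ℝ) ^ (-(1 + δ)) := by
      have := (rpow_inv_log_mem hT1 (Real.rpow_pos_of_pos hT0 _)).1 hn.2
      rw [neg_add, Real.rpow_add hn0, Real.rpow_neg_one, Real.rpow_neg hn0.le]
      have hp : 0 < (n : ℝ) ^ δ := by positivity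
      calc (n : ℝ)⁻¹ = (n : ℝ) ^ δ * ((n : ℝ)⁻¹ * ((n : ℝ) ^ δ)⁻¹) := by field_simp
        _ ≤ _ := by gcongr
    have h2 : divSum (mainWeight T) n ^ 2 ≤
        2 * (exp (19 / 5) / E * δ) ^ 2 * divSum (U (19 / 5)) n ^ 2 +
        2 * (exp (15 / 4) / E * δ) ^ 2 * divSum (U (15 / 4)) n ^ 2 := by
      rw [hdiv]
      nlinarith [sq_nonneg (exp (19 / 5) / E * δ * divSum (U (19 / 5)) n +
        exp (15 / 4) / E * δ * divSum (U (15 / 4)) n)]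
    rw [div_eq_mul_inv]
    calc _ ≤ (2 * (exp (19 / 5) / E * δ) ^ 2 * divSum (U (19 / 5)) n ^ 2 +
        2 * (exp (15 / 4) / E * δ) ^ 2 * divSum (U (15 / 4)) n ^ 2) *
          (exp (37 / 5) * (n : ℝ) ^ (-(1 + δ))) := by gcongr
      _ = _ := by ring
  refine (Finset.sum_le_sum hpt).trans ?_
  rw [← Finset.mul_sum, Finset.sum_add_distrib, ← Finset.mul_sum, ← Finset.mul_sum]
  have hδL : δ * L = 1 := by simp [hδdef, hL0.ne']
  have key : ∀ c : ℝ, 2 * (c * δ) ^ 2 * (3 * (9 * exp 12 * 5) * L ^ 2) =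
      2 * c ^ 2 * (3 * (9 * exp 12 * 5)) := by
    intro c
    calc _ = 2 * c ^ 2 * (3 * (9 * exp 12 * 5)) * (δ * L) ^ 2 := by ring
      _ = _ := by rw [hδL]; ring
  rw [← key, ← key]
  gcongr
  · exact hUsum _ (by norm_num) (by norm_num) le_rfl
  · exact hUsum _ (by norm_num) (by norm_num) hab

/-- The weights `μ(b) log(z / b) / log z`, `b ≤ z`, with `z = T^{1/50}`. -/
noncomputable def twistWeight (T : ℝ) (b : ℕ) : ℝ :=
  if b ≤ ⌊T ^ (1 / 50 : ℝ)⌋₊ then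
    ((μ b : ℤ) : ℝ) * log (T ^ (1 / 50 : ℝ) / b) / log (T ^ (1 / 50 : ℝ)) else 0

theorem twistWeight_eq_zero {T : ℝ} {b : ℕ} (hb : ⌊T ^ (1 / 50 : ℝ)⌋₊ < b) :
    twistWeight T b = 0 := by
  rw [twistWeight, if_neg (not_le.2 hb)]

theorem abs_twistWeight_le {T : ℝ} (hT : 1 < T) (b : ℕ) : |twistWeight T b| ≤ 1 := by
  rw [twistWeight]
  split_ifs with h
  · have hz : 1 < T ^ (1 / 50 : ℝ) := Real.one_lt_rpow hT (by norm_num)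
    rcases Nat.eq_zero_or_pos b with rfl | hb
    · simp
    have hb1 : (1 : ℝ) ≤ b := by exact_mod_cast hb
    have hbz : (b : ℝ) ≤ T ^ (1 / 50 : ℝ) := (Nat.le_floor_iff (by linarith)).1 h
    have h0 : 1 ≤ T ^ (1 / 50 : ℝ) / b := (one_le_div (by linarith)).2 hbz
    rw [mul_div_assoc, abs_mul]
    refine mul_le_one₀ (abs_moebius_cast_le b) (abs_nonneg _) ?_
    rw [abs_of_nonneg (div_nonneg (Real.log_nonneg h0) (Real.log_pos hz).le),
      div_le_one (Real.log_pos hz)]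
    exact Real.log_le_log (by linarith) (div_le_self (by linarith) hb1)
  · simp

theorem divSum_twistWeight_one {T : ℝ} (hT : 1 < T) : divSum (twistWeight T) 1 = 1 := by
  have hz : 1 < T ^ (1 / 50 : ℝ) := Real.one_lt_rpow hT (by norm_num)
  have : 1 ≤ ⌊T ^ (1 / 50 : ℝ)⌋₊ := (Nat.one_le_floor_iff _).2 hz.le
  have h2 := (Real.log_pos hz).ne'
  simp only [divSum, Nat.divisors_one, Finset.sum_singleton, twistWeight, this, if_true,
    moebius_apply_one, Int.cast_one, Nat.cast_one, div_one, one_mul]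
  exact div_self h2

theorem exists_lcmForm_twistWeight_le : ∃ C : ℝ, 0 < C ∧ ∀ T : ℝ, exp 1 ≤ T →
    lcmForm 1 ⌊T ^ (1 / 50 : ℝ)⌋₊ (twistWeight T) ≤ C / log T := by
  refine ⟨9 * exp 12 * 2 * 50 ^ 2, by positivity, fun T hT ↦ ?_⟩
  have hT1 : 1 < T := by have := Real.add_one_lt_exp (x := 1) (by norm_num); linarith
  have hT0 : 0 < T := by linarith
  have hL1 : 1 ≤ log T := (Real.le_log_iff_exp_le hT0).2 hT
  have hz : 1 ≤ T ^ (1 / 50 : ℝ) := Real.one_le_rpow hT1.le (by norm_num)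
  have h1 := isLogWeight_log.lcmForm_le hz le_rfl
  have hlog : log (T ^ (1 / 50 : ℝ)) = log T / 50 := by rw [Real.log_rpow hT0]; ring
  have h2 : lcmForm 1 ⌊T ^ (1 / 50 : ℝ)⌋₊ (twistWeight T) = (50 / log T) ^ 2 *
      lcmForm 1 ⌊T ^ (1 / 50 : ℝ)⌋₊ (fun d ↦ if d ≤ ⌊T ^ (1 / 50 : ℝ)⌋₊ then
        ((μ d : ℤ) : ℝ) * log (T ^ (1 / 50 : ℝ) / d) else 0) := by
    rw [lcmForm, lcmForm, Finset.mul_sum]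
    refine Finset.sum_congr rfl fun d hd ↦ ?_
    rw [Finset.mul_sum]
    refine Finset.sum_congr rfl fun e he ↦ ?_
    rw [Finset.mem_Ioc] at hd he
    simp only [twistWeight, hd.2, he.2, if_true, hlog]
    field_simp
  rw [h2]
  calc _ ≤ (50 / log T) ^ 2 * (9 * exp 12 * (2 * log T)) := by
        gcongr
        refine h1.trans ?_
        gcongr
        rw [hlog]
        linarith
    _ = _ := by field_simp

end ZeroDensity

namespace ZeroDensity
open Filter Topology

theorem isOpen_re_pos : IsOpen {s : ℂ | 0 < s.re} :=
  isOpen_lt continuous_const Complex.continuous_re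

/-- Analytic continuation of an approximation from `Re s > 1` to `Re s > 0`. -/
theorem norm_sub_le_of_cauchy {G : ℕ → ℂ → ℂ} {F : ℂ → ℂ} {B : ℂ → ℝ}
    (hG : ∀ n, 0 < n → DifferentiableOn ℂ (G n) {s | 0 < s.re})
    (hF : DifferentiableOn ℂ F {s | 0 < s.re})
    (hB : ContinuousOn B {s | 0 < s.re})
    (hGB : ∀ s : ℂ, 0 < s.re → ∀ M N : ℕ, 0 < M → M ≤ N →
      ‖G N s - G M s‖ ≤ B s * (M : ℝ) ^ (-s.re))
    (hlim : ∀ s : ℂ, 1 < s.re → Tendsto (fun n ↦ G n s) atTop (𝓝 (F s)))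
    {s : ℂ} (hs : 0 < s.re) {M : ℕ} (hM : 0 < M) :
    ‖F s - G M s‖ ≤ B s * (M : ℝ) ^ (-s.re) := by
  have hpow : ∀ σ : ℝ, 0 < σ → Tendsto (fun n : ℕ ↦ (n : ℝ) ^ (-σ)) atTop (𝓝 0) := fun σ hσ ↦
    (tendsto_rpow_neg_atTop hσ).comp tendsto_natCast_atTop_atTop
  have hex : ∀ s : ℂ, 0 < s.re → ∃ l, Tendsto (fun n ↦ G n s) atTop (𝓝 l) := by
    intro s hs
    refine cauchySeq_tendsto_of_complete (Metric.cauchySeq_iff'.2 fun ε hε ↦ ?_)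
    have h1 : Tendsto (fun n : ℕ ↦ B s * (n : ℝ) ^ (-s.re)) atTop (𝓝 0) := by
      simpa using (hpow _ hs).const_mul (B s)
    obtain ⟨M, hM, hM0⟩ := ((h1.eventually (gt_mem_nhds hε)).and (eventually_gt_atTop 0)).exists
    exact ⟨M, fun n hn ↦ by rw [dist_eq_norm]; exact (hGB s hs M n hM0 hn).trans_lt hM⟩
  choose! H hH using hex
  have hHG : ∀ s : ℂ, 0 < s.re → ∀ M : ℕ, 0 < M → ‖H s - G M s‖ ≤ B s * (M : ℝ) ^ (-s.re) := by
    intro s hs M hM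
    refine le_of_tendsto ((hH s hs).sub_const (G M s)).norm ?_
    filter_upwards [eventually_ge_atTop M] with N hN using hGB s hs M N hM hN
  have hunif : TendstoLocallyUniformlyOn G H atTop {s : ℂ | 0 < s.re} := by
    rw [Metric.tendstoLocallyUniformlyOn_iff]
    intro ε hε s hs
    have hs' : 0 < s.re := hs
    refine ⟨{z | B z < B s + 1} ∩ {z | s.re / 2 < z.re} ∩ {z | 0 < z.re}, ?_, ?_⟩
    · refine inter_mem (inter_mem ?_ ?_) self_mem_nhdsWithin
      · exact (hB s hs).eventually (gt_mem_nhds (by linarith))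
      · exact mem_nhdsWithin_of_mem_nhds
          ((isOpen_lt continuous_const Complex.continuous_re).mem_nhds (by simp; linarith))
    · have h1 : Tendsto (fun n : ℕ ↦ |B s + 1| * (n : ℝ) ^ (-(s.re / 2))) atTop (𝓝 0) := by
        simpa using (hpow _ (half_pos hs')).const_mul |B s + 1|
      filter_upwards [h1.eventually (gt_mem_nhds hε), eventually_gt_atTop 0] with n hn hn0 z hz
      obtain ⟨⟨hz1, hz2⟩, hz3⟩ := hz
      rw [dist_eq_norm]
      refine (hHG z hz3 n hn0).trans_lt (lt_of_le_of_lt ?_ hn)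
      have hn1 : (1 : ℝ) ≤ n := by exact_mod_cast hn0
      simp only [Set.mem_ofPred_eq] at hz1 hz2
      refine mul_le_mul (hz1.le.trans (le_abs_self _)) ?_ (by positivity) (abs_nonneg _)
      exact Real.rpow_le_rpow_of_exponent_le hn1 (by linarith)
  have hHd : DifferentiableOn ℂ H {s : ℂ | 0 < s.re} :=
    hunif.differentiableOn ((eventually_gt_atTop 0).mono hG) isOpen_re_pos
  have heq : Set.EqOn H F {s : ℂ | 0 < s.re} := by
    refine (hHd.analyticOnNhd isOpen_re_pos).eqOn_of_preconnected_of_eventuallyEq (z₀ := 2)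
      (hF.analyticOnNhd isOpen_re_pos) (convex_halfSpace_re_gt 0).isPreconnected (by simp) ?_
    have : {s : ℂ | 1 < s.re} ∈ 𝓝 (2 : ℂ) :=
      (isOpen_lt continuous_const Complex.continuous_re).mem_nhds (by simp)
    filter_upwards [this] with s hs
    have hs1 : 1 < s.re := hs
    exact tendsto_nhds_unique (hH s (by linarith)) (hlim s hs1)
  rw [← heq hs]
  exact hHG s hs M hM

theorem norm_natCast_cpow_neg_sub_le {s : ℂ} (hs : 0 < s.re) {n : ℕ} (hn : 0 < n) :
    ‖(n : ℂ) ^ (-s)‖ ≤ ‖s‖ / s.re * (n : ℝ) ^ (-s.re) ∧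
    ‖(n : ℂ) ^ (-s) - ((n + 1 : ℕ) : ℂ) ^ (-s)‖ ≤
      ‖s‖ / s.re * ((n : ℝ) ^ (-s.re) - ((n + 1 : ℕ) : ℝ) ^ (-s.re)) := by
  have hn0 : (0 : ℝ) < n := by exact_mod_cast hn
  constructor
  · have h := norm_cpow_neg hn0 s
    rw [Complex.ofReal_natCast] at h
    rw [h]
    refine le_mul_of_one_le_left (by positivity) ?_
    rw [one_le_div hs]
    exact (le_abs_self _).trans (Complex.abs_re_le_norm s)
  · have h := norm_cpow_neg_sub_le (s := s) hn0 (b := ((n + 1 : ℕ) : ℝ)) (by push_cast; linarith) hs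
    simpa only [Complex.ofReal_natCast] using h

/-- Partial summation against `n^{-s}` for coefficients with bounded partial sums. -/
theorem norm_sum_mul_cpow_le {a : ℕ → ℂ} {B : ℝ} {s : ℂ} (hs : 0 < s.re) (M N : ℕ)
    (ha : ∀ n ≤ N, ‖∑ k ∈ Finset.Ioc M n, a k‖ ≤ B) :
    ‖∑ n ∈ Finset.Ioc M N, a n * (n : ℂ) ^ (-s)‖ ≤
      B * (‖s‖ / s.re * ((M + 1 : ℕ) : ℝ) ^ (-s.re)) :=
  norm_sum_Ioc_mul_le a (fun n : ℕ ↦ (n : ℂ) ^ (-s)) (fun n : ℕ ↦ (n : ℝ) ^ (-s.re)) M N ha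
    (fun n hn ↦ (norm_natCast_cpow_neg_sub_le hs (by omega)).1)
    (fun n hn ↦ (norm_natCast_cpow_neg_sub_le hs (by omega)).2)

theorem norm_sum_character_le {q : ℕ} [NeZero q] {χ : DirichletCharacter ℂ q} (hχ : χ ≠ 1)
    (M N : ℕ) : ‖∑ k ∈ Finset.Ioc M N, χ k‖ ≤ q := by
  have hq : 0 < q := Nat.pos_of_ne_zero (NeZero.ne q)
  induction N using Nat.strong_induction_on with
  | _ N ih =>
  by_cases h : N < M + q
  · calc ‖∑ k ∈ Finset.Ioc M N, χ k‖ ≤ ∑ k ∈ Finset.Ioc M N, (1 : ℝ) :=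
        norm_sum_le_of_le _ fun k _ ↦ χ.norm_le_one k
      _ ≤ q := by
        simp only [Finset.sum_const, Nat.card_Ioc, nsmul_eq_mul, mul_one]
        exact_mod_cast (by omega : N - M ≤ q)
  · have h0 : ∑ k ∈ Finset.Ioc (N - q) N, χ k = 0 := by
      have h1 : ∑ x : ZMod q, χ x = 0 := MulChar.sum_eq_zero_of_ne_one hχ
      rw [← h1]
      refine Finset.sum_nbij (fun k : ℕ ↦ (k : ZMod q)) (by simp) ?_ ?_ (by simp)
      · intro a ha b hb hab
        simp only [Finset.coe_Ioc, Set.mem_Ioc] at ha hb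
        have := (ZMod.natCast_eq_natCast_iff a b q).1 hab
        have h3 := (Nat.modEq_iff_dvd.1 this)
        obtain ⟨c, hc⟩ := h3
        have : c = 0 := by
          by_contra hc0
          have : (q : ℤ) ≤ |(b : ℤ) - a| := by
            rw [hc, abs_mul, abs_of_nonneg (by positivity)]
            exact le_mul_of_one_le_right (by positivity) (Int.one_le_abs hc0)
          rcases le_abs.1 this with h | h <;> omega
        subst this
        omega
      · have hcard : (Finset.Ioc (N - q) N).card = Fintype.card (ZMod q) := by
          rw [Nat.card_Ioc, ZMod.card]; omega
        intro x _
        set k := N - (((N : ZMod q) - x).val) with hk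
        have hlt : (((N : ZMod q) - x).val) < q := ZMod.val_lt _
        refine ⟨k, by simp only [Finset.coe_Ioc, Set.mem_Ioc]; omega, ?_⟩
        simp only [hk]
        rw [Nat.cast_sub (by omega), ZMod.natCast_zmod_val]
        ring
    have h2 := Finset.sum_Ioc_consecutive (fun k : ℕ ↦ χ k) (by omega : M ≤ N - q)
      (by omega : N - q ≤ N)
    rw [← h2, h0, add_zero]
    exact ih _ (by omega)

theorem norm_LFunction_sub_sum_le {q : ℕ} [NeZero q] {χ : DirichletCharacter ℂ q} (hχ : χ ≠ 1)
    {s : ℂ} (hs : 0 < s.re) {M : ℕ} (hM : 0 < M) :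
    ‖χ.LFunction s - ∑ n ∈ Finset.Ioc 0 M, χ n * (n : ℂ) ^ (-s)‖ ≤
      q * (‖s‖ / s.re) * (M : ℝ) ^ (-s.re) := by
  refine norm_sub_le_of_cauchy (G := fun M s ↦ ∑ n ∈ Finset.Ioc 0 M, χ n * (n : ℂ) ^ (-s))
    (F := χ.LFunction) (B := fun s ↦ q * (‖s‖ / s.re)) ?_ ?_ ?_ ?_ ?_ hs hM
  · intro n _ s _
    refine DifferentiableAt.differentiableWithinAt ?_
    refine DifferentiableAt.fun_sum fun k hk ↦ ?_
    have : (k : ℂ) ≠ 0 := by exact_mod_cast (Finset.mem_Ioc.1 hk).1.ne'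
    exact (differentiableAt_id.neg.const_cpow (Or.inl this)).const_mul _
  · exact (DirichletCharacter.differentiable_LFunction hχ).differentiableOn
  · refine continuousOn_const.mul (continuous_norm.continuousOn.div
      Complex.continuous_re.continuousOn fun s hs ↦ ?_)
    exact (show 0 < s.re from hs).ne'
  · intro s hs M N hM hMN
    have h := Finset.sum_Ioc_consecutive (fun n : ℕ ↦ χ n * (n : ℂ) ^ (-s)) (Nat.zero_le M) hMN
    rw [← h, add_sub_cancel_left]
    refine (norm_sum_mul_cpow_le hs M N (B := q) fun n _ ↦ norm_sum_character_le hχ M n).trans ?_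
    rw [← mul_assoc]
    refine mul_le_mul_of_nonneg_left ?_ (by positivity)
    refine Real.rpow_le_rpow_of_nonpos (by exact_mod_cast hM) (by push_cast; linarith) (by linarith)
  · intro s hs
    have h := (DirichletCharacter.LSeriesSummable_of_one_lt_re χ hs).hasSum.tendsto_sum_nat.comp
      (tendsto_add_atTop_nat 1)
    rw [DirichletCharacter.LFunction_eq_LSeries χ hs]
    refine h.congr fun n ↦ ?_
    simp only [Function.comp]
    rw [Finset.range_eq_Ico, Finset.sum_eq_sum_Ico_succ_bot (by omega)]
    simp only [LSeries.term_zero, zero_add]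
    refine Finset.sum_congr (by ext; simp; omega) fun k hk ↦ ?_
    rw [LSeries.term_of_ne_zero (by simp at hk; omega), Complex.cpow_neg, div_eq_mul_inv]

theorem norm_LFunction_le {q : ℕ} [NeZero q] {χ : DirichletCharacter ℂ q} (hχ : χ ≠ 1)
    {s : ℂ} (hs : 0 < s.re) : ‖χ.LFunction s‖ ≤ 1 + q * (‖s‖ / s.re) := by
  have h := norm_LFunction_sub_sum_le hχ hs one_pos
  simp only [Nat.cast_one, Real.one_rpow, mul_one] at h
  have h2 : ∑ n ∈ Finset.Ioc (0 : ℕ) 1, χ n * (n : ℂ) ^ (-s) = 1 := by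
    simp
  rw [h2] at h
  calc ‖χ.LFunction s‖ = ‖1 + (χ.LFunction s - 1)‖ := by congr 1; ring
    _ ≤ ‖(1 : ℂ)‖ + ‖χ.LFunction s - 1‖ := norm_add_le _ _
    _ ≤ _ := by rw [norm_one]; linarith

end ZeroDensity

namespace ZeroDensity
open Filter Topology

theorem hasDerivAt_ofReal_cpow {x : ℝ} (hx : 0 < x) {c : ℂ} (hc : c ≠ 0) :
    HasDerivAt (fun y : ℝ ↦ (y : ℂ) ^ c) (c * (x : ℂ) ^ (c - 1)) x := by
  have h := hasDerivAt_ofReal_cpow_const' (r := c - 1) hx.ne' (by simpa using hc)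
  have h2 := h.const_mul c
  have : (fun y : ℝ ↦ c * ((y : ℂ) ^ (c - 1 + 1) / (c - 1 + 1))) = fun y : ℝ ↦ (y : ℂ) ^ c := by
    funext y
    rw [sub_add_cancel]
    field_simp
  rwa [this] at h2

theorem norm_ofReal_cpow_sub_le {a b K : ℝ} (ha : 0 < a) (hab : a ≤ b) {c : ℂ} (hc : c ≠ 0) (w : ℂ)
    (hK : ∀ x ∈ Set.Ico a b, ‖(x : ℂ) ^ (c - 1) - w‖ ≤ K) :
    ‖(b : ℂ) ^ c - (a : ℂ) ^ c - c * w * (b - a)‖ ≤ ‖c‖ * K * (b - a) := by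
  have h := norm_image_sub_le_of_norm_deriv_le_segment'
    (f := fun y : ℝ ↦ (y : ℂ) ^ c - c * w * y) (f' := fun y ↦ c * (y : ℂ) ^ (c - 1) - c * w * 1)
    (a := a) (b := b) (C := ‖c‖ * K) ?_ ?_ b ⟨hab, le_rfl⟩
  · calc _ = ‖(b : ℂ) ^ c - c * w * b - ((a : ℂ) ^ c - c * w * a)‖ := by congr 1; ring
      _ ≤ _ := h
  · intro x hx
    refine HasDerivAt.hasDerivWithinAt ?_
    exact (hasDerivAt_ofReal_cpow (ha.trans_le hx.1) hc).sub
      ((hasDerivAt_id x).ofReal_comp.const_mul (c * w))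
  · intro x hx
    rw [mul_one, ← mul_sub, norm_mul]
    exact mul_le_mul_of_nonneg_left (hK x hx) (norm_nonneg _)

theorem norm_cpow_one_sub_sub_le {a b : ℝ} (ha : 0 < a) (hab : a ≤ b) {s : ℂ} (hs : 0 < s.re)
    (hs1 : s ≠ 1) : ‖(b : ℂ) ^ (1 - s) - (a : ℂ) ^ (1 - s)‖ ≤ ‖1 - s‖ * a ^ (-s.re) * (b - a) := by
  have h := norm_ofReal_cpow_sub_le ha hab (sub_ne_zero.2 hs1.symm) 0 (K := a ^ (-s.re)) ?_
  · simpa using h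
  · intro x hx
    rw [sub_zero, show (1 - s - 1 : ℂ) = -s by ring, norm_cpow_neg (ha.trans_le hx.1)]
    exact Real.rpow_le_rpow_of_nonpos ha hx.1 (by linarith)

theorem norm_cpow_one_sub_step_le {n : ℕ} (hn : 0 < n) {s : ℂ} (hs : 0 < s.re) (hs1 : s ≠ 1) :
    ‖(s - 1) * ((n + 1 : ℕ) : ℂ) ^ (-s) + ((n + 1 : ℕ) : ℂ) ^ (1 - s) - (n : ℂ) ^ (1 - s)‖ ≤
      ‖s - 1‖ * (‖s‖ / s.re) * ((n : ℝ) ^ (-s.re) - ((n + 1 : ℕ) : ℝ) ^ (-s.re)) := by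
  have hn0 : (0 : ℝ) < n := by exact_mod_cast hn
  have hn1 : (n : ℝ) ≤ (n + 1 : ℕ) := by push_cast; linarith
  have h := norm_ofReal_cpow_sub_le hn0 hn1 (sub_ne_zero.2 hs1.symm)
    ((((n + 1 : ℕ) : ℝ) : ℂ) ^ (-s))
    (K := ‖s‖ / s.re * ((n : ℝ) ^ (-s.re) - ((n + 1 : ℕ) : ℝ) ^ (-s.re))) ?_
  · have e1 : (((n + 1 : ℕ) : ℝ) - (n : ℝ)) = 1 := by push_cast; ring
    have e2 : ((((n + 1 : ℕ) : ℝ) : ℂ) - ((n : ℝ) : ℂ)) = 1 := by push_cast; ring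
    rw [e1, e2, norm_sub_rev 1 s] at h
    simp only [Complex.ofReal_natCast] at h
    calc _ = ‖((n + 1 : ℕ) : ℂ) ^ (1 - s) - (n : ℂ) ^ (1 - s) -
          (1 - s) * ((n + 1 : ℕ) : ℂ) ^ (-s) * 1‖ := by congr 1; ring
      _ ≤ _ := h
      _ = _ := by ring
  · intro x hx
    rw [show (1 - s - 1 : ℂ) = -s by ring]
    refine (norm_cpow_neg_sub_le (hn0.trans_le hx.1) hx.2.le hs).trans ?_
    refine mul_le_mul_of_nonneg_left ?_ (by positivity)
    have := Real.rpow_le_rpow_of_nonpos hn0 hx.1 (by linarith : -s.re ≤ 0)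
    linarith

/-- `(s - 1) ζ(s)` with its removable singularity filled in. -/
noncomputable def zetaOne : ℂ → ℂ := DirichletCharacter.LFunctionTrivChar₁ 1

theorem differentiable_zetaOne : Differentiable ℂ zetaOne :=
  DirichletCharacter.differentiable_LFunctionTrivChar₁ 1

theorem zetaOne_apply {s : ℂ} (hs : s ≠ 1) : zetaOne s = (s - 1) * riemannZeta s := by
  rw [zetaOne, DirichletCharacter.LFunctionTrivChar₁, Function.update_of_ne hs,
    DirichletCharacter.LFunctionTrivChar, DirichletCharacter.LFunction_modOne_eq]

theorem zetaOne_one_ne_zero : zetaOne 1 ≠ 0 :=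
  DirichletCharacter.LFunctionTrivChar₁_apply_one_ne_zero 1

theorem norm_zetaOne_sub_le {s : ℂ} (hs : 0 < s.re) {M : ℕ} (hM : 0 < M) :
    ‖zetaOne s - ((s - 1) * ∑ n ∈ Finset.Ioc 0 M, (n : ℂ) ^ (-s) + (M : ℂ) ^ (1 - s))‖ ≤
      ‖s - 1‖ * (‖s‖ / s.re) * (M : ℝ) ^ (-s.re) := by
  refine norm_sub_le_of_cauchy
    (G := fun M s ↦ (s - 1) * ∑ n ∈ Finset.Ioc 0 M, (n : ℂ) ^ (-s) + (M : ℂ) ^ (1 - s))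
    (F := zetaOne) (B := fun s ↦ ‖s - 1‖ * (‖s‖ / s.re)) ?_
    differentiable_zetaOne.differentiableOn ?_ ?_ ?_ hs hM
  · intro n hn s _
    refine DifferentiableAt.differentiableWithinAt ?_
    have h0 : ∀ k : ℕ, 0 < k → (k : ℂ) ≠ 0 := fun k hk ↦ by exact_mod_cast hk.ne'
    refine ((differentiableAt_id.sub_const _).mul (DifferentiableAt.fun_sum fun k hk ↦ ?_)).add ?_
    · exact differentiableAt_id.neg.const_cpow (Or.inl (h0 k (Finset.mem_Ioc.1 hk).1))
    · exact (differentiableAt_id.const_sub 1).const_cpow (Or.inl (h0 n hn))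
  · refine ((continuous_id.sub continuous_const).norm.continuousOn).mul
      (continuous_norm.continuousOn.div Complex.continuous_re.continuousOn fun s hs ↦ ?_)
    exact (show 0 < s.re from hs).ne'
  · intro s hs M N hM hMN
    rcases eq_or_ne s 1 with rfl | hs1
    · simp
    suffices h : ‖((s - 1) * ∑ n ∈ Finset.Ioc 0 N, (n : ℂ) ^ (-s) + (N : ℂ) ^ (1 - s)) -
        ((s - 1) * ∑ n ∈ Finset.Ioc 0 M, (n : ℂ) ^ (-s) + (M : ℂ) ^ (1 - s))‖ ≤
        ‖s - 1‖ * (‖s‖ / s.re) * ((M : ℝ) ^ (-s.re) - (N : ℝ) ^ (-s.re)) by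
      refine h.trans (mul_le_mul_of_nonneg_left ?_ (by positivity))
      have : 0 ≤ (N : ℝ) ^ (-s.re) := by positivity
      linarith
    induction N, hMN using Nat.le_induction with
    | base => simp
    | succ n hn ih =>
      have h1 := norm_cpow_one_sub_step_le (hM.trans_le hn) hs hs1
      rw [Finset.sum_Ioc_succ_top (Nat.zero_le n)]
      calc _ = ‖(((s - 1) * ∑ n ∈ Finset.Ioc 0 n, (n : ℂ) ^ (-s) + (n : ℂ) ^ (1 - s)) -
            ((s - 1) * ∑ n ∈ Finset.Ioc 0 M, (n : ℂ) ^ (-s) + (M : ℂ) ^ (1 - s))) +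
            ((s - 1) * ((n + 1 : ℕ) : ℂ) ^ (-s) + ((n + 1 : ℕ) : ℂ) ^ (1 - s) -
              (n : ℂ) ^ (1 - s))‖ := by congr 1; ring
        _ ≤ _ := norm_add_le _ _
        _ ≤ _ := add_le_add ih h1
        _ = _ := by ring
  · intro s hs
    have hs1 : s ≠ 1 := by rintro rfl; simp at hs
    have hs0 : s ≠ 0 := by rintro rfl; simp at hs; linarith
    rw [zetaOne_apply hs1]
    have h := (Complex.summable_one_div_nat_cpow.2 hs).hasSum.tendsto_sum_nat.comp
      (tendsto_add_atTop_nat 1)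
    rw [← zeta_eq_tsum_one_div_nat_cpow hs] at h
    have h2 : Tendsto (fun n : ℕ ↦ (n : ℂ) ^ (1 - s)) atTop (𝓝 0) := by
      rw [tendsto_zero_iff_norm_tendsto_zero]
      have : Tendsto (fun n : ℕ ↦ (n : ℝ) ^ (-(s.re - 1))) atTop (𝓝 0) :=
        (tendsto_rpow_neg_atTop (by linarith)).comp tendsto_natCast_atTop_atTop
      refine this.congr' ?_
      filter_upwards [eventually_gt_atTop 0] with n hn
      have hn0 : (0 : ℝ) < n := by exact_mod_cast hn
      have := norm_cpow_neg hn0 (s - 1)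
      rw [Complex.ofReal_natCast, neg_sub] at this
      rw [this, Complex.sub_re, Complex.one_re]
    have h3 := (h.const_mul (s - 1)).add h2
    rw [add_zero] at h3
    refine h3.congr fun n ↦ ?_
    simp only [Function.comp]
    rw [Finset.range_eq_Ico, Finset.sum_eq_sum_Ico_succ_bot (by omega)]
    simp only [Nat.cast_zero, Complex.zero_cpow hs0, div_zero, zero_add]
    congr 2
    refine Finset.sum_congr (by ext; simp; omega) fun k hk ↦ ?_
    rw [Complex.cpow_neg, one_div]

theorem norm_zetaOne_le {s : ℂ} (hs : 0 < s.re) :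
    ‖zetaOne s‖ ≤ ‖s‖ + ‖s - 1‖ * (‖s‖ / s.re) := by
  have h := norm_zetaOne_sub_le hs one_pos
  simp only [Nat.cast_one, Real.one_rpow, mul_one] at h
  have h2 : (s - 1) * ∑ n ∈ Finset.Ioc (0 : ℕ) 1, (n : ℂ) ^ (-s) + 1 ^ (1 - s) = s := by
    simp
  rw [h2] at h
  calc ‖zetaOne s‖ = ‖s + (zetaOne s - s)‖ := by congr 1; ring
    _ ≤ ‖s‖ + ‖zetaOne s - s‖ := norm_add_le _ _
    _ ≤ _ := by linarith

end ZeroDensity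

namespace ZeroDensity
open Filter Topology

theorem norm_natCast_cpow_two_sub_le {s : ℂ} (hs : 0 < s.re) (hs1 : s ≠ 1) (hs2 : s ≠ 2) {M : ℕ}
    (hM : 0 < M) : ‖(M : ℂ) ^ (2 - s) - (2 - s) * ∑ n ∈ Finset.Ioc 0 M, (n : ℂ) ^ (1 - s)‖ ≤
      ‖1 - s‖ + ‖2 - s‖ * ‖1 - s‖ * ∑ n ∈ Finset.range M, (n : ℝ) ^ (-s.re) := by
  induction M, hM using Nat.le_induction with
  | base =>
    have : (1 : ℂ) - (2 - s) = -(1 - s) := by ring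
    simp only [Nat.succ_eq_add_one, zero_add, Nat.cast_one, Complex.one_cpow, Nat.Ioc_succ_singleton,
      Finset.sum_singleton, mul_one, this, norm_neg]
    have : 0 ≤ ‖2 - s‖ * ‖1 - s‖ * ∑ n ∈ Finset.range 1, (n : ℝ) ^ (-s.re) := by positivity
    linarith
  | succ n hn ih =>
    have hn0 : (0 : ℝ) < n := by exact_mod_cast hn
    have hn1 : (n : ℝ) ≤ (n + 1 : ℕ) := by push_cast; linarith
    have h := norm_ofReal_cpow_sub_le hn0 hn1 (sub_ne_zero.2 hs2.symm)
      ((((n + 1 : ℕ) : ℝ) : ℂ) ^ (1 - s)) (K := ‖1 - s‖ * (n : ℝ) ^ (-s.re)) ?_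
    · have e1 : (((n + 1 : ℕ) : ℝ) - (n : ℝ)) = 1 := by push_cast; ring
      have e2 : ((((n + 1 : ℕ) : ℝ) : ℂ) - ((n : ℝ) : ℂ)) = 1 := by push_cast; ring
      rw [e1, e2, mul_one, mul_one] at h
      simp only [Complex.ofReal_natCast] at h
      rw [Finset.sum_Ioc_succ_top (Nat.zero_le n), Finset.sum_range_succ]
      have hle : (n : ℝ) ^ (-s.re) ≥ 0 := by positivity
      calc _ = ‖((n : ℂ) ^ (2 - s) - (2 - s) * ∑ n ∈ Finset.Ioc 0 n, (n : ℂ) ^ (1 - s)) +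
            (((n + 1 : ℕ) : ℂ) ^ (2 - s) - (n : ℂ) ^ (2 - s) -
              (2 - s) * ((n + 1 : ℕ) : ℂ) ^ (1 - s))‖ := by congr 1; ring
        _ ≤ _ := norm_add_le _ _
        _ ≤ _ := add_le_add ih h
        _ = _ := by ring
    · intro x hx
      rw [show (2 - s - 1 : ℂ) = 1 - s by ring, norm_sub_rev]
      have hx0 := hn0.trans_le hx.1
      refine (norm_cpow_one_sub_sub_le hx0 hx.2.le hs hs1).trans ?_
      have h1 : x ^ (-s.re) ≤ (n : ℝ) ^ (-s.re) :=
        Real.rpow_le_rpow_of_nonpos hn0 hx.1 (by linarith)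
      have h2 : ((n + 1 : ℕ) : ℝ) - x ≤ 1 := by push_cast; linarith [hx.1]
      have h3 : 0 ≤ ((n + 1 : ℕ) : ℝ) - x := by linarith [hx.2]
      calc _ ≤ ‖1 - s‖ * (n : ℝ) ^ (-s.re) * 1 := by gcongr
        _ = _ := mul_one _

theorem sum_range_rpow_le {σ Y : ℝ} (hσ : σ ≤ 1) (hY : 1 ≤ Y) :
    ∑ n ∈ Finset.range ⌊Y⌋₊, (n : ℝ) ^ (-σ) ≤ 1 + Y ^ (1 - σ) * (1 + log Y) := by
  have h1 : ∀ n ∈ Finset.Ioc 0 ⌊Y⌋₊, (n : ℝ) ^ (-σ) ≤ Y ^ (1 - σ) * (n : ℝ)⁻¹ := by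
    intro n hn
    rw [Finset.mem_Ioc] at hn
    have hn0 : (0 : ℝ) < n := by exact_mod_cast hn.1
    have hnY : (n : ℝ) ≤ Y := (Nat.le_floor_iff (by linarith)).1 hn.2
    rw [show -σ = (1 - σ) + -1 by ring, Real.rpow_add hn0, Real.rpow_neg_one]
    gcongr
  have h2 : ∑ n ∈ Finset.range ⌊Y⌋₊, (n : ℝ) ^ (-σ) ≤
      ∑ n ∈ insert 0 (Finset.Ioc 0 ⌊Y⌋₊), (n : ℝ) ^ (-σ) :=
    Finset.sum_le_sum_of_subset_of_nonneg (fun i hi ↦ by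
      simp only [Finset.mem_range, Finset.mem_insert, Finset.mem_Ioc] at hi ⊢; omega)
      fun i _ _ ↦ by positivity
  rw [Finset.sum_insert (by simp)] at h2
  have h3 : ((0 : ℕ) : ℝ) ^ (-σ) ≤ 1 := by
    rw [Nat.cast_zero]
    rcases eq_or_ne (-σ) 0 with h | h
    · rw [h, Real.rpow_zero]
    · rw [Real.zero_rpow h]; norm_num
  have h4 := sum_inv_Ioc_le ⌊Y⌋₊
  have h5 : log ⌊Y⌋₊ ≤ log Y := Real.log_le_log
    (by exact_mod_cast Nat.floor_pos.2 hY) (Nat.floor_le (by linarith))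
  calc _ ≤ _ := h2
    _ ≤ 1 + ∑ n ∈ Finset.Ioc 0 ⌊Y⌋₊, Y ^ (1 - σ) * (n : ℝ)⁻¹ := add_le_add h3 (Finset.sum_le_sum h1)
    _ ≤ _ := by
      rw [← Finset.mul_sum]
      gcongr
      linarith

theorem floor_rpow_neg_le {σ Y : ℝ} (hσ0 : 0 ≤ σ) (hσ : σ ≤ 1) (hY : 1 ≤ Y) :
    (⌊Y⌋₊ : ℝ) ^ (-σ) ≤ 2 * Y ^ (-σ) := by
  have h1 : Y / 2 ≤ ⌊Y⌋₊ := by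
    have h2 := Nat.lt_floor_add_one Y
    have h3 : (1 : ℝ) ≤ ⌊Y⌋₊ := by exact_mod_cast (Nat.floor_pos.2 hY)
    linarith
  calc (⌊Y⌋₊ : ℝ) ^ (-σ) ≤ (Y / 2) ^ (-σ) :=
        Real.rpow_le_rpow_of_nonpos (by linarith) h1 (by linarith)
    _ = 2 ^ σ * Y ^ (-σ) := by
        rw [Real.div_rpow (by linarith) (by norm_num), Real.rpow_neg (by norm_num : (0 : ℝ) ≤ 2)]
        field_simp
    _ ≤ 2 ^ (1 : ℝ) * Y ^ (-σ) := by gcongr; norm_num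
    _ = _ := by rw [Real.rpow_one]

/-- At a zero of `ζ`, the linear weight removes the contribution of the pole. -/
theorem norm_sum_zeta_zero_le {ρ : ℂ} (h0 : 1 / 2 ≤ ρ.re) (h1 : ρ.re ≤ 1) (hρ1 : ρ ≠ 1)
    (hζ : riemannZeta ρ = 0) {κ : ℝ} (hκ : ‖2 - ρ‖ ≤ κ * ‖1 - ρ‖) {Y : ℝ} (hY : 1 ≤ Y) :
    ‖∑ m ∈ Finset.Ioc 0 ⌊Y⌋₊, (m : ℂ) ^ (-ρ) * (1 - (2 - ρ) / (1 - ρ) * (m / Y))‖ ≤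
      (κ + 10 * (‖ρ‖ + 1) * (1 + log Y)) * Y ^ (-ρ.re) := by
  have hρ0 : 0 < ρ.re := by linarith
  have hρ2 : ρ ≠ 2 := by rintro rfl; norm_num at h1
  have hY0 : 0 < Y := by linarith
  set M := ⌊Y⌋₊ with hM
  have hM0 : 0 < M := Nat.floor_pos.2 hY
  have hM0' : (0 : ℝ) < M := by exact_mod_cast hM0
  have hMY : (M : ℝ) ≤ Y := Nat.floor_le hY0.le
  have hYM : Y - M ≤ 1 := by have := Nat.lt_floor_add_one Y; linarith
  have hpos : 0 < ‖1 - ρ‖ := norm_pos_iff.2 (sub_ne_zero.2 hρ1.symm)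
  have hlog : 0 ≤ log Y := Real.log_nonneg hY
  set S1 := ∑ m ∈ Finset.Ioc 0 M, (m : ℂ) ^ (-ρ) with hS1
  set S2 := ∑ m ∈ Finset.Ioc 0 M, (m : ℂ) ^ (1 - ρ) with hS2
  set D := Y ^ (-ρ.re) with hD
  have hDM : (M : ℝ) ^ (-ρ.re) ≤ 2 * D := floor_rpow_neg_le hρ0.le h1 hY
  have hYD : Y * D = Y ^ (1 - ρ.re) := by
    rw [sub_eq_add_neg, Real.rpow_add hY0, Real.rpow_one]
  have hD1 : 1 ≤ Y * D := by rw [hYD]; exact Real.one_le_rpow hY (by linarith)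
  have hD0 : 0 < D := by positivity
  have hE1 : ‖(Y : ℂ) ^ (1 - ρ) - (1 - ρ) * S1‖ ≤ ‖1 - ρ‖ * ((2 * ‖ρ‖ + 1) * (2 * D)) := by
    have a1 := norm_zetaOne_sub_le hρ0 hM0
    rw [zetaOne_apply hρ1, hζ, mul_zero, zero_sub, norm_neg, norm_sub_rev ρ 1] at a1
    have a2 := norm_cpow_one_sub_sub_le hM0' hMY hρ0 hρ1
    rw [Complex.ofReal_natCast] at a2
    have a3 : ‖ρ‖ / ρ.re ≤ 2 * ‖ρ‖ := by
      rw [div_le_iff₀ hρ0]; nlinarith [norm_nonneg ρ]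
    calc _ = ‖((ρ - 1) * S1 + (M : ℂ) ^ (1 - ρ)) + ((Y : ℂ) ^ (1 - ρ) - (M : ℂ) ^ (1 - ρ))‖ := by
          congr 1; ring
      _ ≤ _ := norm_add_le _ _
      _ ≤ ‖1 - ρ‖ * (‖ρ‖ / ρ.re) * (M : ℝ) ^ (-ρ.re) + ‖1 - ρ‖ * (M : ℝ) ^ (-ρ.re) * (Y - M) :=
          add_le_add a1 a2
      _ ≤ ‖1 - ρ‖ * (2 * ‖ρ‖) * (2 * D) + ‖1 - ρ‖ * (2 * D) * 1 := by
          gcongr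
      _ = _ := by ring
  have hE2 : ‖(Y : ℂ) ^ (2 - ρ) - (2 - ρ) * S2‖ ≤ ‖1 - ρ‖ * (Y * D) +
      ‖2 - ρ‖ * ‖1 - ρ‖ * (Y * D + Y * D * (1 + log Y)) + ‖2 - ρ‖ * (Y * D) := by
    have a1 := norm_natCast_cpow_two_sub_le hρ0 hρ1 hρ2 hM0
    have a2 := sum_range_rpow_le h1 hY
    rw [← hM, ← hYD] at a2
    have a3 := norm_ofReal_cpow_sub_le hM0' hMY (sub_ne_zero.2 hρ2.symm) 0 (K := Y * D) ?_
    · simp only [mul_zero, zero_mul, sub_zero, Complex.ofReal_natCast] at a3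
      calc _ = ‖((Y : ℂ) ^ (2 - ρ) - (M : ℂ) ^ (2 - ρ)) +
            ((M : ℂ) ^ (2 - ρ) - (2 - ρ) * S2)‖ := by congr 1; ring
        _ ≤ _ := norm_add_le _ _
        _ ≤ ‖2 - ρ‖ * (Y * D) * (Y - M) + (‖1 - ρ‖ + ‖2 - ρ‖ * ‖1 - ρ‖ *
            ∑ n ∈ Finset.range M, (n : ℝ) ^ (-ρ.re)) := add_le_add a3 a1
        _ ≤ ‖2 - ρ‖ * (Y * D) * 1 + (‖1 - ρ‖ * (Y * D) + ‖2 - ρ‖ * ‖1 - ρ‖ *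
            (Y * D + Y * D * (1 + log Y))) := by
          gcongr
          · exact le_mul_of_one_le_right hpos.le hD1
          · linarith
        _ = _ := by ring
    · intro x hx
      have hx0 := hM0'.trans_le hx.1
      rw [sub_zero, show (2 - ρ - 1 : ℂ) = -(ρ - 1) by ring, norm_cpow_neg hx0, hYD]
      simp only [Complex.sub_re, Complex.one_re, neg_sub]
      exact Real.rpow_le_rpow hx0.le hx.2.le (by linarith)
  have hW : ∑ m ∈ Finset.Ioc 0 M, (m : ℂ) ^ (-ρ) * (1 - (2 - ρ) / (1 - ρ) * (m / Y)) =
      S1 - (2 - ρ) / (1 - ρ) / Y * S2 := by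
    rw [hS1, hS2, Finset.mul_sum, ← Finset.sum_sub_distrib]
    refine Finset.sum_congr rfl fun m hm ↦ ?_
    have : (m : ℂ) ≠ 0 := by exact_mod_cast (Finset.mem_Ioc.1 hm).1.ne'
    rw [sub_eq_add_neg 1 ρ, Complex.cpow_add _ _ this, Complex.cpow_one]
    ring
  have hY1 : (Y : ℂ) ≠ 0 := by exact_mod_cast hY0.ne'
  have hρ1' : 1 - ρ ≠ 0 := sub_ne_zero.2 hρ1.symm
  have hW2 : (1 - ρ) * Y * (S1 - (2 - ρ) / (1 - ρ) / Y * S2) =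
      ((Y : ℂ) ^ (2 - ρ) - (2 - ρ) * S2) - Y * ((Y : ℂ) ^ (1 - ρ) - (1 - ρ) * S1) := by
    rw [show (2 - ρ : ℂ) = 1 + (1 - ρ) by ring, Complex.cpow_add _ _ hY1, Complex.cpow_one]
    field_simp
    ring
  have hn2 : ‖2 - ρ‖ ≤ 2 + ‖ρ‖ := by
    refine (norm_sub_le _ _).trans ?_
    simp
  rw [hW]
  have hfin : ‖1 - ρ‖ * Y * ‖S1 - (2 - ρ) / (1 - ρ) / Y * S2‖ ≤
      ‖1 - ρ‖ * Y * ((κ + 10 * (‖ρ‖ + 1) * (1 + log Y)) * D) := by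
    have e : ‖1 - ρ‖ * Y * ‖S1 - (2 - ρ) / (1 - ρ) / Y * S2‖ =
        ‖(1 - ρ) * Y * (S1 - (2 - ρ) / (1 - ρ) / Y * S2)‖ := by
      rw [norm_mul, norm_mul, Complex.norm_real, Real.norm_of_nonneg hY0.le]
    rw [e, hW2]
    refine (norm_sub_le _ _).trans ?_
    rw [norm_mul, Complex.norm_real, Real.norm_of_nonneg hY0.le]
    calc _ ≤ (‖1 - ρ‖ * (Y * D) + ‖2 - ρ‖ * ‖1 - ρ‖ * (Y * D + Y * D * (1 + log Y)) +
          ‖2 - ρ‖ * (Y * D)) + Y * (‖1 - ρ‖ * ((2 * ‖ρ‖ + 1) * (2 * D))) := by gcongr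
      _ ≤ (‖1 - ρ‖ * (Y * D) + (2 + ‖ρ‖) * ‖1 - ρ‖ * (Y * D + Y * D * (1 + log Y)) +
          κ * ‖1 - ρ‖ * (Y * D)) + Y * (‖1 - ρ‖ * ((2 * ‖ρ‖ + 1) * (2 * D))) := by gcongr
      _ = ‖1 - ρ‖ * Y * D * (1 + (2 + ‖ρ‖) * (2 + log Y) + κ + 2 * (2 * ‖ρ‖ + 1)) := by ring
      _ ≤ ‖1 - ρ‖ * Y * D * (κ + 10 * (‖ρ‖ + 1) * (1 + log Y)) := by
          refine mul_le_mul_of_nonneg_left ?_ (by positivity)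
          nlinarith [norm_nonneg ρ, mul_nonneg (norm_nonneg ρ) hlog]
      _ = _ := by ring
  exact le_of_mul_le_mul_left hfin (by positivity)

end ZeroDensity

namespace ZeroDensity
open Filter Topology Metric

/-- The logarithmic derivative of a zero-free function at the centre of a disc. -/
theorem norm_logDeriv_zero_le {h : ℂ → ℂ} {R M A : ℝ} (hR : 0 < R) (hd : Differentiable ℂ h)
    (h0 : ∀ z ∈ ball (0 : ℂ) R, h z ≠ 0) (hM : ∀ z ∈ ball (0 : ℂ) R, ‖h z‖ ≤ M) (hA : 0 < A)
    (hMA : M ≤ ‖h 0‖ * exp A) : ‖logDeriv h 0‖ ≤ 2 * A / R := by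
  have h00 : h 0 ≠ 0 := h0 0 (mem_ball_self hR)
  have hdl : DifferentiableOn ℂ (logDeriv h) (ball 0 R) :=
    (hd.deriv.differentiableOn).div hd.differentiableOn h0
  obtain ⟨ψ, hψ⟩ := hdl.isExactOn_ball
  set φ : ℂ → ℂ := fun z ↦ ψ z - ψ 0 with hφ
  have hφd : ∀ z ∈ ball (0 : ℂ) R, HasDerivAt φ (logDeriv h z) z := fun z hz ↦ (hψ z hz).sub_const _
  have hφ0 : φ 0 = 0 := by simp [hφ]
  have hexp : ∀ z ∈ ball (0 : ℂ) R, h z = h 0 * Complex.exp (φ z) := by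
    intro z hz
    have hder : ∀ w ∈ ball (0 : ℂ) R, HasDerivAt (fun w ↦ h w * Complex.exp (-φ w)) 0 w := by
      intro w hw
      have h1 := (hd w).hasDerivAt.mul ((hφd w hw).neg.cexp)
      have e : deriv h w * Complex.exp (-φ w) + h w * (Complex.exp (-φ w) * -logDeriv h w) = 0 := by
        rw [logDeriv_apply]
        have := h0 w hw
        field_simp
        ring
      exact e ▸ h1
    have hconst := (convex_ball (0 : ℂ) R).is_const_of_fderivWithin_eq_zero (𝕜 := ℂ)
      (f := fun w ↦ h w * Complex.exp (-φ w))
      (fun w hw ↦ (hder w hw).differentiableAt.differentiableWithinAt)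
      (fun w hw ↦ by
        rw [fderivWithin_eq_fderiv (isOpen_ball.uniqueDiffWithinAt hw) (hder w hw).differentiableAt]
        have := (hder w hw).hasFDerivAt.fderiv
        rw [this]
        ext
        simp)
      hz (mem_ball_self hR)
    simp only [hφ0, neg_zero, Complex.exp_zero, mul_one] at hconst
    rw [← hconst, mul_assoc, ← Complex.exp_add, neg_add_cancel, Complex.exp_zero, mul_one]
  have hre : Set.MapsTo φ (ball 0 R) {z | z.re ≤ A} := by
    intro z hz
    have h1 := hM z hz
    rw [hexp z hz, norm_mul, Complex.norm_exp] at h1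
    have h2 : ‖h 0‖ * exp (φ z).re ≤ ‖h 0‖ * exp A := h1.trans hMA
    exact Real.exp_le_exp.1 (le_of_mul_le_mul_left h2 (norm_pos_iff.2 h00))
  have hb := fun z hz ↦ Complex.borelCaratheodory_zero hA
    (fun z hz ↦ (hφd z hz).differentiableAt.differentiableWithinAt) hre hR (z := z) hz hφ0
  refine le_of_forall_gt_imp_ge_of_dense fun K hK ↦ ?_
  have hK0 : 0 ≤ K := le_trans (by positivity) hK.le
  refine HasDerivAt.le_of_lip' (hφd 0 (mem_ball_self hR)) hK0 ?_
  have hlim : Tendsto (fun z : ℂ ↦ 2 * A / (R - ‖z‖)) (𝓝 0) (𝓝 (2 * A / (R - ‖(0 : ℂ)‖))) :=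
    tendsto_const_nhds.div (tendsto_const_nhds.sub (continuous_norm.tendsto 0)) (by simp [hR.ne'])
  rw [norm_zero, sub_zero] at hlim
  filter_upwards [hlim.eventually (gt_mem_nhds hK), ball_mem_nhds (0 : ℂ) hR] with z hz hzR
  rw [hφ0, sub_zero, sub_zero]
  refine (hb z hzR).trans ?_
  rw [mul_div_right_comm]
  gcongr

/-- An entire function factors over its zeros in a disc. -/
theorem exists_eq_prod_mul {f : ℂ → ℂ} (hf : Differentiable ℂ f) (h0 : f 0 ≠ 0) {R : ℝ}
    (hR : 0 < R) : ∃ (n : ℕ) (a : Fin n → ℂ) (g : ℂ → ℂ), (∀ i, ‖a i‖ ≤ R) ∧ Differentiable ℂ g ∧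
      (∀ z, f z = (∏ i, (z - a i)) * g z) ∧ ∀ z, ‖z‖ ≤ R → g z ≠ 0 := by
  set P : ℕ → Prop := fun n ↦ ∃ (a : Fin n → ℂ) (g : ℂ → ℂ), (∀ i, ‖a i‖ ≤ R) ∧
    Differentiable ℂ g ∧ ∀ z, f z = (∏ i, (z - a i)) * g z with hP
  by_contra! hcon
  have hstep : ∀ n, P n := by
    intro n
    induction n with
    | zero => exact ⟨fun i ↦ i.elim0, f, fun i ↦ i.elim0, hf, fun z ↦ by simp⟩
    | succ n ih =>
      obtain ⟨a, g, ha, hg, hfg⟩ := ih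
      obtain ⟨b, hb, hgb⟩ := hcon n a g ha hg hfg
      refine ⟨Fin.cons b a, dslope g b, fun i ↦ ?_, ?_, fun z ↦ ?_⟩
      · refine Fin.cases (by simpa using hb) (fun j ↦ by simpa using ha j) i
      · have := (Complex.differentiableOn_dslope (f := g) (s := Set.univ) (c := b) univ_mem).2
          hg.differentiableOn
        exact differentiableOn_univ.1 this
      · have h1 := sub_smul_dslope g b z
        rw [hgb, sub_zero, smul_eq_mul] at h1
        rw [hfg z, Fin.prod_univ_succ]
        simp only [Fin.cons_zero, Fin.cons_succ]
        rw [← h1]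
        ring
  obtain ⟨M, hM⟩ := (isCompact_closedBall (0 : ℂ) (3 * R)).exists_bound_of_continuousOn
    hf.continuous.continuousOn
  have hbound : ∀ n : ℕ, ‖f 0‖ * 2 ^ n ≤ M := by
    intro n
    obtain ⟨a, g, ha, hg, hfg⟩ := hstep n
    have hR3 : (3 * R) ≠ 0 := by positivity
    have hg0 : ‖g 0‖ ≤ M / (2 * R) ^ n := by
      refine Complex.norm_le_of_forall_mem_frontier_norm_le (U := ball 0 (3 * R)) isBounded_ball
        hg.diffContOnCl (fun z hz ↦ ?_) (subset_closure (mem_ball_self (by positivity)))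
      rw [frontier_ball _ hR3, mem_sphere_zero_iff_norm] at hz
      have h1 := hM z (by simp [hz])
      rw [hfg z, norm_mul, norm_prod] at h1
      rw [le_div_iff₀ (by positivity), mul_comm]
      refine le_trans (mul_le_mul_of_nonneg_right ?_ (norm_nonneg _)) h1
      rw [← Fin.prod_const n (2 * R)]
      refine Finset.prod_le_prod (fun i _ ↦ by positivity) fun i _ ↦ ?_
      have := norm_sub_norm_le z (a i)
      linarith [ha i]
    have h2 : ‖f 0‖ ≤ R ^ n * ‖g 0‖ := by
      rw [hfg 0, norm_mul, norm_prod]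
      refine mul_le_mul_of_nonneg_right ?_ (norm_nonneg _)
      rw [← Fin.prod_const n R]
      exact Finset.prod_le_prod (fun i _ ↦ norm_nonneg _) fun i _ ↦ by simpa using ha i
    calc ‖f 0‖ * 2 ^ n ≤ R ^ n * (M / (2 * R) ^ n) * 2 ^ n := by
          gcongr
          exact h2.trans (by gcongr)
      _ = M := by rw [mul_pow]; field_simp
  have hpos : 0 < ‖f 0‖ := norm_pos_iff.2 h0
  obtain ⟨n, hn⟩ := pow_unbounded_of_one_lt (M / ‖f 0‖) (one_lt_two (α := ℝ))
  rw [div_lt_iff₀ hpos] at hn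
  linarith [hbound n]

/-- Zeros of `f` in a disc, weighted by their distance to the imaginary axis. -/
theorem sum_zeros_le {f : ℂ → ℂ} (hf : Differentiable ℂ f) {R M A : ℝ} (hR : 0 < R) (h0 : f 0 ≠ 0)
    (hM : ∀ z, ‖z‖ ≤ R → ‖f z‖ ≤ M) (hA : 0 < A) (hMA : M ≤ ‖f 0‖ * exp A)
    (hz : ∀ z, ‖z‖ ≤ R → f z = 0 → z.re ≤ 0) (S : Finset ℂ) (hS : ∀ a ∈ S, ‖a‖ ≤ R ∧ f a = 0) :
    ∑ a ∈ S, (-a.re) * (1 / ‖a‖ ^ 2 - 1 / R ^ 2) ≤ (logDeriv f 0).re + 2 * A / R := by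
  obtain ⟨n, a, g, ha, hg, hfg, hg0⟩ := exists_eq_prod_mul hf h0 hR
  have ha0 : ∀ i, a i ≠ 0 := by
    intro i hi
    apply h0
    rw [hfg 0, Finset.prod_eq_zero (Finset.mem_univ i) (by simp [hi]), zero_mul]
  have hfa : ∀ i, f (a i) = 0 := by
    intro i
    rw [hfg, Finset.prod_eq_zero (Finset.mem_univ i) (by simp), zero_mul]
  set h : ℂ → ℂ := fun z ↦ (∏ i, ((R ^ 2 - (starRingEnd ℂ) (a i) * z) / R)) * g z with hh
  have hRc : (R : ℂ) ≠ 0 := by exact_mod_cast hR.ne'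
  have hfac : ∀ i, Differentiable ℂ fun z : ℂ ↦ (R ^ 2 - (starRingEnd ℂ) (a i) * z) / R :=
    fun i ↦ by fun_prop
  have hhd : Differentiable ℂ h :=
    (Differentiable.fun_finsetProd fun i _ ↦ hfac i).mul hg
  have hfac0 : ∀ i, ∀ z ∈ ball (0 : ℂ) R, ((R ^ 2 - (starRingEnd ℂ) (a i) * z) / R : ℂ) ≠ 0 := by
    intro i z hzb
    rw [mem_ball_zero_iff] at hzb
    refine div_ne_zero (fun h ↦ ?_) hRc
    have h1 : (R : ℂ) ^ 2 = (starRingEnd ℂ) (a i) * z := by linear_combination h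
    have h2 := congrArg norm h1
    rw [norm_pow, Complex.norm_real, norm_mul, Complex.norm_conj, Real.norm_of_nonneg hR.le] at h2
    nlinarith [ha i, norm_nonneg z, norm_nonneg (a i)]
  have hhb0 : ∀ z ∈ ball (0 : ℂ) R, h z ≠ 0 := by
    intro z hzb
    refine mul_ne_zero (Finset.prod_ne_zero_iff.2 fun i _ ↦ hfac0 i z hzb) (hg0 z ?_)
    exact (mem_ball_zero_iff.1 hzb).le
  have hhM : ∀ z ∈ ball (0 : ℂ) R, ‖h z‖ ≤ M := by
    intro z hzb
    refine Complex.norm_le_of_forall_mem_frontier_norm_le (U := ball 0 R) isBounded_ball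
        hhd.diffContOnCl (fun z hz ↦ ?_) (subset_closure hzb)
    rw [frontier_ball _ hR.ne', mem_sphere_zero_iff_norm] at hz
    have h1 : ‖h z‖ = ‖f z‖ := by
      rw [hfg z]
      simp only [hh]
      rw [norm_mul, norm_mul, norm_prod, norm_prod]
      congr 1
      refine Finset.prod_congr rfl fun i _ ↦ ?_
      have h2 : (R : ℂ) ^ 2 = (starRingEnd ℂ) z * z := by
        rw [mul_comm, Complex.mul_conj, Complex.normSq_eq_norm_sq, hz]; norm_cast
      rw [h2, ← sub_mul, ← map_sub, norm_div, norm_mul, Complex.norm_conj, Complex.norm_real,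
        Real.norm_of_nonneg hR.le, hz, mul_div_cancel_right₀ _ hR.ne']
    rw [h1]
    exact hM z hz.le
  have hh0 : ‖f 0‖ ≤ ‖h 0‖ := by
    rw [hfg 0]
    simp only [hh]
    rw [norm_mul, norm_mul, norm_prod, norm_prod]
    refine mul_le_mul_of_nonneg_right ?_ (norm_nonneg _)
    refine Finset.prod_le_prod (fun i _ ↦ norm_nonneg _) fun i _ ↦ ?_
    rw [mul_zero, sub_zero, sq, mul_div_cancel_right₀ _ hRc, Complex.norm_real,
      Real.norm_of_nonneg hR.le]
    simpa using ha i
  have hlogh := norm_logDeriv_zero_le hR hhd hhb0 hhM hA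
    (hMA.trans (mul_le_mul_of_nonneg_right hh0 (exp_pos A).le))
  have hg00 : g 0 ≠ 0 := hg0 0 (by simpa using hR.le)
  have e1 : logDeriv f 0 = ∑ i, (-1 / a i) + logDeriv g 0 := by
    have : f = fun z ↦ (∏ i, (z - a i)) * g z := funext hfg
    rw [this, logDeriv_mul (f := fun z ↦ ∏ i, (z - a i)) 0
      (Finset.prod_ne_zero_iff.2 fun i _ ↦ by simpa using ha0 i) hg00 (by fun_prop) (hg 0),
      logDeriv_prod (fun i _ ↦ by simpa using ha0 i) (fun i _ ↦ by fun_prop)]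
    congr 1
    refine Finset.sum_congr rfl fun i _ ↦ ?_
    rw [logDeriv_apply, deriv_sub_const, deriv_id'', zero_sub, neg_div, one_div_neg_eq_neg_one_div]
  have e2 : logDeriv h 0 = ∑ i, (-(starRingEnd ℂ) (a i) / R ^ 2) + logDeriv g 0 := by
    rw [hh, logDeriv_mul (f := fun z ↦ ∏ i, ((R ^ 2 - (starRingEnd ℂ) (a i) * z) / R)) 0
      (Finset.prod_ne_zero_iff.2 fun i _ ↦ hfac0 i 0 (mem_ball_self hR)) hg00
      ((Differentiable.fun_finsetProd fun i _ ↦ hfac i) 0) (hg 0),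
      logDeriv_prod (f := fun i z ↦ (R ^ 2 - (starRingEnd ℂ) (a i) * z) / R)
        (fun i _ ↦ hfac0 i 0 (mem_ball_self hR)) (fun i _ ↦ hfac i 0)]
    congr 1
    refine Finset.sum_congr rfl fun i _ ↦ ?_
    rw [logDeriv_apply]
    have : HasDerivAt (fun z : ℂ ↦ (R ^ 2 - (starRingEnd ℂ) (a i) * z) / R)
        ((-((starRingEnd ℂ) (a i) * 1)) / R) 0 :=
      (((hasDerivAt_id (0 : ℂ)).const_mul _).const_sub _).div_const _
    rw [this.deriv]
    field_simp
    simp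
  have e3 : ∑ i, (-(a i).re) * (1 / ‖a i‖ ^ 2 - 1 / R ^ 2) =
      (logDeriv f 0).re - (logDeriv h 0).re := by
    rw [e1, e2, Complex.add_re, Complex.add_re, Complex.re_sum, Complex.re_sum,
      add_sub_add_right_eq_sub, ← Finset.sum_sub_distrib]
    refine Finset.sum_congr rfl fun i _ ↦ ?_
    have : (-(starRingEnd ℂ) (a i) / (R : ℂ) ^ 2).re = -(a i).re / R ^ 2 := by
      rw [show (R : ℂ) ^ 2 = ((R ^ 2 : ℝ) : ℂ) by push_cast; rfl, Complex.div_ofReal_re]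
      simp
    rw [this, Complex.div_re, Complex.normSq_eq_norm_sq]
    simp
    ring
  have hterm : ∀ i, 0 ≤ (-(a i).re) * (1 / ‖a i‖ ^ 2 - 1 / R ^ 2) := by
    intro i
    refine mul_nonneg (by linarith [hz _ (ha i) (hfa i)]) (sub_nonneg.2 ?_)
    exact one_div_le_one_div_of_le (by have := norm_pos_iff.2 (ha0 i); positivity)
      (pow_le_pow_left₀ (norm_nonneg _) (ha i) 2)
  have hex : ∀ b ∈ S, ∃ i, a i = b := by
    intro b hb
    have h1 := hfg b
    rw [(hS b hb).2] at h1
    have h2 := (mul_eq_zero.1 h1.symm).resolve_right (hg0 b (hS b hb).1)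
    obtain ⟨i, _, hi⟩ := Finset.prod_eq_zero_iff.1 h2
    exact ⟨i, (sub_eq_zero.1 hi).symm⟩
  have h5 : ∑ b ∈ S, (-b.re) * (1 / ‖b‖ ^ 2 - 1 / R ^ 2) ≤
      ∑ i, (-(a i).re) * (1 / ‖a i‖ ^ 2 - 1 / R ^ 2) := by
    classical
    have hsub : S ⊆ Finset.univ.image a := fun b hb ↦ by
      obtain ⟨i, hi⟩ := hex b hb
      exact Finset.mem_image.2 ⟨i, Finset.mem_univ i, hi⟩
    refine (Finset.sum_le_sum_of_subset_of_nonneg hsub fun b hb _ ↦ ?_).trans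
      (Finset.sum_image_le_of_nonneg fun b hb ↦ ?_)
    · obtain ⟨i, _, rfl⟩ := Finset.mem_image.1 hb
      exact hterm i
    · obtain ⟨i, _, rfl⟩ := Finset.mem_image.1 hb
      exact hterm i
  calc _ ≤ ∑ i, (-(a i).re) * (1 / ‖a i‖ ^ 2 - 1 / R ^ 2) := h5
    _ = (logDeriv f 0).re - (logDeriv h 0).re := e3
    _ ≤ _ := by
      have := (abs_le.1 ((Complex.abs_re_le_norm _).trans hlogh)).1
      linarith

end ZeroDensity

namespace ZeroDensity
open Filter Topology Metric
open scoped Finset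

theorem tsum_norm_LSeries_term_le {f : ℕ → ℂ} (hf : ∀ n, ‖f n‖ ≤ 1) {s : ℂ} (hs : 1 < s.re) :
    ‖LSeries f s‖ ≤ 2 + 1 / (s.re - 1) := by
  have hδ : 0 < s.re - 1 := by linarith
  have hsum : Summable fun n : ℕ ↦ (n : ℝ) ^ (-(1 + (s.re - 1))) :=
    Real.summable_nat_rpow.2 (by linarith)
  refine (tsum_of_norm_bounded hsum.hasSum fun n ↦ ?_).trans (tsum_rpow_le hδ)
  rw [LSeries.norm_term_eq]
  split_ifs with h
  · positivity
  · rw [show -(1 + (s.re - 1)) = -s.re by ring, Real.rpow_neg n.cast_nonneg, div_eq_mul_inv]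
    exact mul_le_of_le_one_left (by positivity) (hf n)

theorem le_norm_LFunction {q : ℕ} [NeZero q] (χ : DirichletCharacter ℂ q) {s : ℂ} (hs : 1 < s.re)
    (hs2 : s.re ≤ 3 / 2) : (s.re - 1) / 2 ≤ ‖χ.LFunction s‖ := by
  have h1 := DirichletCharacter.LSeries.mul_mu_eq_one χ hs
  rw [← DirichletCharacter.LFunction_eq_LSeries χ hs] at h1
  have h2 := tsum_norm_LSeries_term_le
    (f := fun n ↦ χ n * ((ArithmeticFunction.moebius n : ℤ) : ℂ)) (fun n ↦ by
      rw [norm_mul]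
      refine mul_le_one₀ (DirichletCharacter.norm_le_one χ _) (norm_nonneg _) ?_
      rw [Complex.norm_intCast]
      exact abs_moebius_cast_le n) hs
  have h3 := congrArg norm h1
  rw [norm_mul, norm_one] at h3
  have hδ : 0 < s.re - 1 := by linarith
  have h4 : 2 + 1 / (s.re - 1) ≤ 2 / (s.re - 1) := by
    rw [add_div' _ _ _ hδ.ne']
    gcongr
    linarith
  have h5 : 1 ≤ ‖χ.LFunction s‖ * (2 / (s.re - 1)) := by
    refine h3.symm.le.trans ?_
    exact mul_le_mul_of_nonneg_left (h2.trans h4) (norm_nonneg _)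
  rw [← mul_div_assoc, one_le_div hδ] at h5
  linarith

theorem exists_logDeriv_zetaOne_le :
    ∃ C : ℝ, 0 < C ∧ ∀ σ : ℝ, 1 ≤ σ → σ ≤ 2 → ‖logDeriv zetaOne σ‖ ≤ C := by
  have hcont : ContinuousOn (fun σ : ℝ ↦ logDeriv zetaOne σ) (Set.Icc 1 2) := by
    intro σ hσ
    have h1 : ContinuousAt (logDeriv zetaOne) σ := by
      refine differentiable_zetaOne.deriv.continuous.continuousAt.div
        differentiable_zetaOne.continuous.continuousAt ?_
      rcases eq_or_ne (σ : ℂ) 1 with h | h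
      · rw [h]; exact zetaOne_one_ne_zero
      · rw [zetaOne_apply h]
        exact mul_ne_zero (sub_ne_zero.2 h) (riemannZeta_ne_zero_of_one_le_re (by simpa using hσ.1))
    exact (h1.comp Complex.continuous_ofReal.continuousAt).continuousWithinAt
  obtain ⟨C, hC⟩ := isCompact_Icc.exists_bound_of_continuousOn hcont
  exact ⟨max C 1, by positivity, fun σ h1 h2 ↦ (hC σ ⟨h1, h2⟩).trans (le_max_left _ _)⟩

theorem logDeriv_zetaOne_eq {s : ℂ} (hs : 1 < s.re) :
    logDeriv zetaOne s = 1 / (s - 1) + logDeriv riemannZeta s := by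
  have hs1 : s ≠ 1 := by rintro rfl; simp at hs
  have h1 : zetaOne =ᶠ[𝓝 s] fun z ↦ (z - 1) * riemannZeta z := by
    filter_upwards [isOpen_ne.mem_nhds hs1] with z hz using zetaOne_apply hz
  rw [logDeriv_apply, h1.deriv_eq, h1.eq_of_nhds, ← logDeriv_apply,
    logDeriv_mul (f := fun z ↦ z - 1) s (sub_ne_zero.2 hs1) (riemannZeta_ne_zero_of_one_lt_re hs)
      (by fun_prop) (differentiableAt_riemannZeta hs1)]
  congr 1
  rw [logDeriv_apply, deriv_sub_const, deriv_id'']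

theorem exists_logDeriv_LFunction_le : ∃ C : ℝ, 0 < C ∧ ∀ (q : ℕ) [NeZero q]
    (χ : DirichletCharacter ℂ q) (s : ℂ), 1 < s.re → s.re ≤ 3 / 2 →
    ‖logDeriv χ.LFunction s‖ ≤ 1 / (s.re - 1) + C := by
  obtain ⟨C, hC0, hC⟩ := exists_logDeriv_zetaOne_le
  refine ⟨C, hC0, fun q _ χ s hs hs2 ↦ ?_⟩
  have hsr : 1 < ((s.re : ℂ)).re := by simpa using hs
  have h1 := DirichletCharacter.LSeries_twist_vonMangoldt_eq χ hs
  have h2 : ‖logDeriv χ.LFunction s‖ =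
      ‖LSeries ((fun n : ℕ ↦ χ n) * fun n : ℕ ↦ ((ArithmeticFunction.vonMangoldt n : ℝ) : ℂ)) s‖ := by
    rw [h1, logDeriv_apply, DirichletCharacter.deriv_LFunction_eq_deriv_LSeries χ hs,
      DirichletCharacter.LFunction_eq_LSeries χ hs, neg_div, norm_neg]
  have hsumm := ArithmeticFunction.LSeriesSummable_vonMangoldt hsr
  have h3 : ‖LSeries ((fun n : ℕ ↦ χ n) * fun n : ℕ ↦ ((ArithmeticFunction.vonMangoldt n : ℝ) : ℂ)) s‖ ≤
      (LSeries (fun n ↦ ((ArithmeticFunction.vonMangoldt n : ℝ) : ℂ)) (s.re : ℂ)).re := by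
    refine tsum_of_norm_bounded (Complex.hasSum_re hsumm.LSeriesHasSum) fun n ↦ ?_
    rcases eq_or_ne n 0 with rfl | hn
    · simp
    · rw [LSeries.norm_term_eq, if_neg hn, LSeries.term_of_ne_zero hn, Pi.mul_apply, norm_mul,
        ← Complex.ofReal_natCast, ← Complex.ofReal_cpow n.cast_nonneg, ← Complex.ofReal_div,
        Complex.ofReal_re, Complex.norm_real,
        Real.norm_of_nonneg ArithmeticFunction.vonMangoldt_nonneg]
      gcongr
      exact mul_le_of_le_one_left ArithmeticFunction.vonMangoldt_nonneg
        (DirichletCharacter.norm_le_one χ _)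
  rw [h2]
  refine h3.trans ?_
  rw [ArithmeticFunction.LSeries_vonMangoldt_eq_deriv_riemannZeta_div hsr, neg_div,
    ← logDeriv_apply, eq_sub_of_add_eq' (logDeriv_zetaOne_eq hsr).symm]
  have h4 := hC s.re hs.le (by linarith)
  have h5 := (abs_le.1 ((Complex.abs_re_le_norm _).trans h4)).1
  have h6 : (1 / ((s.re : ℂ) - 1)).re = 1 / (s.re - 1) := by
    rw [← Complex.ofReal_one, ← Complex.ofReal_sub, ← Complex.ofReal_div, Complex.ofReal_re]
  rw [Complex.neg_re, Complex.sub_re, h6]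
  linarith

/-- An entire function with the growth of an `L`-function of conductor and height at most `T`. -/
structure IsLFunctionLike (f : ℂ → ℂ) (C T : ℝ) : Prop where
  differentiable : Differentiable ℂ f
  norm_le : ∀ s : ℂ, 1 / 10 ≤ s.re → s.re ≤ 3 → |s.im| ≤ 2 * T + 2 → ‖f s‖ ≤ 400 * T ^ 2
  le_norm : ∀ s : ℂ, 1 < s.re → s.re ≤ 3 / 2 → (s.re - 1) ^ 2 / 2 ≤ ‖f s‖
  logDeriv_le : ∀ s : ℂ, 1 < s.re → s.re ≤ 3 / 2 → (logDeriv f s).re ≤ 2 / (s.re - 1) + C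
  ne_zero : ∀ s : ℂ, 1 < s.re → f s ≠ 0

theorem norm_le_of_abs_im_le {s : ℂ} {T : ℝ} (hT : 2 ≤ T) (h1 : 0 < s.re) (h2 : s.re ≤ 3)
    (h3 : |s.im| ≤ 2 * T + 2) : ‖s‖ ≤ 5 * T := by
  have := Complex.norm_le_abs_re_add_abs_im s
  rw [abs_of_pos h1] at this
  linarith

theorem isLFunctionLike_zetaOne : ∃ C, 0 < C ∧ ∀ T, 2 ≤ T → IsLFunctionLike zetaOne C T := by
  obtain ⟨C, hC0, hC⟩ := exists_logDeriv_LFunction_le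
  refine ⟨C, hC0, fun T hT ↦ ⟨differentiable_zetaOne, fun s h1 h2 h3 ↦ ?_, fun s h1 h2 ↦ ?_,
    fun s h1 h2 ↦ ?_, fun s h1 ↦ ?_⟩⟩
  · have hs : ‖s‖ ≤ 5 * T := norm_le_of_abs_im_le hT (by linarith) h2 h3
    have hs1 : ‖s - 1‖ ≤ 5 * T := by
      have := Complex.norm_le_abs_re_add_abs_im (s - 1)
      have h4 : |(s - 1).re| ≤ 2 := by
          rw [Complex.sub_re, Complex.one_re, abs_le]
          constructor <;> linarith
      have h5 : (s - 1).im = s.im := by simp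
      rw [h5] at this
      linarith
    have h6 : ‖s‖ / s.re ≤ 5 * T * 10 := by
      rw [div_le_iff₀ (by linarith)]
      nlinarith
    calc ‖zetaOne s‖ ≤ ‖s‖ + ‖s - 1‖ * (‖s‖ / s.re) := norm_zetaOne_le (by linarith)
      _ ≤ 5 * T + 5 * T * (5 * T * 10) := by gcongr
      _ ≤ _ := by nlinarith
  · have hs1 : s ≠ 1 := by rintro rfl; simp at h1
    have h4 := le_norm_LFunction (1 : DirichletCharacter ℂ 1) h1 h2
    rw [DirichletCharacter.LFunction_modOne_eq] at h4
    rw [zetaOne_apply hs1, norm_mul]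
    have h5 : s.re - 1 ≤ ‖s - 1‖ := by simpa using Complex.re_le_norm (s - 1)
    calc (s.re - 1) ^ 2 / 2 = (s.re - 1) * ((s.re - 1) / 2) := by ring
      _ ≤ _ := by gcongr
  · have h4 := hC 1 1 s h1 h2
    rw [DirichletCharacter.LFunction_modOne_eq] at h4
    rw [logDeriv_zetaOne_eq h1, Complex.add_re]
    have h5 : s.re - 1 ≤ ‖s - 1‖ := by simpa using Complex.re_le_norm (s - 1)
    have h6 : (1 / (s - 1)).re ≤ 1 / (s.re - 1) := by
      refine (Complex.re_le_norm _).trans ?_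
      rw [norm_div, norm_one]
      exact one_div_le_one_div_of_le (by linarith) h5
    have h7 := (Complex.re_le_norm _).trans h4
    have h8 : 2 / (s.re - 1) = 1 / (s.re - 1) + 1 / (s.re - 1) := by ring
    linarith
  · have hs1 : s ≠ 1 := by rintro rfl; simp at h1
    rw [zetaOne_apply hs1]
    exact mul_ne_zero (sub_ne_zero.2 hs1) (riemannZeta_ne_zero_of_one_lt_re h1)

theorem isLFunctionLike_LFunction : ∃ C, 0 < C ∧ ∀ T, 2 ≤ T → ∀ (q : ℕ) [NeZero q]
    (χ : DirichletCharacter ℂ q), χ ≠ 1 → (q : ℝ) ≤ T → IsLFunctionLike χ.LFunction C T := by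
  obtain ⟨C, hC0, hC⟩ := exists_logDeriv_LFunction_le
  refine ⟨C, hC0, fun T hT q _ χ hχ hq ↦ ⟨DirichletCharacter.differentiable_LFunction hχ,
    fun s h1 h2 h3 ↦ ?_, fun s h1 h2 ↦ ?_, fun s h1 h2 ↦ ?_, fun s h1 ↦ ?_⟩⟩
  · have hs : ‖s‖ ≤ 5 * T := norm_le_of_abs_im_le hT (by linarith) h2 h3
    have h6 : ‖s‖ / s.re ≤ 5 * T * 10 := by
      rw [div_le_iff₀ (by linarith)]
      nlinarith
    calc ‖χ.LFunction s‖ ≤ 1 + q * (‖s‖ / s.re) := norm_LFunction_le hχ (by linarith)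
      _ ≤ 1 + T * (5 * T * 10) := by gcongr
      _ ≤ _ := by nlinarith
  · refine le_trans ?_ (le_norm_LFunction χ h1 h2)
    nlinarith
  · refine ((Complex.re_le_norm _).trans (hC q χ s h1 h2)).trans ?_
    have : 0 < s.re - 1 := by linarith
    gcongr
    norm_num
  · exact DirichletCharacter.LFunction_ne_zero_of_one_le_re χ (Or.inl hχ) h1.le

/-- The number of zeros near the line `Re s = 1`. -/
theorem IsLFunctionLike.card_zeros_le {f : ℂ → ℂ} {C T : ℝ} (hC : 0 < C) (hT : 2 ≤ T)
    (hf : IsLFunctionLike f C T) {r t : ℝ}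
    (hr : 0 < r) (hr2 : r ≤ 1 / 2) (ht : |t| ≤ 2 * T) (S : Finset ℂ)
    (hS : ∀ ρ ∈ S, f ρ = 0 ∧ 1 - r ≤ ρ.re ∧ |ρ.im - t| ≤ r / 4) :
    (#S : ℝ) ≤ (200 + 5 * C) * (1 + r * log T) := by
  classical
  set s₀ : ℂ := ⟨1 + r, t⟩ with hs₀
  set g : ℂ → ℂ := fun z ↦ f (s₀ + z) with hg
  set R : ℝ := 9 / 10 + r with hR
  set A : ℝ := 7 + 2 * log T + 2 / r with hA
  have hlogT : 0 ≤ log T := Real.log_nonneg (by linarith)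
  have hA0 : 0 < A := by positivity
  have hR0 : 0 < R := by positivity
  have hgd : Differentiable ℂ g := hf.differentiable.comp (by fun_prop)
  have hs1 : 1 < s₀.re := by simp [hs₀, hr]
  have hs2 : s₀.re ≤ 3 / 2 := by simp only [hs₀]; linarith
  have hs3 : s₀.re - 1 = r := by simp [hs₀]
  have hg0 : g 0 = f s₀ := by simp [hg]
  have hlog : logDeriv g 0 = logDeriv f s₀ := by
    rw [logDeriv_apply, logDeriv_apply, hg0, hg, deriv_comp_const_add, add_zero]
  have hM : ∀ z : ℂ, ‖z‖ ≤ R → ‖g z‖ ≤ 400 * T ^ 2 := by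
    intro z hz
    have h1 := abs_le.1 ((Complex.abs_re_le_norm z).trans hz)
    have h2 := (Complex.abs_im_le_norm z).trans hz
    refine hf.norm_le _ ?_ ?_ ?_
    · simp only [Complex.add_re, hs₀]; linarith [h1.1]
    · simp only [Complex.add_re, hs₀]; linarith [h1.2]
    · simp only [Complex.add_im, hs₀]
      have := abs_add_le t z.im
      linarith
  have hMA : 400 * T ^ 2 ≤ ‖g 0‖ * exp A := by
    have h1 := hf.le_norm s₀ hs1 hs2
    rw [hs3] at h1
    rw [hg0]
    have h2 : 1 / r ≤ exp (1 / r) := by linarith [Real.add_one_le_exp (1 / r)]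
    have h3 : exp A = exp 7 * T ^ 2 * exp (1 / r) ^ 2 := by
      rw [hA, Real.exp_add, Real.exp_add, ← Real.exp_nat_mul, mul_comm 2 (log T), Real.exp_mul,
        Real.exp_log (by linarith), Real.rpow_two, Nat.cast_ofNat, mul_one_div]
    have h4 : (800 : ℝ) ≤ exp 7 := by
      have := Real.exp_one_gt_d9
      rw [show (7 : ℝ) = ((7 : ℕ) : ℝ) * 1 by norm_num, Real.exp_nat_mul]
      refine le_trans ?_ (pow_le_pow_left₀ (by norm_num) (show (2.7 : ℝ) ≤ exp 1 by linarith) 7)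
      norm_num
    calc 400 * T ^ 2 = r ^ 2 / 2 * (800 * T ^ 2 * (1 / r) ^ 2) := by field_simp; norm_num
      _ ≤ ‖f s₀‖ * (exp 7 * T ^ 2 * exp (1 / r) ^ 2) := by gcongr
      _ = _ := by rw [h3]
  have hg00 : g 0 ≠ 0 := by rw [hg0]; exact hf.ne_zero s₀ hs1
  have hzre : ∀ z, ‖z‖ ≤ R → g z = 0 → z.re ≤ 0 := by
    intro z _ hz
    by_contra! h
    refine hf.ne_zero (s₀ + z) ?_ hz
    rw [Complex.add_re]
    linarith
  have hkey : ∀ ρ ∈ S, ‖ρ - s₀‖ ≤ R ∧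
      1 / 5 / r ≤ (-(ρ - s₀).re) * (1 / ‖ρ - s₀‖ ^ 2 - 1 / R ^ 2) := by
    intro ρ hρ
    obtain ⟨h1, h2, h3⟩ := hS ρ hρ
    have h4 : ρ.re ≤ 1 := by
      by_contra! h
      exact hf.ne_zero ρ h h1
    set x : ℝ := 1 + r - ρ.re with hx
    have hre : -(ρ - s₀).re = x := by simp [hs₀, hx]
    have him : (ρ - s₀).im = ρ.im - t := by simp [hs₀]
    have hx1 : r ≤ x := by linarith
    have hx2 : x ≤ 2 * r := by linarith
    have hnorm : ‖ρ - s₀‖ ^ 2 = x ^ 2 + (ρ.im - t) ^ 2 := by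
      rw [← Complex.normSq_eq_norm_sq, Complex.normSq_apply, him, ← neg_mul_neg, hre]; ring
    have h5 : (ρ.im - t) ^ 2 ≤ (r / 4) ^ 2 :=
      sq_le_sq.2 (by rwa [abs_of_pos (by positivity : 0 < r / 4)])
    have h6 : ‖ρ - s₀‖ ^ 2 ≤ 17 / 16 * x ^ 2 := by rw [hnorm]; nlinarith
    have hR2 : 14 / 5 * r ≤ R := by rw [hR]; linarith
    have hx0 : 0 < x := hr.trans_le hx1
    refine ⟨abs_le_of_sq_le_sq' ?_ hR0.le |>.2, ?_⟩
    · nlinarith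
    · rw [hre]
      have h7 : 0 < ‖ρ - s₀‖ ^ 2 := by rw [hnorm]; positivity
      have h8 : 1 / (17 / 16 * x ^ 2) ≤ 1 / ‖ρ - s₀‖ ^ 2 := one_div_le_one_div_of_le h7 h6
      have h9 : 1 / R ^ 2 ≤ 1 / (14 / 5 * r) ^ 2 :=
        one_div_le_one_div_of_le (by positivity) (pow_le_pow_left₀ (by positivity) hR2 2)
      calc 1 / 5 / r ≤ 16 / 17 * (1 / (2 * r)) - 2 * r * (1 / (14 / 5 * r) ^ 2) := by
            rw [div_le_iff₀ hr]
            field_simp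
            norm_num
        _ ≤ 16 / 17 * (1 / x) - x * (1 / (14 / 5 * r) ^ 2) := by gcongr
        _ = x * (1 / (17 / 16 * x ^ 2) - 1 / (14 / 5 * r) ^ 2) := by field_simp
        _ ≤ _ := by gcongr
  have hmain := sum_zeros_le hgd hR0 hg00 hM hA0 hMA hzre (S.image fun ρ ↦ ρ - s₀) (by
    intro a ha
    obtain ⟨ρ, hρ, rfl⟩ := Finset.mem_image.1 ha
    exact ⟨(hkey ρ hρ).1, by simpa [hg] using (hS ρ hρ).1⟩)
  rw [Finset.sum_image (fun a _ b _ h ↦ sub_left_injective h), hlog] at hmain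
  have hlow : (#S : ℝ) * (1 / 5 / r) ≤
      ∑ ρ ∈ S, (-(ρ - s₀).re) * (1 / ‖ρ - s₀‖ ^ 2 - 1 / R ^ 2) := by
    rw [← nsmul_eq_mul]
    exact Finset.card_nsmul_le_sum _ _ _ fun ρ hρ ↦ (hkey ρ hρ).2
  have hup := hf.logDeriv_le s₀ hs1 hs2
  rw [hs3] at hup
  have hAR : 2 * A / R ≤ 2 * A / (9 / 10) := by
    gcongr
    linarith
  have htot : (#S : ℝ) * (1 / 5 / r) ≤ 2 / r + C + 2 * A / (9 / 10) := by linarith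
  have h1 : (#S : ℝ) = (#S : ℝ) * (1 / 5 / r) * (5 * r) := by field_simp
  rw [h1]
  calc (#S : ℝ) * (1 / 5 / r) * (5 * r) ≤ (2 / r + C + 2 * A / (9 / 10)) * (5 * r) := by gcongr
    _ = 10 + 5 * C * r + 100 / 9 * (7 * r + 2 * (r * log T) + 2) := by
      rw [hA]; field_simp; ring
    _ ≤ _ := by
      have : 0 ≤ r * log T := by positivity
      have h2 : C * r ≤ C * 1 := by gcongr; linarith
      nlinarith [mul_nonneg hC.le this]

end ZeroDensity

namespace ZeroDensity
open scoped Finset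

theorem exists_card_zeros_window_le : ∃ C : ℝ, 0 < C ∧ ∀ T, 2 ≤ T → ∀ (q : ℕ) [NeZero q]
    (χ : DirichletCharacter ℂ q), (q = 1 ∨ χ ≠ 1) → (q : ℝ) ≤ T → ∀ r, 0 < r → r ≤ 1 / 2 →
    ∀ (S : Finset ℂ), (∀ ρ ∈ S, χ.LFunction ρ = 0 ∧ 1 - r ≤ ρ.re ∧ |ρ.im| ≤ T) → ∀ t : ℝ,
    (#{ρ ∈ S | |ρ.im - t| ≤ r / 4} : ℝ) ≤ C * (1 + r * log T) := by
  obtain ⟨C₁, hC₁, h₁⟩ := isLFunctionLike_zetaOne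
  obtain ⟨C₂, hC₂, h₂⟩ := isLFunctionLike_LFunction
  refine ⟨200 + 5 * (C₁ + C₂), by positivity, fun T hT q _ χ hχ hq r hr hr2 S hS t ↦ ?_⟩
  have hlogT : 0 ≤ log T := Real.log_nonneg (by linarith)
  rcases Finset.eq_empty_or_nonempty {ρ ∈ S | |ρ.im - t| ≤ r / 4} with h | ⟨ρ₀, hρ₀⟩
  · rw [h, Finset.card_empty, Nat.cast_zero]
    positivity
  have ht : |t| ≤ 2 * T := by
    rw [Finset.mem_filter] at hρ₀
    have h3 := (hS ρ₀ hρ₀.1).2.2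
    have h4 := abs_sub_abs_le_abs_sub t ρ₀.im
    rw [abs_sub_comm] at h4
    linarith
  have hnn : 0 ≤ 1 + r * log T := by positivity
  by_cases hχ1 : χ = 1
  · have hq1 : q = 1 := hχ.resolve_right (not_not.2 hχ1)
    subst hq1
    refine ((h₁ T hT).card_zeros_le hC₁ hT hr hr2 ht _ fun ρ hρ ↦ ?_).trans
      (mul_le_mul_of_nonneg_right (by linarith) hnn)
    rw [Finset.mem_filter] at hρ
    obtain ⟨h3, h4, -⟩ := hS ρ hρ.1
    rw [DirichletCharacter.LFunction_modOne_eq] at h3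
    refine ⟨?_, h4, hρ.2⟩
    have hρ1 : ρ ≠ 1 := by
      rintro rfl
      exact riemannZeta_ne_zero_of_one_le_re (by simp) h3
    rw [zetaOne_apply hρ1, h3, mul_zero]
  · refine ((h₂ T hT q χ hχ1 hq).card_zeros_le hC₂ hT hr hr2 ht _ fun ρ hρ ↦ ?_).trans
      (mul_le_mul_of_nonneg_right (by linarith) hnn)
    rw [Finset.mem_filter] at hρ
    obtain ⟨h3, h4, -⟩ := hS ρ hρ.1
    exact ⟨h3, h4, hρ.2⟩

theorem exists_card_zeros_le : ∃ C : ℝ, 0 < C ∧ ∀ T, 2 ≤ T → ∀ (q : ℕ) [NeZero q]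
    (χ : DirichletCharacter ℂ q), (q = 1 ∨ χ ≠ 1) → (q : ℝ) ≤ T →
    ∀ (S : Finset ℂ), (∀ ρ ∈ S, χ.LFunction ρ = 0 ∧ 1 / 2 ≤ ρ.re ∧ |ρ.im| ≤ T) →
    (#S : ℝ) ≤ C * (T * (1 + log T)) := by
  obtain ⟨C, hC, h⟩ := exists_card_zeros_window_le
  refine ⟨C * 18, by positivity, fun T hT q _ χ hχ hq S hS ↦ ?_⟩
  have hlogT : 0 ≤ log T := Real.log_nonneg (by linarith)
  set F : ℂ → ℤ := fun ρ ↦ ⌊8 * ρ.im⌋ with hF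
  have hmaps : ∀ ρ ∈ S, F ρ ∈ Finset.Icc ⌊-(8 * T)⌋ ⌊8 * T⌋ := fun ρ hρ ↦ by
    have := abs_le.1 (hS ρ hρ).2.2
    rw [Finset.mem_Icc]
    exact ⟨Int.floor_le_floor (by linarith), Int.floor_le_floor (by linarith)⟩
  rw [Finset.card_eq_sum_card_fiberwise hmaps, Nat.cast_sum]
  have hfib : ∀ j ∈ Finset.Icc ⌊-(8 * T)⌋ ⌊8 * T⌋,
      ((#{ρ ∈ S | F ρ = j} : ℕ) : ℝ) ≤ C * (1 + 1 / 2 * log T) := by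
    intro j _
    refine le_trans ?_ (h T hT q χ hχ hq (1 / 2) (by norm_num) le_rfl S
      (fun ρ hρ ↦ ⟨(hS ρ hρ).1, by linarith [(hS ρ hρ).2.1], (hS ρ hρ).2.2⟩) (j / 8))
    refine Nat.cast_le.2 (Finset.card_le_card fun ρ hρ ↦ ?_)
    rw [Finset.mem_filter] at hρ ⊢
    refine ⟨hρ.1, ?_⟩
    rw [← hρ.2, hF]
    have h1 := Int.floor_le (8 * ρ.im)
    have h2 := Int.lt_floor_add_one (8 * ρ.im)
    rw [abs_le]
    constructor <;> linarith
  refine (Finset.sum_le_card_nsmul _ _ _ hfib).trans ?_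
  have hcard : ((#(Finset.Icc ⌊-(8 * T)⌋ ⌊8 * T⌋) : ℕ) : ℝ) ≤ 18 * T := by
    rw [Int.card_Icc]
    have h1 := Int.floor_le (8 * T)
    have h2 := Int.lt_floor_add_one (-(8 * T))
    have h3 : 0 ≤ ⌊8 * T⌋ + 1 - ⌊-(8 * T)⌋ := by
      have : ⌊-(8 * T)⌋ ≤ ⌊8 * T⌋ := Int.floor_le_floor (by linarith)
      linarith
    have h4 : (((⌊8 * T⌋ + 1 - ⌊-(8 * T)⌋).toNat : ℕ) : ℝ) = ((⌊8 * T⌋ + 1 - ⌊-(8 * T)⌋ : ℤ) : ℝ) := by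
      exact_mod_cast congrArg (Int.cast : ℤ → ℝ) (Int.toNat_of_nonneg h3)
    rw [h4]
    push_cast
    linarith
  rw [nsmul_eq_mul]
  calc _ ≤ 18 * T * (C * (1 + 1 * log T)) := by
        gcongr
        norm_num
    _ = _ := by ring

theorem exists_sum_zeros_le : ∃ C : ℝ, 0 < C ∧ ∀ T, exp 2 ≤ T → ∀ (q : ℕ) [NeZero q]
    (χ : DirichletCharacter ℂ q), (q = 1 ∨ χ ≠ 1) → (q : ℝ) ≤ T → ∀ α : ℝ, 1 / 2 ≤ α → α ≤ 1 →
    ∀ (S : Finset ℂ), (∀ ρ ∈ S, χ.LFunction ρ = 0 ∧ α ≤ ρ.re ∧ |ρ.im| ≤ T) → ∀ γ : ℝ,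
    ∑ ρ ∈ S, 1 / (1 + (log T * (γ - ρ.im)) ^ 2) ≤ C * (1 + (1 - α) * log T) := by
  obtain ⟨C, hC, h⟩ := exists_card_zeros_window_le
  have hsumm : Summable fun j : ℕ ↦ 1 / ((j : ℝ) + 1) ^ 2 := by
    have := (summable_nat_add_iff 1).2 (Real.summable_one_div_nat_pow.2 one_lt_two)
    simpa using this
  set K : ℝ := ∑' j : ℕ, 1 / ((j : ℝ) + 1) ^ 2 with hK
  have hK0 : 0 < K := hsumm.tsum_pos (fun j ↦ by positivity) 0 (by norm_num)
  refine ⟨K * 32 * (2 * (C * 2)), by positivity, fun T hT q _ χ hχ hq α hα hα1 S hS γ ↦ ?_⟩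
  have hT2 : 2 ≤ T := by linarith [Real.add_one_le_exp 2]
  have hL : 2 ≤ log T := (Real.le_log_iff_exp_le (by linarith)).2 hT
  set L := log T
  set r : ℝ := max (1 - α) (1 / L) with hr
  have hr0 : 0 < r := lt_max_of_lt_right (by positivity)
  have hr2 : r ≤ 1 / 2 := max_le (by linarith) (one_div_le_one_div_of_le two_pos hL)
  have hrL : 1 ≤ r * L := by
    rw [← div_le_iff₀ (by linarith)]; exact le_max_right _ _
  have hrL2 : 1 + r * L ≤ 2 * (1 + (1 - α) * L) := by
    have h1 : r ≤ (1 - α) + 1 / L := max_le (by linarith [show 0 < 1 / L by positivity]) (by linarith)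
    have h2 : r * L ≤ (1 - α + 1 / L) * L := by gcongr
    rw [add_mul, one_div_mul_cancel (by linarith)] at h2
    have h3 : 0 ≤ (1 - α) * L := mul_nonneg (by linarith) (by linarith)
    linarith
  set F : ℂ → ℕ := fun ρ ↦ ⌊|γ - ρ.im| / (r / 4)⌋₊ with hF
  have hwin := h T hT2 q χ hχ hq r hr0 hr2 S
    (fun ρ hρ ↦ ⟨(hS ρ hρ).1, by linarith [(hS ρ hρ).2.1, le_max_left (1 - α) (1 / L)],
      (hS ρ hρ).2.2⟩)
  have hfib : ∀ j : ℕ, (#{ρ ∈ S | F ρ = j} : ℝ) ≤ 2 * (C * 2) * (1 + (1 - α) * L) := by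
    intro j
    classical
    have h1 : ({ρ ∈ S | F ρ = j} : Finset ℂ) ⊆ {ρ ∈ S | |ρ.im - (γ + j * (r / 4))| ≤ r / 4} ∪
        {ρ ∈ S | |ρ.im - (γ - j * (r / 4))| ≤ r / 4} := by
      intro ρ hρ
      rw [Finset.mem_filter] at hρ
      have hr4 : 0 < r / 4 := by positivity
      have h2 := Nat.floor_le (a := |γ - ρ.im| / (r / 4)) (by positivity)
      have h3 := Nat.lt_floor_add_one (|γ - ρ.im| / (r / 4))
      rw [show ⌊|γ - ρ.im| / (r / 4)⌋₊ = j from hρ.2] at h2 h3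
      rw [le_div_iff₀ hr4] at h2
      rw [div_lt_iff₀ hr4] at h3
      rw [Finset.mem_union, Finset.mem_filter, Finset.mem_filter]
      rcases le_total γ ρ.im with h4 | h4
      · left
        rw [abs_of_nonpos (by linarith)] at h2 h3
        exact ⟨hρ.1, abs_le.2 ⟨by linarith, by linarith⟩⟩
      · right
        rw [abs_of_nonneg (by linarith)] at h2 h3
        exact ⟨hρ.1, abs_le.2 ⟨by linarith, by linarith⟩⟩
    have h2 := (Finset.card_le_card h1).trans (Finset.card_union_le _ _)
    have h3 : (#{ρ ∈ S | F ρ = j} : ℝ) ≤ (#{ρ ∈ S | |ρ.im - (γ + j * (r / 4))| ≤ r / 4} : ℝ) +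
        (#{ρ ∈ S | |ρ.im - (γ - j * (r / 4))| ≤ r / 4} : ℝ) := by exact_mod_cast h2
    have h4 := hwin (γ + j * (r / 4))
    have h5 := hwin (γ - j * (r / 4))
    have h6 := mul_le_mul_of_nonneg_left hrL2 hC.le
    linarith
  have hterm : ∀ ρ, 1 / (1 + (L * (γ - ρ.im)) ^ 2) ≤ 32 * (1 / ((F ρ : ℝ) + 1) ^ 2) := by
    intro ρ
    have h2 := Nat.floor_le (a := |γ - ρ.im| / (r / 4)) (by positivity)
    rw [le_div_iff₀ (by positivity)] at h2
    have h3 : (F ρ : ℝ) ≤ 4 * |L * (γ - ρ.im)| := by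
      rw [abs_mul, abs_of_pos (by linarith : 0 < L)]
      calc (F ρ : ℝ) ≤ F ρ * (r * L) := le_mul_of_one_le_right (by positivity) hrL
        _ = 4 * (L * (F ρ * (r / 4))) := by ring
        _ ≤ _ := by gcongr
    rw [mul_one_div, div_le_div_iff₀ (by positivity) (by positivity), ← sq_abs (L * (γ - ρ.im))]
    have h4 : (F ρ : ℝ) ^ 2 ≤ 16 * |L * (γ - ρ.im)| ^ 2 := by
      have := pow_le_pow_left₀ (Nat.cast_nonneg _) h3 2
      linarith [mul_pow 4 |L * (γ - ρ.im)| 2]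
    nlinarith [sq_nonneg ((F ρ : ℝ) - 1)]
  calc ∑ ρ ∈ S, 1 / (1 + (L * (γ - ρ.im)) ^ 2) ≤ ∑ ρ ∈ S, 32 * (1 / ((F ρ : ℝ) + 1) ^ 2) :=
        Finset.sum_le_sum fun ρ _ ↦ hterm ρ
    _ = ∑ j ∈ S.image F, (#{ρ ∈ S | F ρ = j} : ℝ) * (32 * (1 / ((j : ℝ) + 1) ^ 2)) := by
        rw [Finset.sum_comp (fun j : ℕ ↦ 32 * (1 / ((j : ℝ) + 1) ^ 2)) F]
        simp only [nsmul_eq_mul]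
    _ ≤ ∑ j ∈ S.image F, 2 * (C * 2) * (1 + (1 - α) * L) * (32 * (1 / ((j : ℝ) + 1) ^ 2)) := by
        gcongr with j _
        exact hfib j
    _ = 2 * (C * 2) * (1 + (1 - α) * L) * 32 * ∑ j ∈ S.image F, 1 / ((j : ℝ) + 1) ^ 2 := by
        rw [Finset.mul_sum]
        exact Finset.sum_congr rfl fun j _ ↦ by ring
    _ ≤ 2 * (C * 2) * (1 + (1 - α) * L) * 32 * K := by
        have : 0 ≤ (1 - α) * L := mul_nonneg (by linarith) (by linarith)
        gcongr
        exact hsumm.sum_le_tsum _ fun j _ ↦ by positivity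
    _ = _ := by ring

end ZeroDensity

namespace ZeroDensity

open scoped ComplexConjugate ZMod

theorem inv_norm_one_sub_exp_le {t : ℝ} (h0 : 0 < t) (h1 : t < 1) :
    ‖1 - Complex.exp (2 * π * Complex.I * t)‖⁻¹ ≤ 1 / 4 * (t⁻¹ + (1 - t)⁻¹) := by
  have hn : ‖1 - Complex.exp (2 * π * Complex.I * t)‖ = 2 * Real.sin (π * t) := by
    have h := Complex.norm_exp_I_mul_ofReal_sub_one (2 * π * t)
    rw [norm_sub_rev, show (2 * π * Complex.I * t : ℂ) = Complex.I * ((2 * π * t : ℝ) : ℂ) by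
      push_cast; ring, h, Real.norm_of_nonneg]
    · ring_nf
    · rw [show 2 * π * t / 2 = π * t by ring]
      have := Real.sin_nonneg_of_nonneg_of_le_pi (x := π * t) (by positivity)
        (by nlinarith [pi_pos])
      positivity
  have key : ∀ u : ℝ, 0 < u → u ≤ 1 / 2 → (2 * Real.sin (π * u))⁻¹ ≤ 1 / 4 * u⁻¹ := by
    intro u hu hu2
    have h := Real.mul_le_sin (x := π * u) (by positivity) (by nlinarith [pi_pos])
    have h2 : 2 / π * (π * u) = 2 * u := by field_simp
    rw [h2] at h
    rw [show 1 / 4 * u⁻¹ = (4 * u)⁻¹ by field_simp]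
    exact inv_anti₀ (by positivity) (by linarith)
  rw [hn]
  have p1 : 0 < t⁻¹ := by positivity
  have p2 : 0 < (1 - t)⁻¹ := inv_pos.mpr (by linarith)
  rcases le_total t (1 / 2) with h | h
  · linarith [key t h0 h]
  · have h3 := key (1 - t) (by linarith) (by linarith)
    rw [show π * (1 - t) = π - π * t by ring, Real.sin_pi_sub] at h3
    linarith

theorem sum_inv_norm_one_sub_root_le {d : ℕ} (hd : 0 < d) (s : Finset ℂ)
    (hs : ∀ z ∈ s, z ^ d = 1 ∧ z ≠ 1) :
    ∑ z ∈ s, ‖1 - z‖⁻¹ ≤ d / 2 * (1 + log d) := by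
  classical
  have hprim := Complex.isPrimitiveRoot_exp d hd.ne'
  set f : ℕ → ℂ := fun j ↦ Complex.exp (2 * π * Complex.I * ((j / d : ℝ) : ℂ)) with hf
  have hfpow : ∀ j, f j = Complex.exp (2 * π * Complex.I / d) ^ j := fun j ↦ by
    rw [hf, ← Complex.exp_nat_mul]; push_cast; ring_nf
  have hsub : s ⊆ (Finset.Ioo 0 d).image f := by
    intro z hz
    obtain ⟨h1, h2⟩ := hs z hz
    have : NeZero d := ⟨hd.ne'⟩
    obtain ⟨i, hi, h3⟩ := hprim.eq_pow_of_pow_eq_one h1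
    refine Finset.mem_image.mpr ⟨i, Finset.mem_Ioo.mpr ⟨?_, hi⟩, by rw [hfpow, h3]⟩
    rcases Nat.eq_zero_or_pos i with h | h
    · subst h; exact absurd (by rw [← h3, pow_zero]) h2
    · exact h
  have hd' : (0 : ℝ) < d := by exact_mod_cast hd
  have hrefl : ∑ j ∈ Finset.Ioo 0 d, ((d - j : ℕ) : ℝ)⁻¹ = ∑ j ∈ Finset.Ioo 0 d, (j : ℝ)⁻¹ := by
    refine Finset.sum_bij' (fun j _ ↦ d - j) (fun j _ ↦ d - j) ?_ ?_ ?_ ?_ ?_ <;>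
      intro j hj <;> rw [Finset.mem_Ioo] at * <;> omega
  have hharm : ∑ j ∈ Finset.Ioo 0 d, (j : ℝ)⁻¹ ≤ 1 + log d :=
    (Finset.sum_le_sum_of_subset_of_nonneg (fun j hj ↦ by
      rw [Finset.mem_Ioo] at hj; rw [Finset.mem_Ioc]; omega)
      (fun _ _ _ ↦ by positivity)).trans (sum_inv_Ioc_le d)
  calc ∑ z ∈ s, ‖1 - z‖⁻¹ ≤ ∑ z ∈ (Finset.Ioo 0 d).image f, ‖1 - z‖⁻¹ :=
        Finset.sum_le_sum_of_subset_of_nonneg hsub fun _ _ _ ↦ by positivity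
    _ ≤ ∑ j ∈ Finset.Ioo 0 d, ‖1 - f j‖⁻¹ :=
        Finset.sum_image_le_of_nonneg fun _ _ ↦ by positivity
    _ ≤ ∑ j ∈ Finset.Ioo 0 d, d / 4 * ((j : ℝ)⁻¹ + ((d - j : ℕ) : ℝ)⁻¹) := by
        refine Finset.sum_le_sum fun j hj ↦ ?_
        rw [Finset.mem_Ioo] at hj
        have hj0 : (0 : ℝ) < j := by exact_mod_cast hj.1
        have hjd : (j : ℝ) < d := by exact_mod_cast hj.2
        refine (inv_norm_one_sub_exp_le (t := j / d) (by positivity)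
          ((div_lt_one hd').mpr hjd)).trans (le_of_eq ?_)
        rw [Nat.cast_sub hj.2.le]
        have : (d : ℝ) - j ≠ 0 := by linarith
        field_simp
    _ ≤ d / 2 * (1 + log d) := by
        rw [← Finset.mul_sum, Finset.sum_add_distrib, hrefl]
        have := mul_le_mul_of_nonneg_left hharm (show (0 : ℝ) ≤ d / 2 by positivity)
        linarith

theorem sum_inv_norm_one_sub_hom_le {G : Type*} [CommGroup G] [Fintype G] (φ : G →* ℂˣ) :
    ∑ x : G with φ x ≠ 1, ‖1 - (φ x : ℂ)‖⁻¹ ≤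
      Fintype.card G / 2 * (1 + log (Fintype.card G)) := by
  classical
  set s : Finset ℂˣ := (Finset.univ.filter (fun x : G ↦ φ x ≠ 1)).image φ with hs
  set K : ℕ := Fintype.card φ.ker with hK
  set d : ℕ := Fintype.card φ.range with hd
  have hKd : K * d = Fintype.card G := by
    have h := φ.ker.card_mul_index
    rw [Subgroup.index_ker] at h
    rwa [Nat.card_eq_fintype_card, Nat.card_eq_fintype_card, Nat.card_eq_fintype_card] at h
  have hd0 : 0 < d := Fintype.card_pos
  have hK0 : 0 < K := Fintype.card_pos
  have hfib : ∀ z ∈ s, ((Finset.univ.filter (fun x : G ↦ φ x ≠ 1)).filter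
      (fun x ↦ φ x = z)).card = K := by
    intro z hz
    obtain ⟨x, hx, rfl⟩ := Finset.mem_image.mp hz
    have hx1 := (Finset.mem_filter.mp hx).2
    have h1 := MonoidHom.card_fiber_eq_of_mem_range φ (x := φ x) (y := 1) ⟨x, rfl⟩ ⟨1, map_one _⟩
    have h2 : (Finset.univ.filter (fun x : G ↦ φ x ≠ 1)).filter (fun y ↦ φ y = φ x) =
        Finset.univ.filter (fun y : G ↦ φ y = φ x) := by
      ext y; simp only [Finset.mem_filter, Finset.mem_univ, true_and]
      exact ⟨fun h ↦ h.2, fun h ↦ ⟨h ▸ hx1, h⟩⟩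
    rw [h2, h1, hK, Fintype.card_subtype]
    simp [MonoidHom.mem_ker]
  rw [Finset.sum_comp (fun z : ℂˣ ↦ ‖1 - (z : ℂ)‖⁻¹) φ]
  have h3 : ∑ b ∈ s, ‖1 - (b : ℂ)‖⁻¹ ≤ d / 2 * (1 + log d) := by
    have := sum_inv_norm_one_sub_root_le hd0 (s.map ⟨Units.val, Units.val_injective⟩) ?_
    · simpa using this
    · intro z hz
      obtain ⟨u, hu, rfl⟩ := Finset.mem_map.mp hz
      obtain ⟨x, hx, rfl⟩ := Finset.mem_image.mp hu
      refine ⟨?_, by simpa using (Finset.mem_filter.mp hx).2⟩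
      have h := pow_card_eq_one' (x := (⟨φ x, x, rfl⟩ : φ.range))
      rw [Nat.card_eq_fintype_card, Subtype.ext_iff] at h
      exact congrArg Units.val h
  have h4 : log d ≤ log (Fintype.card G) := by
    refine log_le_log (by exact_mod_cast hd0) ?_
    rw [← hKd]; exact_mod_cast Nat.le_mul_of_pos_left d hK0
  calc _ = ∑ b ∈ s, (K : ℝ) * ‖1 - (b : ℂ)‖⁻¹ :=
        Finset.sum_congr rfl fun z hz ↦ by rw [hfib z hz, nsmul_eq_mul]
    _ = K * ∑ b ∈ s, ‖1 - (b : ℂ)‖⁻¹ := by rw [Finset.mul_sum]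
    _ ≤ K * (d / 2 * (1 + log (Fintype.card G))) := by
        refine mul_le_mul_of_nonneg_left (h3.trans ?_) (by positivity)
        gcongr
    _ = _ := by rw [← hKd]; push_cast; ring

theorem norm_sum_Ioc_pow_le {z : ℂ} (hz : ‖z‖ = 1) (h1 : z ≠ 1) (M N : ℕ) :
    ‖∑ n ∈ Finset.Ioc M N, z ^ n‖ ≤ 2 * ‖1 - z‖⁻¹ := by
  rcases le_total N M with h | h
  · rw [Finset.Ioc_eq_empty_of_le h]; simp
  have h2 : (1 - z) ≠ 0 := sub_ne_zero.mpr h1.symm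
  have key : ∑ n ∈ Finset.Ioc M N, z ^ n = (z ^ (M + 1) - z ^ (N + 1)) / (1 - z) := by
    rw [eq_div_iff h2]
    induction N, h using Nat.le_induction with
    | base => simp
    | succ n hn ih => rw [Finset.sum_Ioc_succ_top (by omega), add_mul, ih]; ring
  rw [key, norm_div, div_eq_mul_inv]
  gcongr
  refine (norm_sub_le _ _).trans ?_
  rw [norm_pow, norm_pow, hz]; norm_num

theorem norm_gaussSum_stdAddChar {q : ℕ} [NeZero q] {χ : DirichletCharacter ℂ q}
    (hχ : χ.IsPrimitive) : ‖gaussSum χ ZMod.stdAddChar‖ = √q := by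
  have hinv : ∀ k, χ⁻¹ k = conj (χ k) := fun k ↦ by
    rw [← MulChar.star_eq_inv]; rfl
  set c := gaussSum χ ZMod.stdAddChar with hc
  have hF : 𝓕 χ = fun k ↦ c * χ⁻¹ (-k) := by
    ext k; rw [hχ.fourierTransform_eq_inv_mul_gaussSum, mul_comm]
  have h2 := congrFun (ZMod.dft_dft (χ : ZMod q → ℂ)) (-1)
  simp only [neg_neg, map_one, smul_eq_mul, mul_one] at h2
  have h3 : 𝓕 (fun k ↦ c * χ⁻¹ (-k)) (-1) = c * conj (𝓕 χ (-1)) := by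
    rw [ZMod.dft_const_mul, ZMod.dft_comp_neg]
    beta_reduce
    rw [ZMod.dft_apply, ZMod.dft_apply, map_sum]
    congr 1
    refine Finset.sum_congr rfl fun j _ ↦ ?_
    simp only [smul_eq_mul, map_mul, hinv, ← AddChar.map_neg_eq_conj]
    simp
  rw [hF, h3, hF] at h2
  simp only [neg_neg, map_one, mul_one] at h2
  rw [Complex.mul_conj] at h2
  have h4 : Complex.normSq c = q := by exact_mod_cast h2
  rw [Complex.normSq_eq_norm_sq] at h4
  rw [← h4, Real.sqrt_sq (norm_nonneg _)]

theorem eq_sum_dft_mul_stdAddChar {q : ℕ} [NeZero q] (χ : DirichletCharacter ℂ q) (n : ℕ) :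
    χ n = (q : ℂ)⁻¹ * ∑ k : ZMod q, 𝓕 χ k * ZMod.stdAddChar k ^ n := by
  have h := congrFun (ZMod.dft.symm_apply_apply (χ : ZMod q → ℂ)) n
  rw [ZMod.invDFT_apply] at h
  rw [← h, smul_eq_mul]
  congr 1
  refine Finset.sum_congr rfl fun k _ ↦ ?_
  rw [smul_eq_mul, mul_comm, ← AddChar.map_nsmul_eq_pow, nsmul_eq_mul, mul_comm k]

theorem norm_dft_le {q : ℕ} [NeZero q] {χ : DirichletCharacter ℂ q} (hχ : χ.IsPrimitive)
    (k : ZMod q) : ‖𝓕 χ k‖ ≤ √q := by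
  rw [hχ.fourierTransform_eq_inv_mul_gaussSum, norm_mul, norm_gaussSum_stdAddChar hχ]
  exact mul_le_of_le_one_left (by positivity) (DirichletCharacter.norm_le_one _ _)

theorem dft_eq_zero {q : ℕ} [NeZero q] {χ : DirichletCharacter ℂ q} (hχ : χ.IsPrimitive)
    {k : ZMod q} (hk : ¬ IsUnit k) : 𝓕 χ k = 0 := by
  rw [hχ.fourierTransform_eq_inv_mul_gaussSum, MulChar.map_nonunit _ (by simpa using hk), zero_mul]

theorem dvd_of_stdAddChar_mul_eq_one {q₁ q₂ : ℕ} [NeZero q₁] [NeZero q₂] {a : ZMod q₁} {b : ZMod q₂}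
    (ha : IsUnit a) (h : (ZMod.stdAddChar a : ℂ) * ZMod.stdAddChar b = 1) : q₁ ∣ q₂ := by
  have h2 : (ZMod.stdAddChar a : ℂ) ^ q₂ = 1 := by
    have h3 : (ZMod.stdAddChar b : ℂ) ^ q₂ = 1 := by
      rw [← AddChar.map_nsmul_eq_pow, nsmul_eq_mul]; simp
    have := congrArg (· ^ q₂) h
    simpa [mul_pow, h3] using this
  rw [← AddChar.map_nsmul_eq_pow, ← AddChar.map_zero_eq_one (ZMod.stdAddChar (N := q₁)),
    ZMod.injective_stdAddChar.eq_iff, nsmul_eq_mul, ha.mul_left_eq_zero] at h2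
  exact (ZMod.natCast_eq_zero_iff _ _).mp h2

theorem norm_sum_mul_character_le {q₁ q₂ : ℕ} [NeZero q₁] [NeZero q₂] (hq : q₁ ≠ q₂)
    {χ₁ : DirichletCharacter ℂ q₁} {χ₂ : DirichletCharacter ℂ q₂} (h₁ : χ₁.IsPrimitive)
    (h₂ : χ₂.IsPrimitive) (M N : ℕ) :
    ‖∑ k ∈ Finset.Ioc M N, χ₁ k * χ₂ k‖ ≤ √(q₁ * q₂) * (1 + log (q₁ * q₂)) := by
  classical
  set ψ : ZMod q₁ × ZMod q₂ → ℂ := fun x ↦ ZMod.stdAddChar x.1 * ZMod.stdAddChar x.2 with hψ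
  let φ₀ : Multiplicative (ZMod q₁ × ZMod q₂) →* ℂ :=
    { toFun := fun x ↦ ψ x.toAdd
      map_one' := by simp [hψ]
      map_mul' := fun x y ↦ by
        simp only [hψ, toAdd_mul, Prod.fst_add, Prod.snd_add, AddChar.map_add_eq_mul]; ring }
  have hsum := sum_inv_norm_one_sub_hom_le φ₀.toHomUnits
  have hcard : Fintype.card (Multiplicative (ZMod q₁ × ZMod q₂)) = q₁ * q₂ := by
    simp [ZMod.card]
  rw [hcard] at hsum
  have hsum' : ∑ x : ZMod q₁ × ZMod q₂ with ψ x ≠ 1, ‖1 - ψ x‖⁻¹ ≤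
      (q₁ * q₂ : ℕ) / 2 * (1 + log (q₁ * q₂ : ℕ)) := by
    refine le_trans (le_of_eq ?_) hsum
    refine Finset.sum_nbij' (fun x ↦ Multiplicative.ofAdd x) (fun x ↦ x.toAdd) ?_ ?_ ?_ ?_ ?_
    · intro x hx
      simp only [Finset.mem_filter, Finset.mem_univ, true_and] at hx ⊢
      intro h; exact hx (congrArg Units.val h)
    · intro x hx
      simp only [Finset.mem_filter, Finset.mem_univ, true_and] at hx ⊢
      intro h; exact hx (Units.ext h)
    · intro x _; rfl
    · intro x _; rfl
    · intro x _; rfl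
  have hnorm : ∀ x, ‖ψ x‖ = 1 := fun x ↦ by simp [hψ, AddChar.norm_apply]
  have hq1 : (0 : ℝ) < q₁ := by exact_mod_cast NeZero.pos q₁
  have hq2 : (0 : ℝ) < q₂ := by exact_mod_cast NeZero.pos q₂
  have expand : ∑ k ∈ Finset.Ioc M N, χ₁ k * χ₂ k = (q₁ * q₂ : ℂ)⁻¹ *
      ∑ x : ZMod q₁ × ZMod q₂, 𝓕 χ₁ x.1 * 𝓕 χ₂ x.2 * ∑ n ∈ Finset.Ioc M N, ψ x ^ n := by
    simp_rw [Finset.mul_sum (Finset.Ioc M N)]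
    rw [Finset.sum_comm, Finset.mul_sum]
    refine Finset.sum_congr rfl fun n _ ↦ ?_
    rw [eq_sum_dft_mul_stdAddChar χ₁, eq_sum_dft_mul_stdAddChar χ₂, mul_mul_mul_comm,
      Finset.sum_mul_sum, mul_inv, Fintype.sum_prod_type]
    congr 1
    refine Finset.sum_congr rfl fun a _ ↦ Finset.sum_congr rfl fun b _ ↦ ?_
    simp only [hψ, mul_pow]; ring
  rw [expand, norm_mul]
  have hb : ‖∑ x : ZMod q₁ × ZMod q₂, 𝓕 χ₁ x.1 * 𝓕 χ₂ x.2 * ∑ n ∈ Finset.Ioc M N, ψ x ^ n‖ ≤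
      ∑ x : ZMod q₁ × ZMod q₂ with ψ x ≠ 1, √(q₁ * q₂) * (2 * ‖1 - ψ x‖⁻¹) := by
    refine (norm_sum_le _ _).trans ?_
    rw [Finset.sum_filter]
    refine Finset.sum_le_sum fun x _ ↦ ?_
    split_ifs with h
    · rw [norm_mul, norm_mul, Real.sqrt_mul hq1.le]
      exact mul_le_mul (mul_le_mul (norm_dft_le h₁ _) (norm_dft_le h₂ _) (norm_nonneg _)
        (by positivity)) (norm_sum_Ioc_pow_le (hnorm x) h M N) (norm_nonneg _) (by positivity)
    · rw [not_not] at h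
      have : 𝓕 χ₁ x.1 * 𝓕 χ₂ x.2 = 0 := by
        by_contra hne
        have u1 : IsUnit x.1 := by
          by_contra hu; exact hne (by rw [dft_eq_zero h₁ hu, zero_mul])
        have u2 : IsUnit x.2 := by
          by_contra hu; exact hne (by rw [dft_eq_zero h₂ hu, mul_zero])
        exact hq (Nat.dvd_antisymm (dvd_of_stdAddChar_mul_eq_one u1 h)
          (dvd_of_stdAddChar_mul_eq_one u2 (by rw [mul_comm]; exact h)))
      rw [this]; simp
  have hnq : ‖(q₁ * q₂ : ℂ)⁻¹‖ = ((q₁ : ℝ) * q₂)⁻¹ := by simp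
  rw [hnq]
  calc _ ≤ ((q₁ : ℝ) * q₂)⁻¹ * (√(q₁ * q₂) * (2 * ((q₁ * q₂ : ℕ) / 2 *
        (1 + log (q₁ * q₂ : ℕ))))) := by
        refine mul_le_mul_of_nonneg_left (hb.trans ?_) (by positivity)
        rw [← Finset.mul_sum, ← Finset.mul_sum]
        exact mul_le_mul_of_nonneg_left (mul_le_mul_of_nonneg_left hsum' (by norm_num))
          (by positivity)
    _ = _ := by push_cast; field_simp

end ZeroDensity

namespace ZeroDensity

theorem sum_Ioc_filter_dvd_eq {E : Type*} [AddCommMonoid E] (f : ℕ → E) (M N : ℕ) {m : ℕ}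
    (hm : 0 < m) :
    ∑ e ∈ Finset.Ioc M N with m ∣ e, f e = ∑ e ∈ Finset.Ioc (M / m) (N / m), f (m * e) := by
  symm
  refine Finset.sum_bij (fun e _ ↦ m * e) ?_ ?_ ?_ ?_
  · intro e he
    simp only [Finset.mem_filter, Finset.mem_Ioc, dvd_mul_right, and_true] at he ⊢
    rw [Nat.div_lt_iff_lt_mul hm, Nat.le_div_iff_mul_le hm] at he
    constructor <;> nlinarith [he.1, he.2]
  · intro a _ b _ h; exact Nat.eq_of_mul_eq_mul_left hm h
  · intro b hb
    simp only [Finset.mem_filter, Finset.mem_Ioc] at hb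
    obtain ⟨⟨h1, h2⟩, e, rfl⟩ := hb
    refine ⟨e, Finset.mem_Ioc.mpr ⟨?_, ?_⟩, rfl⟩
    · rw [Nat.div_lt_iff_lt_mul hm]; linarith
    · rw [Nat.le_div_iff_mul_le hm]; linarith
  · intro _ _; rfl

theorem norm_sum_divSum_sq_sub_le {w : ℕ → ℝ} {D : ℕ} (hw : ∀ d, D < d → w d = 0)
    (hw1 : ∀ d, |w d| ≤ 1) (F c : ℕ → ℂ) {B : ℝ} (M N : ℕ)
    (hF : ∀ g, 0 < g → g ≤ D ^ 2 → ‖∑ n ∈ Finset.Ioc M N with g ∣ n, F n - c g‖ ≤ B) :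
    ‖∑ n ∈ Finset.Ioc M N, ((divSum w n ^ 2 : ℝ) : ℂ) * F n -
      ∑ d ∈ Finset.Ioc 0 D, ∑ e ∈ Finset.Ioc 0 D, ((w d * w e : ℝ) : ℂ) * c (d.lcm e)‖ ≤
      (D : ℝ) ^ 2 * B := by
  have h1 : ∑ n ∈ Finset.Ioc M N, ((divSum w n ^ 2 : ℝ) : ℂ) * F n =
      ∑ d ∈ Finset.Ioc 0 D, ∑ e ∈ Finset.Ioc 0 D, ((w d * w e : ℝ) : ℂ) *
        ∑ n ∈ Finset.Ioc M N with d.lcm e ∣ n, F n := by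
    have h2 : ∀ n ∈ Finset.Ioc M N, ((divSum w n ^ 2 : ℝ) : ℂ) * F n =
        ∑ d ∈ Finset.Ioc 0 D, ∑ e ∈ Finset.Ioc 0 D,
          ((w d * w e : ℝ) : ℂ) * (if d.lcm e ∣ n then F n else 0) := by
      intro n hn
      rw [divSum_sq_eq hw (by rw [Finset.mem_Ioc] at hn; omega)]
      push_cast
      rw [Finset.sum_mul]
      refine Finset.sum_congr rfl fun d _ ↦ ?_
      rw [Finset.sum_mul]
      refine Finset.sum_congr rfl fun e _ ↦ ?_
      split_ifs <;> simp
    rw [Finset.sum_congr rfl h2, Finset.sum_comm]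
    refine Finset.sum_congr rfl fun d _ ↦ ?_
    rw [Finset.sum_comm]
    refine Finset.sum_congr rfl fun e _ ↦ ?_
    rw [Finset.sum_filter, Finset.mul_sum]
  rw [h1, ← Finset.sum_sub_distrib]
  have h3 : ∀ d ∈ Finset.Ioc 0 D, ∀ e ∈ Finset.Ioc 0 D, ‖((w d * w e : ℝ) : ℂ) *
      ∑ n ∈ Finset.Ioc M N with d.lcm e ∣ n, F n - ((w d * w e : ℝ) : ℂ) * c (d.lcm e)‖ ≤ B := by
    intro d hd e he
    rw [Finset.mem_Ioc] at hd he
    have hg : 0 < d.lcm e := Nat.lcm_pos hd.1 he.1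
    have hB := hF (d.lcm e) hg ((Nat.le_of_dvd (Nat.mul_pos hd.1 he.1)
      (Nat.lcm_dvd_mul d e)).trans (by rw [sq]; exact Nat.mul_le_mul hd.2 he.2))
    rw [← mul_sub, norm_mul, Complex.norm_real, Real.norm_eq_abs, abs_mul]
    calc _ ≤ 1 * 1 * B := by
          refine mul_le_mul (mul_le_mul (hw1 d) (hw1 e) (abs_nonneg _) zero_le_one) ?_
            (norm_nonneg _) (by norm_num)
          exact hB
      _ = B := by ring
  calc _ ≤ ∑ d ∈ Finset.Ioc 0 D, ∑ e ∈ Finset.Ioc 0 D, B := by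
        refine (norm_sum_le _ _).trans (Finset.sum_le_sum fun d hd ↦ ?_)
        rw [← Finset.sum_sub_distrib]
        exact (norm_sum_le _ _).trans (Finset.sum_le_sum fun e he ↦ h3 d hd e he)
    _ = _ := by simp; ring

theorem norm_sum_dvd_mul_cpow_le {a : ℕ → ℂ} (ha : ∀ m n, a (m * n) = a m * a n)
    (ha1 : ∀ n, ‖a n‖ ≤ 1) {P : ℝ} (hP : ∀ M N, ‖∑ k ∈ Finset.Ioc M N, a k‖ ≤ P)
    {s : ℂ} (hs : 0 < s.re) {y : ℝ} (hy : 0 < y) (N : ℕ) {g : ℕ} (hg : 0 < g) :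
    ‖∑ n ∈ Finset.Ioc ⌊y⌋₊ N with g ∣ n, a n * (n : ℂ) ^ (-s)‖ ≤
      P * (‖s‖ / s.re) * y ^ (-s.re) := by
  have hP0 : 0 ≤ P := (norm_nonneg _).trans (hP 0 0)
  rw [sum_Ioc_filter_dvd_eq _ _ _ hg]
  have h1 : ∀ m, a (g * m) * ((g * m : ℕ) : ℂ) ^ (-s) =
      (a g * (g : ℂ) ^ (-s)) * (a m * (m : ℂ) ^ (-s)) := fun m ↦ by
    rw [ha, Nat.cast_mul, Complex.natCast_mul_natCast_cpow]; ring
  have hg' : (0 : ℝ) < g := by exact_mod_cast hg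
  simp_rw [h1]
  rw [← Finset.mul_sum, norm_mul, norm_mul]
  have h2 := norm_sum_mul_cpow_le hs (⌊y⌋₊ / g) (N / g) (a := a) (fun n _ ↦ hP _ n)
  have h3 : ‖(g : ℂ) ^ (-s)‖ = (g : ℝ) ^ (-s.re) := by
    rw [← norm_cpow_neg hg' s, Complex.ofReal_natCast]
  set M := ⌊y⌋₊ / g with hM
  have h4 : y ≤ g * ((M + 1 : ℕ) : ℝ) := by
    have : ⌊y⌋₊ < g * (M + 1) := by
      rw [hM]; exact Nat.lt_mul_div_succ _ hg
    exact (Nat.lt_of_floor_lt this).le.trans (by push_cast; rfl)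
  have h5 : (g : ℝ) ^ (-s.re) * ((M + 1 : ℕ) : ℝ) ^ (-s.re) ≤ y ^ (-s.re) := by
    rw [← Real.mul_rpow (by positivity) (by positivity)]
    exact Real.rpow_le_rpow_of_nonpos hy h4 (by linarith)
  calc _ ≤ 1 * (g : ℝ) ^ (-s.re) * (P * (‖s‖ / s.re * ((M + 1 : ℕ) : ℝ) ^ (-s.re))) := by
        rw [h3]
        exact mul_le_mul (mul_le_mul_of_nonneg_right (ha1 g) (by positivity)) h2 (norm_nonneg _)
          (by positivity)
    _ = P * (‖s‖ / s.re) * ((g : ℝ) ^ (-s.re) * ((M + 1 : ℕ) : ℝ) ^ (-s.re)) := by ring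
    _ ≤ _ := mul_le_mul_of_nonneg_left h5 (by positivity)

theorem norm_sum_Ioc_cpow_add_le {s : ℂ} (hs : 0 < s.re) (hs1 : s ≠ 1) {M N : ℕ} (hM : 0 < M)
    (hMN : M ≤ N) :
    ‖(s - 1) * ∑ m ∈ Finset.Ioc M N, (m : ℂ) ^ (-s) + ((N : ℂ) ^ (1 - s) - (M : ℂ) ^ (1 - s))‖ ≤
      ‖s - 1‖ * (‖s‖ / s.re) * ((M : ℝ) ^ (-s.re) - (N : ℝ) ^ (-s.re)) := by
  induction N, hMN using Nat.le_induction with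
  | base => simp
  | succ n hn ih =>
    have h := norm_cpow_one_sub_step_le (n := n) (by omega) hs hs1
    rw [Finset.sum_Ioc_succ_top (by omega)]
    calc _ = ‖((s - 1) * ∑ m ∈ Finset.Ioc M n, (m : ℂ) ^ (-s) +
          ((n : ℂ) ^ (1 - s) - (M : ℂ) ^ (1 - s))) + ((s - 1) * ((n + 1 : ℕ) : ℂ) ^ (-s) +
            ((n + 1 : ℕ) : ℂ) ^ (1 - s) - (n : ℂ) ^ (1 - s))‖ := by congr 1; ring
      _ ≤ _ := (norm_add_le _ _).trans (add_le_add ih h)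
      _ = _ := by ring

theorem norm_sum_dvd_cpow_sub_le {s : ℂ} (hs : 0 < s.re) (hs1 : s.re ≤ 1) (hs2 : s ≠ 1) {x y : ℝ}
    {g : ℕ} (hg : 0 < g) (hgy : 2 * (g : ℝ) ≤ y) (hyx : y ≤ x) :
    ‖∑ n ∈ Finset.Ioc ⌊y⌋₊ ⌊x⌋₊ with g ∣ n, (n : ℂ) ^ (-s) -
      (g : ℂ)⁻¹ * (((x : ℂ) ^ (1 - s) - (y : ℂ) ^ (1 - s)) / (1 - s))‖ ≤
      6 * (‖s‖ / s.re) * y ^ (-s.re) := by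
  have hg' : (0 : ℝ) < g := by exact_mod_cast hg
  have hgC : (g : ℂ) ≠ 0 := by exact_mod_cast hg.ne'
  have hy : 0 < y := by linarith
  have hs2' : (1 - s) ≠ 0 := sub_ne_zero.mpr hs2.symm
  rw [sum_Ioc_filter_dvd_eq _ _ _ hg]
  have key : ∀ z : ℝ, y ≤ z → 0 < ⌊z⌋₊ / g ∧ (g : ℝ) * (⌊z⌋₊ / g : ℕ) ≤ z ∧
      z - (g : ℝ) * (⌊z⌋₊ / g : ℕ) ≤ g := by
    intro z hz
    have hz0 : 0 < z := hy.trans_le hz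
    have e : ⌊z⌋₊ / g = ⌊z / g⌋₊ := (Nat.floor_div_natCast z g).symm
    have h1 : (⌊z / g⌋₊ : ℝ) ≤ z / g := Nat.floor_le (by positivity)
    have h2 : z / g < ⌊z / g⌋₊ + 1 := Nat.lt_floor_add_one _
    rw [le_div_iff₀ hg'] at h1
    rw [div_lt_iff₀ hg'] at h2
    rw [e]
    refine ⟨Nat.floor_pos.mpr ?_, by linarith, by linarith⟩
    rw [le_div_iff₀ hg']; linarith
  obtain ⟨a1, a2, a3⟩ := key y le_rfl
  obtain ⟨b1, b2, b3⟩ := key x hyx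
  have hMN : ⌊y⌋₊ / g ≤ ⌊x⌋₊ / g := Nat.div_le_div_right (Nat.floor_mono hyx)
  set M := ⌊y⌋₊ / g
  set N := ⌊x⌋₊ / g
  have hM0 : (0 : ℝ) < M := by exact_mod_cast a1
  have hN0 : (0 : ℝ) < N := by exact_mod_cast b1
  have hMNr : (M : ℝ) ≤ N := by exact_mod_cast hMN
  set D := y ^ (-s.re) with hD
  have hD0 : 0 < D := by positivity
  have hgM : ((g : ℝ) * M) ^ (-s.re) ≤ 2 * D := by
    have h1 : y / 2 ≤ g * M := by linarith
    calc ((g : ℝ) * M) ^ (-s.re) ≤ (y / 2) ^ (-s.re) :=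
          Real.rpow_le_rpow_of_nonpos (by positivity) h1 (by linarith)
      _ = 2 ^ s.re * D := by
          rw [Real.div_rpow hy.le (by norm_num), Real.rpow_neg (x := 2) (by norm_num), div_inv_eq_mul,
            mul_comm]
      _ ≤ 2 ^ (1 : ℝ) * D := by
          gcongr; norm_num
      _ = 2 * D := by norm_num
  have hgN : ((g : ℝ) * N) ^ (-s.re) ≤ 2 * D :=
    (Real.rpow_le_rpow_of_nonpos (by positivity) (by gcongr) (by linarith)).trans hgM
  have c1 := norm_sum_Ioc_cpow_add_le hs hs2 a1 hMN
  have c2 := norm_cpow_one_sub_sub_le (a := g * M) (by positivity) a2 hs hs2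
  have c3 := norm_cpow_one_sub_sub_le (a := g * N) (by positivity) b2 hs hs2
  have c2' : ‖(y : ℂ) ^ (1 - s) - ((g * M : ℝ) : ℂ) ^ (1 - s)‖ ≤ ‖1 - s‖ * (2 * D) * g :=
    c2.trans (by gcongr)
  have c3' : ‖(x : ℂ) ^ (1 - s) - ((g * N : ℝ) : ℂ) ^ (1 - s)‖ ≤ ‖1 - s‖ * (2 * D) * g :=
    c3.trans (by gcongr)
  have hgpow : ‖(g : ℂ) ^ (1 - s)‖ = g * (g : ℝ) ^ (-s.re) := by
    rw [Complex.norm_natCast_cpow_of_pos hg, Complex.sub_re, Complex.one_re, sub_eq_add_neg,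
      Real.rpow_add hg', Real.rpow_one]
  have c1' : ‖(g : ℂ) ^ (1 - s) * ((s - 1) * ∑ m ∈ Finset.Ioc M N, (m : ℂ) ^ (-s) +
      ((N : ℂ) ^ (1 - s) - (M : ℂ) ^ (1 - s)))‖ ≤ ‖1 - s‖ * (‖s‖ / s.re * (2 * D)) * g := by
    rw [norm_mul, hgpow]
    calc _ ≤ g * (g : ℝ) ^ (-s.re) * (‖s - 1‖ * (‖s‖ / s.re) * (M : ℝ) ^ (-s.re)) := by
          refine mul_le_mul_of_nonneg_left (c1.trans ?_) (by positivity)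
          refine mul_le_mul_of_nonneg_left ?_ (by positivity)
          linarith [show 0 < (N : ℝ) ^ (-s.re) by positivity]
      _ = ‖1 - s‖ * (‖s‖ / s.re * ((g * M : ℝ) ^ (-s.re))) * g := by
          rw [norm_sub_rev, Real.mul_rpow hg'.le hM0.le]; ring
      _ ≤ _ := by gcongr
  have hterm : ∀ m : ℕ, ((g * m : ℕ) : ℂ) ^ (-s) = (g : ℂ) ^ (-s) * (m : ℂ) ^ (-s) := fun m ↦ by
    push_cast; exact Complex.natCast_mul_natCast_cpow g m _
  have hone : 1 ≤ ‖s‖ / s.re := by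
    rw [le_div_iff₀ hs, one_mul]; exact Complex.re_le_norm s
  have hid : (g : ℂ) * (1 - s) * (∑ m ∈ Finset.Ioc M N, ((g * m : ℕ) : ℂ) ^ (-s) -
      (g : ℂ)⁻¹ * (((x : ℂ) ^ (1 - s) - (y : ℂ) ^ (1 - s)) / (1 - s))) =
      -((g : ℂ) ^ (1 - s) * ((s - 1) * ∑ m ∈ Finset.Ioc M N, (m : ℂ) ^ (-s) +
      ((N : ℂ) ^ (1 - s) - (M : ℂ) ^ (1 - s)))) -
      ((x : ℂ) ^ (1 - s) - ((g * N : ℝ) : ℂ) ^ (1 - s)) +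
      ((y : ℂ) ^ (1 - s) - ((g * M : ℝ) : ℂ) ^ (1 - s)) := by
    simp_rw [hterm]
    rw [← Finset.mul_sum]
    push_cast
    rw [Complex.natCast_mul_natCast_cpow, Complex.natCast_mul_natCast_cpow]
    have : (g : ℂ) ^ (1 - s) = g * (g : ℂ) ^ (-s) := by
      rw [sub_eq_add_neg, Complex.cpow_add _ _ hgC, Complex.cpow_one]
    rw [this]
    field_simp
    ring
  have hfin : ‖(g : ℂ) * (1 - s) * (∑ m ∈ Finset.Ioc M N, ((g * m : ℕ) : ℂ) ^ (-s) -
      (g : ℂ)⁻¹ * (((x : ℂ) ^ (1 - s) - (y : ℂ) ^ (1 - s)) / (1 - s)))‖ ≤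
      g * ‖1 - s‖ * (6 * (‖s‖ / s.re) * D) := by
    rw [hid]
    refine (norm_add_le _ _).trans ((add_le_add (norm_sub_le _ _) le_rfl).trans ?_)
    rw [norm_neg]
    have h5 : ‖1 - s‖ * (2 * D) * g ≤ ‖1 - s‖ * (‖s‖ / s.re * (2 * D)) * g := by
      refine mul_le_mul_of_nonneg_right (mul_le_mul_of_nonneg_left ?_ (norm_nonneg _)) hg'.le
      exact le_mul_of_one_le_left (by positivity) hone
    linarith
  rw [norm_mul, norm_mul, Complex.norm_natCast] at hfin
  exact le_of_mul_le_mul_left hfin (mul_pos hg' (norm_pos_iff.mpr hs2'))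

end ZeroDensity

namespace ZeroDensity

open scoped ComplexConjugate
open MeasureTheory Filter Topology

theorem integrableOn_mul_exp_neg {w : ℂ} (hw : 0 < w.re) :
    IntegrableOn (fun v : ℝ ↦ (v : ℂ) * Complex.exp (-w * v)) (Set.Ioi 0) := by
  have h := integrableOn_rpow_mul_exp_neg_mul_rpow (s := 1) (p := 1) (b := w.re) (by norm_num)
    one_pos hw
  refine Integrable.mono' h (by fun_prop) ?_
  filter_upwards [ae_restrict_mem measurableSet_Ioi] with v hv
  rw [norm_mul, Complex.norm_real, Real.norm_of_nonneg (le_of_lt hv), Complex.norm_exp]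
  simp

theorem integral_mul_exp_neg {w : ℂ} (hw : 0 < w.re) :
    ∫ v : ℝ in Set.Ioi 0, (v : ℂ) * Complex.exp (-w * v) = 1 / w ^ 2 := by
  have hw0 : w ≠ 0 := by rintro rfl; simp at hw
  have h := integral_Ioi_of_hasDerivAt_of_tendsto (a := (0 : ℝ))
    (f := fun v : ℝ ↦ -(v / w + 1 / w ^ 2) * Complex.exp (-w * v))
    (f' := fun v : ℝ ↦ (v : ℂ) * Complex.exp (-w * v)) (m := 0) ?_ ?_
    (integrableOn_mul_exp_neg hw) ?_
  · rw [h]; simp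
  · exact Continuous.continuousWithinAt (by fun_prop)
  · intro v _
    have h1 : HasDerivAt (fun v : ℝ ↦ (v : ℂ)) 1 v := Complex.ofRealCLM.hasDerivAt
    have h2 := (((h1.div_const w).add_const (1 / w ^ 2)).neg).mul ((h1.const_mul (-w)).cexp)
    refine h2.congr_deriv ?_
    simp only [Pi.neg_apply]
    field_simp
    ring
  · rw [tendsto_zero_iff_norm_tendsto_zero]
    have h1 := tendsto_rpow_mul_exp_neg_mul_atTop_nhds_zero 1 w.re hw
    have h0 := tendsto_rpow_mul_exp_neg_mul_atTop_nhds_zero 0 w.re hw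
    have h2 := (h1.mul_const ‖w‖⁻¹).add (h0.mul_const ‖w ^ 2‖⁻¹)
    simp only [zero_mul, add_zero] at h2
    refine squeeze_zero' (Eventually.of_forall fun v ↦ norm_nonneg _) ?_ h2
    filter_upwards [eventually_ge_atTop 0] with v hv
    rw [norm_mul, norm_neg, Complex.norm_exp]
    have h3 : ‖(v : ℂ) / w + 1 / w ^ 2‖ ≤ v * ‖w‖⁻¹ + ‖w ^ 2‖⁻¹ := by
      refine (norm_add_le _ _).trans (le_of_eq ?_)
      rw [norm_div, norm_div, Complex.norm_real, Real.norm_of_nonneg hv, norm_one]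
      ring
    calc _ ≤ (v * ‖w‖⁻¹ + ‖w ^ 2‖⁻¹) * rexp (-w * (v : ℂ)).re := by gcongr
      _ = _ := by
        have : (-w * (v : ℂ)).re = -w.re * v := by simp
        rw [this]; simp; ring

theorem ofReal_norm_sq_sum_exp (B : Finset ℂ) (c : ℂ → ℂ) (v : ℝ) :
    ((‖∑ ρ ∈ B, c ρ * Complex.exp ((1 - ρ) * v)‖ ^ 2 : ℝ) : ℂ) =
      ∑ ρ ∈ B, ∑ ρ' ∈ B, c ρ * conj (c ρ') * Complex.exp ((1 - (ρ + conj ρ' - 1)) * v) := by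
  rw [Complex.ofReal_pow, ← Complex.mul_conj', map_sum, Finset.sum_mul_sum]
  refine Finset.sum_congr rfl fun ρ _ ↦ Finset.sum_congr rfl fun ρ' _ ↦ ?_
  rw [map_mul, ← Complex.exp_conj, mul_mul_mul_comm, ← Complex.exp_add]
  congr 2
  simp only [map_mul, map_sub, map_one, Complex.conj_ofReal]
  ring

theorem sum_sum_exp_eq_and_le {B : Finset ℂ} {α L a b : ℝ} (hL : 0 < L) (ha : 0 < a) (hab : a ≤ b)
    (hα : α ≤ 1) (hB : ∀ ρ ∈ B, α ≤ ρ.re ∧ ρ.re < 1) {c : ℂ → ℂ} (hc : ∀ ρ ∈ B, ‖c ρ‖ ≤ 1) :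
    ∃ r : ℝ, 0 ≤ r ∧ r ≤ rexp ((2 * (1 - α) + 1 / L) * b) / a * L ^ 2 *
        ∑ ρ ∈ B, ∑ ρ' ∈ B, 1 / (1 + (L * (ρ.im - ρ'.im)) ^ 2) ∧
      ∑ ρ ∈ B, ∑ ρ' ∈ B, c ρ * conj (c ρ') *
      ((Complex.exp ((1 - (ρ + conj ρ' - 1)) * b) - Complex.exp ((1 - (ρ + conj ρ' - 1)) * a)) /
        (1 - (ρ + conj ρ' - 1))) = (r : ℂ) := by
  set P : ℝ → ℂ := fun v ↦ ∑ ρ ∈ B, c ρ * Complex.exp ((1 - ρ) * v) with hP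
  set κ := 2 * (1 - α) + 1 / L with hκ
  have hκ0 : 0 < κ := by
    have : 0 < 1 / L := by positivity
    linarith
  have hPc : Continuous P := by simp only [hP]; fun_prop
  have hne : ∀ ρ ∈ B, ∀ ρ' ∈ B, (1 - (ρ + conj ρ' - 1)) ≠ 0 := by
    intro ρ hρ ρ' hρ' h
    have := congrArg Complex.re h
    simp at this
    linarith [(hB ρ hρ).2, (hB ρ' hρ').2]
  have e1 : ∑ ρ ∈ B, ∑ ρ' ∈ B, c ρ * conj (c ρ') *
      ((Complex.exp ((1 - (ρ + conj ρ' - 1)) * b) - Complex.exp ((1 - (ρ + conj ρ' - 1)) * a)) /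
        (1 - (ρ + conj ρ' - 1))) = ((∫ v in a..b, ‖P v‖ ^ 2 : ℝ) : ℂ) := by
    rw [← intervalIntegral.integral_ofReal]
    simp_rw [hP, ofReal_norm_sq_sum_exp]
    rw [intervalIntegral.integral_finsetSum fun ρ _ ↦
      Continuous.intervalIntegrable (by fun_prop) _ _]
    refine Finset.sum_congr rfl fun ρ hρ ↦ ?_
    rw [intervalIntegral.integral_finsetSum fun ρ _ ↦
      Continuous.intervalIntegrable (by fun_prop) _ _]
    refine Finset.sum_congr rfl fun ρ' hρ' ↦ ?_
    rw [intervalIntegral.integral_const_mul, integral_exp_mul_complex (hne ρ hρ ρ' hρ')]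
  set w : ℂ → ℂ → ℂ := fun ρ ρ' ↦ κ - (1 - (ρ + conj ρ' - 1)) with hw
  have hwre : ∀ ρ ∈ B, ∀ ρ' ∈ B, 1 / L ≤ (w ρ ρ').re := by
    intro ρ hρ ρ' hρ'
    simp [hw, hκ]
    linarith [(hB ρ hρ).1, (hB ρ' hρ').1]
  have hwpos : ∀ ρ ∈ B, ∀ ρ' ∈ B, 0 < (w ρ ρ').re := fun ρ hρ ρ' hρ' ↦
    (by positivity : 0 < 1 / L).trans_le (hwre ρ hρ ρ' hρ')
  have e2 : ∀ v : ℝ, ((v * rexp (-κ * v) * ‖P v‖ ^ 2 : ℝ) : ℂ) =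
      ∑ ρ ∈ B, ∑ ρ' ∈ B, c ρ * conj (c ρ') * ((v : ℂ) * Complex.exp (-(w ρ ρ') * v)) := by
    intro v
    rw [Complex.ofReal_mul, ofReal_norm_sq_sum_exp, Finset.mul_sum]
    refine Finset.sum_congr rfl fun ρ _ ↦ ?_
    rw [Finset.mul_sum]
    refine Finset.sum_congr rfl fun ρ' _ ↦ ?_
    have : Complex.exp (-(w ρ ρ') * v) = Complex.exp (-κ * v) *
        Complex.exp ((1 - (ρ + conj ρ' - 1)) * v) := by
      rw [← Complex.exp_add]; congr 1; simp only [hw]; ring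
    rw [this]; push_cast; ring
  have hint1 : ∀ ρ ∈ B, ∀ ρ' ∈ B, IntegrableOn (fun v : ℝ ↦ c ρ * conj (c ρ') *
      ((v : ℂ) * Complex.exp (-(w ρ ρ') * v))) (Set.Ioi 0) := fun ρ hρ ρ' hρ' ↦
    (integrableOn_mul_exp_neg (hwpos ρ hρ ρ' hρ')).const_mul _
  have hintC : IntegrableOn (fun v : ℝ ↦ ((v * rexp (-κ * v) * ‖P v‖ ^ 2 : ℝ) : ℂ))
      (Set.Ioi 0) := by
    simp_rw [e2]
    exact integrable_finsetSum _ fun ρ hρ ↦ integrable_finsetSum _ fun ρ' hρ' ↦ hint1 ρ hρ ρ' hρ'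
  have hint : IntegrableOn (fun v : ℝ ↦ v * rexp (-κ * v) * ‖P v‖ ^ 2) (Set.Ioi 0) := by
    have h := hintC.re
    simp only [RCLike.re_to_complex, Complex.ofReal_re] at h
    exact h
  have e3 : ((∫ v : ℝ in Set.Ioi 0, v * rexp (-κ * v) * ‖P v‖ ^ 2 : ℝ) : ℂ) =
      ∑ ρ ∈ B, ∑ ρ' ∈ B, c ρ * conj (c ρ') * (1 / w ρ ρ' ^ 2) := by
    refine (integral_ofReal (𝕜 := ℂ)).symm.trans ?_
    refine (integral_congr_ae (Eventually.of_forall fun v ↦ e2 v)).trans ?_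
    rw [integral_finsetSum _ fun ρ hρ ↦ integrable_finsetSum _ fun ρ' hρ' ↦ hint1 ρ hρ ρ' hρ']
    refine Finset.sum_congr rfl fun ρ hρ ↦ ?_
    rw [integral_finsetSum _ fun ρ' hρ' ↦ hint1 ρ hρ ρ' hρ']
    refine Finset.sum_congr rfl fun ρ' hρ' ↦ ?_
    rw [integral_const_mul, integral_mul_exp_neg (hwpos ρ hρ ρ' hρ')]
  have hnn : ∀ v : ℝ, 0 < v → 0 ≤ v * rexp (-κ * v) * ‖P v‖ ^ 2 := fun v hv ↦ by positivity
  have hK : ∫ v : ℝ in Set.Ioi 0, v * rexp (-κ * v) * ‖P v‖ ^ 2 ≤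
      L ^ 2 * ∑ ρ ∈ B, ∑ ρ' ∈ B, 1 / (1 + (L * (ρ.im - ρ'.im)) ^ 2) := by
    have h0 : 0 ≤ ∫ v : ℝ in Set.Ioi 0, v * rexp (-κ * v) * ‖P v‖ ^ 2 :=
      setIntegral_nonneg measurableSet_Ioi fun v hv ↦ hnn v hv
    rw [← abs_of_nonneg h0, ← Real.norm_eq_abs, ← Complex.norm_real, e3, Finset.mul_sum]
    refine (norm_sum_le _ _).trans (Finset.sum_le_sum fun ρ hρ ↦ ?_)
    rw [Finset.mul_sum]
    refine (norm_sum_le _ _).trans (Finset.sum_le_sum fun ρ' hρ' ↦ ?_)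
    rw [norm_mul, norm_mul, RCLike.norm_conj, norm_div, norm_pow, norm_one]
    have h1 : ‖c ρ‖ * ‖c ρ'‖ ≤ 1 := mul_le_one₀ (hc ρ hρ) (norm_nonneg _) (hc ρ' hρ')
    have h2 : (1 + (L * (ρ.im - ρ'.im)) ^ 2) / L ^ 2 ≤ ‖w ρ ρ'‖ ^ 2 := by
      rw [← Complex.normSq_eq_norm_sq, Complex.normSq_apply]
      have him : (w ρ ρ').im = ρ.im - ρ'.im := by simp [hw]; ring
      have hre := hwre ρ hρ ρ' hρ'
      have := mul_self_le_mul_self (by positivity) hre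
      rw [him]
      calc _ = 1 / L * (1 / L) + (ρ.im - ρ'.im) * (ρ.im - ρ'.im) := by field_simp
        _ ≤ _ := by linarith
    calc _ ≤ 1 * (1 / ((1 + (L * (ρ.im - ρ'.im)) ^ 2) / L ^ 2)) := by gcongr
      _ = _ := by field_simp
  have hmaj : ∫ v in a..b, ‖P v‖ ^ 2 ≤ rexp (κ * b) / a *
      ∫ v : ℝ in Set.Ioi 0, v * rexp (-κ * v) * ‖P v‖ ^ 2 := by
    rw [← integral_const_mul, intervalIntegral.integral_of_le hab]
    refine le_trans (setIntegral_mono_on (g := fun v : ℝ ↦ rexp (κ * b) / a *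
      (v * rexp (-κ * v) * ‖P v‖ ^ 2)) ?_ ?_ measurableSet_Ioc ?_) (setIntegral_mono_set ?_ ?_ ?_)
    · exact (Continuous.integrableOn_Icc (by fun_prop)).mono_set Set.Ioc_subset_Icc_self
    · exact (Continuous.integrableOn_Icc (by fun_prop)).mono_set Set.Ioc_subset_Icc_self
    · intro v hv
      have h1 : 1 ≤ v / a := (one_le_div ha).mpr hv.1.le
      have h2 : 1 ≤ rexp (κ * b) * rexp (-κ * v) := by
        rw [← Real.exp_add]; exact Real.one_le_exp (by nlinarith [hv.2])
      calc ‖P v‖ ^ 2 = 1 * 1 * ‖P v‖ ^ 2 := by ring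
        _ ≤ (v / a) * (rexp (κ * b) * rexp (-κ * v)) * ‖P v‖ ^ 2 := by gcongr
        _ = _ := by ring
    · exact hint.const_mul _
    · filter_upwards [ae_restrict_mem measurableSet_Ioi] with v hv
      exact mul_nonneg (by positivity) (hnn v hv)
    · exact (show Set.Ioc a b ⊆ Set.Ioi 0 from fun v hv ↦ ha.trans hv.1).eventuallyLE
  refine ⟨∫ v in a..b, ‖P v‖ ^ 2, intervalIntegral.integral_nonneg hab fun v _ ↦ by positivity,
    ?_, e1⟩
  rw [mul_assoc]
  exact hmaj.trans (mul_le_mul_of_nonneg_left hK (by positivity))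

end ZeroDensity

namespace ZeroDensity
open scoped ComplexConjugate Finset

/-- Bound for the error made when a sum twisted by the square of the sieve weights is evaluated. -/
noncomputable def twistError (T : ℝ) : ℝ := 5 * (1 + 2 * log T) * T ^ (-(21 / 100) : ℝ)

/-- The range of summation used for detecting zeros. -/
noncomputable def zeroRange (T : ℝ) : Finset ℕ :=
  Finset.Ioc ⌊T ^ (15 / 4 : ℝ)⌋₊ ⌊T ^ (37 / 5 : ℝ)⌋₊

theorem twistError_nonneg {T : ℝ} (hT : 1 ≤ T) : 0 ≤ twistError T := by
  have := log_nonneg hT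
  unfold twistError
  positivity

theorem sq_floor_mul_le_twistError {T K : ℝ} (hT : 1 ≤ T) (hK : 0 ≤ K)
    (hKT : K ≤ T * (1 + 2 * log T)) {s : ℂ} (hs : 3 / 5 ≤ s.re) (hsT : ‖s‖ ≤ 2 * T + 1) :
    (⌊T ^ (1 / 50 : ℝ)⌋₊ : ℝ) ^ 2 * (K * (‖s‖ / s.re) * (T ^ (15 / 4 : ℝ)) ^ (-s.re)) ≤
      twistError T := by
  have hT0 : 0 < T := by linarith
  have hL := log_nonneg hT
  have h1 : (⌊T ^ (1 / 50 : ℝ)⌋₊ : ℝ) ^ 2 ≤ T ^ (1 / 25 : ℝ) := by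
    calc (⌊T ^ (1 / 50 : ℝ)⌋₊ : ℝ) ^ 2 ≤ (T ^ (1 / 50 : ℝ)) ^ 2 := by
          gcongr
          exact Nat.floor_le (by positivity)
      _ = T ^ (1 / 25 : ℝ) := by
          rw [← rpow_natCast, ← rpow_mul hT0.le]
          norm_num
  have h2 : ‖s‖ / s.re ≤ 5 * T := by
    rw [div_le_iff₀ (by linarith)]
    nlinarith
  have h3 : (T ^ (15 / 4 : ℝ)) ^ (-s.re) ≤ T ^ (-(9 / 4) : ℝ) := by
    rw [← rpow_mul hT0.le]
    exact rpow_le_rpow_of_exponent_le hT (by linarith)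
  have hsr : 0 < s.re := by linarith
  calc _ ≤ T ^ (1 / 25 : ℝ) * (T * (1 + 2 * log T) * (5 * T) * T ^ (-(9 / 4) : ℝ)) := by gcongr
    _ = 5 * (1 + 2 * log T) * (T ^ (1 / 25 : ℝ) * (T ^ (1 : ℝ) * T ^ (1 : ℝ)) *
          T ^ (-(9 / 4) : ℝ)) := by rw [rpow_one]; ring
    _ = twistError T := by
        rw [twistError, ← rpow_add hT0, ← rpow_add hT0, ← rpow_add hT0]
        norm_num

theorem norm_sum_twist_sq_sub_le {T : ℝ} (hT : exp 2 ≤ T) {s : ℂ} (hs : 3 / 5 ≤ s.re)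
    (hs1 : s.re < 1) (hsT : ‖s‖ ≤ 2 * T + 1) :
    ‖∑ n ∈ zeroRange T, ((divSum (twistWeight T) n ^ 2 : ℝ) : ℂ) * (n : ℂ) ^ (-s) -
      (lcmForm 1 ⌊T ^ (1 / 50 : ℝ)⌋₊ (twistWeight T) : ℂ) *
        ((((T ^ (37 / 5 : ℝ) : ℝ) : ℂ) ^ (1 - s) - ((T ^ (15 / 4 : ℝ) : ℝ) : ℂ) ^ (1 - s)) /
          (1 - s))‖ ≤ twistError T := by
  have hT2 : 3 ≤ T := by linarith [add_one_le_exp (2 : ℝ)]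
  have hlog : 2 ≤ log T := (le_log_iff_exp_le (by linarith)).2 hT
  have hne : s ≠ 1 := by rintro rfl; simp at hs1
  set G : ℂ := (((T ^ (37 / 5 : ℝ) : ℝ) : ℂ) ^ (1 - s) - ((T ^ (15 / 4 : ℝ) : ℝ) : ℂ) ^ (1 - s)) /
          (1 - s) with hG
  have hF : ∀ g, 0 < g → g ≤ ⌊T ^ (1 / 50 : ℝ)⌋₊ ^ 2 →
      ‖∑ n ∈ zeroRange T with g ∣ n, (n : ℂ) ^ (-s) - (g : ℂ)⁻¹ * G‖ ≤
        6 * (‖s‖ / s.re) * (T ^ (15 / 4 : ℝ)) ^ (-s.re) := by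
    intro g hg hgD
    refine norm_sum_dvd_cpow_sub_le (by linarith) hs1.le hne hg ?_ ?_
    · have h1 : (g : ℝ) ≤ T := by
        calc (g : ℝ) ≤ (⌊T ^ (1 / 50 : ℝ)⌋₊ : ℝ) ^ 2 := by exact_mod_cast hgD
          _ ≤ (T ^ (1 / 50 : ℝ)) ^ 2 := by
            gcongr
            exact Nat.floor_le (by positivity)
          _ = T ^ (1 / 25 : ℝ) := by
            rw [← rpow_natCast, ← rpow_mul (by linarith)]
            norm_num
          _ ≤ T ^ (1 : ℝ) := rpow_le_rpow_of_exponent_le (by linarith) (by norm_num)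
          _ = T := rpow_one T
      calc 2 * (g : ℝ) ≤ T * T := by nlinarith
        _ = T ^ (2 : ℝ) := by norm_num; ring
        _ ≤ T ^ (15 / 4 : ℝ) := rpow_le_rpow_of_exponent_le (by linarith) (by norm_num)
    · exact rpow_le_rpow_of_exponent_le (by linarith) (by norm_num)
  have h := norm_sum_divSum_sq_sub_le (w := twistWeight T) (D := ⌊T ^ (1 / 50 : ℝ)⌋₊)
    (fun d hd ↦ twistWeight_eq_zero hd) (abs_twistWeight_le (by linarith))
    (fun n ↦ (n : ℂ) ^ (-s)) (fun g ↦ (g : ℂ)⁻¹ * G) _ _ hF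
  refine le_trans (le_of_eq ?_) (h.trans (sq_floor_mul_le_twistError (by linarith) (by norm_num)
    (by nlinarith) hs hsT))
  congr 2
  rw [lcmForm]
  push_cast
  rw [Finset.sum_mul]
  refine Finset.sum_congr rfl fun d _ ↦ ?_
  rw [Finset.sum_mul]
  refine Finset.sum_congr rfl fun e _ ↦ ?_
  rw [rpow_neg_one]
  push_cast
  ring

theorem norm_sum_twist_sq_mul_le {T : ℝ} (hT : 1 < T) {a : ℕ → ℂ}
    (ha : ∀ m n, a (m * n) = a m * a n) (ha1 : ∀ n, ‖a n‖ ≤ 1)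
    (hP : ∀ M N, ‖∑ k ∈ Finset.Ioc M N, a k‖ ≤ T * (1 + 2 * log T)) {s : ℂ} (hs : 3 / 5 ≤ s.re)
    (hsT : ‖s‖ ≤ 2 * T + 1) :
    ‖∑ n ∈ zeroRange T, ((divSum (twistWeight T) n ^ 2 : ℝ) : ℂ) * (a n * (n : ℂ) ^ (-s))‖ ≤
      twistError T := by
  have h := norm_sum_divSum_sq_sub_le (w := twistWeight T) (D := ⌊T ^ (1 / 50 : ℝ)⌋₊)
    (fun d hd ↦ twistWeight_eq_zero hd) (abs_twistWeight_le hT)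
    (fun n ↦ a n * (n : ℂ) ^ (-s)) (fun g ↦ 0) ⌊T ^ (15 / 4 : ℝ)⌋₊ ⌊T ^ (37 / 5 : ℝ)⌋₊
    (B := T * (1 + 2 * log T) * (‖s‖ / s.re) * (T ^ (15 / 4 : ℝ)) ^ (-s.re)) (fun g hg _ ↦ by
      rw [sub_zero]
      exact norm_sum_dvd_mul_cpow_le ha ha1 hP (by linarith) (by positivity) _ hg)
  simp only [mul_zero, Finset.sum_const_zero, sub_zero] at h
  have := log_nonneg hT.le
  exact h.trans (sq_floor_mul_le_twistError hT.le (by positivity) le_rfl hs hsT)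

theorem norm_sum_character_mul_conj_le {T : ℝ} (hT : 1 ≤ T) {l₁ l₂ : Σ q : ℕ, DirichletCharacter ℂ q}
    [NeZero l₁.1] [NeZero l₂.1] (hl : l₁ ≠ l₂) (h₁ : l₁.2.IsPrimitive) (h₂ : l₂.2.IsPrimitive)
    (hq₁ : (l₁.1 : ℝ) ≤ T) (hq₂ : (l₂.1 : ℝ) ≤ T) (M N : ℕ) :
    ‖∑ k ∈ Finset.Ioc M N, l₁.2 k * conj (l₂.2 k)‖ ≤ T * (1 + 2 * log T) := by
  have hL := log_nonneg hT
  have hconj : ∀ {q : ℕ} [NeZero q] (χ : DirichletCharacter ℂ q) (k : ℕ),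
      conj (χ k) = χ⁻¹ k := fun χ k ↦ by rw [← MulChar.star_eq_inv]; rfl
  simp only [hconj]
  obtain ⟨q₁, χ₁⟩ := l₁
  obtain ⟨q₂, χ₂⟩ := l₂
  simp only at *
  by_cases hq : q₁ = q₂
  · subst hq
    have hne : χ₁ * χ₂⁻¹ ≠ 1 := by
      intro h
      rw [mul_inv_eq_one] at h
      exact hl (by rw [h])
    have h := norm_sum_character_le hne M N
    simp only [MulChar.mul_apply] at h
    exact h.trans (hq₁.trans (by nlinarith))
  · have h₂' : χ₂⁻¹.IsPrimitive := by
      rw [DirichletCharacter.isPrimitive_def, DirichletCharacter.conductor_inv]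
      exact h₂
    refine (norm_sum_mul_character_le hq h₁ h₂' M N).trans ?_
    have hp₁ : (0 : ℝ) < q₁ := by exact_mod_cast Nat.pos_of_ne_zero (NeZero.ne q₁)
    have hp₂ : (0 : ℝ) < q₂ := by exact_mod_cast Nat.pos_of_ne_zero (NeZero.ne q₂)
    have h1 : (q₁ * q₂ : ℝ) ≤ T ^ 2 := by rw [sq]; gcongr
    have h1' : (1 : ℝ) ≤ q₁ * q₂ := by
      exact_mod_cast Nat.mul_pos (Nat.pos_of_ne_zero (NeZero.ne q₁))
        (Nat.pos_of_ne_zero (NeZero.ne q₂))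
    have h2 : √(q₁ * q₂ : ℝ) ≤ T := by
      rw [← sqrt_sq (by linarith : 0 ≤ T)]
      exact sqrt_le_sqrt h1
    have h3 : log (q₁ * q₂ : ℝ) ≤ 2 * log T := by
      calc log (q₁ * q₂ : ℝ) ≤ log (T ^ 2) := log_le_log (by positivity) h1
        _ = 2 * log T := by rw [log_pow]; norm_num
    have h4 : 0 ≤ log (q₁ * q₂ : ℝ) := log_nonneg h1'
    exact mul_le_mul h2 (by linarith) (by linarith) (by linarith)

end ZeroDensity

namespace ZeroDensity
open scoped ComplexConjugate Finset

theorem sum_mul_sum_mul_conj_sum (I : Finset ℕ) (hI : ∀ n ∈ I, n ≠ 0) (w : ℕ → ℝ) (a b : ℕ → ℂ)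
    (S S' : Finset ℂ) (c c' : ℂ → ℂ) :
    ∑ n ∈ I, ((w n * n : ℝ) : ℂ) * ((∑ ρ ∈ S, c ρ * (a n * (n : ℂ) ^ (-ρ))) *
        conj (∑ ρ ∈ S', c' ρ * (b n * (n : ℂ) ^ (-ρ)))) =
      ∑ ρ ∈ S, ∑ ρ' ∈ S', c ρ * conj (c' ρ') *
        ∑ n ∈ I, ((w n : ℝ) : ℂ) * (a n * conj (b n) * (n : ℂ) ^ (-(ρ + conj ρ' - 1))) := by
  have h : ∀ n ∈ I, ((w n * n : ℝ) : ℂ) * ((∑ ρ ∈ S, c ρ * (a n * (n : ℂ) ^ (-ρ))) *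
        conj (∑ ρ ∈ S', c' ρ * (b n * (n : ℂ) ^ (-ρ)))) =
      ∑ ρ ∈ S, ∑ ρ' ∈ S', c ρ * conj (c' ρ') *
        (((w n : ℝ) : ℂ) * (a n * conj (b n) * (n : ℂ) ^ (-(ρ + conj ρ' - 1)))) := by
    intro n hn
    have hn0 : (n : ℂ) ≠ 0 := by exact_mod_cast hI n hn
    rw [map_sum, Finset.sum_mul_sum, Finset.mul_sum]
    refine Finset.sum_congr rfl fun ρ _ ↦ ?_
    rw [Finset.mul_sum]
    refine Finset.sum_congr rfl fun ρ' _ ↦ ?_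
    have h1 : conj ((n : ℂ) ^ (-ρ')) = (n : ℂ) ^ (-conj ρ') := by
      have := Complex.conj_cpow (n : ℂ) (-ρ') (by
        rw [Complex.natCast_arg]; exact pi_pos.ne)
      rw [Complex.conj_natCast] at this
      rw [this, ← map_neg, Complex.conj_conj]
    have h2 : (n : ℂ) ^ (-(ρ + conj ρ' - 1)) = n * ((n : ℂ) ^ (-ρ) * (n : ℂ) ^ (-conj ρ')) := by
      rw [show -(ρ + conj ρ' - 1) = 1 + (-ρ + -conj ρ') by ring, Complex.cpow_add _ _ hn0,
        Complex.cpow_add _ _ hn0, Complex.cpow_one]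
    rw [h2, map_mul, map_mul, h1]
    push_cast
    ring
  rw [Finset.sum_congr rfl h, Finset.sum_comm]
  refine Finset.sum_congr rfl fun ρ _ ↦ ?_
  rw [Finset.sum_comm]
  refine Finset.sum_congr rfl fun ρ' _ ↦ ?_
  rw [Finset.mul_sum]

theorem norm_sum_sum_mul_conj_mul_le {S S' : Finset ℂ} {c c' : ℂ → ℂ} (hc : ∀ ρ ∈ S, ‖c ρ‖ ≤ 1)
    (hc' : ∀ ρ ∈ S', ‖c' ρ‖ ≤ 1) {F : ℂ → ℂ → ℂ} {B : ℝ}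
    (hF : ∀ ρ ∈ S, ∀ ρ' ∈ S', ‖F ρ ρ'‖ ≤ B) :
    ‖∑ ρ ∈ S, ∑ ρ' ∈ S', c ρ * conj (c' ρ') * F ρ ρ'‖ ≤ B * (#S * #S') := by
  calc _ ≤ ∑ ρ ∈ S, ∑ ρ' ∈ S', B := by
        refine norm_sum_le_of_le _ fun ρ hρ ↦ norm_sum_le_of_le _ fun ρ' hρ' ↦ ?_
        rw [norm_mul, norm_mul, Complex.norm_conj]
        calc _ ≤ 1 * 1 * B := by
              refine mul_le_mul (mul_le_mul (hc ρ hρ) (hc' ρ' hρ') (norm_nonneg _) zero_le_one)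
                (hF ρ hρ ρ' hρ') (norm_nonneg _) (by norm_num)
          _ = B := by ring
    _ = B * (#S * #S') := by
        rw [Finset.sum_const, Finset.sum_const, nsmul_eq_mul, nsmul_eq_mul]
        ring

theorem re_and_norm_add_conj_sub_one {T α : ℝ} (hα : 4 / 5 ≤ α) {ρ ρ' : ℂ}
    (hρ : α ≤ ρ.re ∧ ρ.re < 1 ∧ |ρ.im| ≤ T) (hρ' : α ≤ ρ'.re ∧ ρ'.re < 1 ∧ |ρ'.im| ≤ T) :
    3 / 5 ≤ (ρ + conj ρ' - 1).re ∧ (ρ + conj ρ' - 1).re < 1 ∧ ‖ρ + conj ρ' - 1‖ ≤ 2 * T + 1 := by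
  have h1 : (ρ + conj ρ' - 1).re = ρ.re + ρ'.re - 1 := by simp
  have h2 : (ρ + conj ρ' - 1).im = ρ.im - ρ'.im := by simp [sub_eq_add_neg]
  refine ⟨by linarith, by linarith, (Complex.norm_le_abs_re_add_abs_im _).trans ?_⟩
  rw [h1, h2, abs_of_nonneg (by linarith)]
  have := abs_sub ρ.im ρ'.im
  linarith

theorem ne_zero_of_mem_zeroRange {T : ℝ} {n : ℕ} (hn : n ∈ zeroRange T) : n ≠ 0 := by
  rw [zeroRange, Finset.mem_Ioc] at hn
  omega

theorem exists_sum_twist_sq_mul_norm_sq_le : ∃ C : ℝ, 0 < C ∧ ∀ T, exp 2 ≤ T →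
    ∀ (q : ℕ) [NeZero q] (χ : DirichletCharacter ℂ q), (q = 1 ∨ χ ≠ 1) → (q : ℝ) ≤ T →
    ∀ α, 4 / 5 ≤ α → α ≤ 1 → ∀ S : Finset ℂ,
    (∀ ρ ∈ S, χ.LFunction ρ = 0 ∧ α ≤ ρ.re ∧ ρ.re < 1 ∧ |ρ.im| ≤ T) → ∀ c : ℂ → ℂ,
    (∀ ρ ∈ S, ‖c ρ‖ ≤ 1) →
    ∑ n ∈ zeroRange T, divSum (twistWeight T) n ^ 2 * n *
        ‖∑ ρ ∈ S, c ρ * (χ n * (n : ℂ) ^ (-ρ))‖ ^ 2 ≤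
      C * ((T ^ (37 / 5 : ℝ)) ^ (2 * (1 - α)) * (1 + (1 - α) * log T)) * #S +
        twistError T * #S ^ 2 := by
  obtain ⟨C₁, hC₁, h₁⟩ := exists_lcmForm_twistWeight_le
  obtain ⟨C₂, hC₂, h₂⟩ := exists_sum_zeros_le
  refine ⟨C₁ * C₂ * (exp (37 / 5) * (4 / 15)), by positivity, ?_⟩
  intro T hT q _ χ hχ hq α hα hα1 S hS c hc
  have hT0 : 0 < T := (exp_pos 2).trans_le hT
  have hL2 : 2 ≤ log T := (le_log_iff_exp_le hT0).2 hT
  set L := log T with hL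
  have hL0 : 0 < L := by linarith
  have step₁ : ∑ n ∈ zeroRange T, divSum (twistWeight T) n ^ 2 * n *
        ‖∑ ρ ∈ S, c ρ * (χ n * (n : ℂ) ^ (-ρ))‖ ^ 2 ≤
      ∑ n ∈ zeroRange T, divSum (twistWeight T) n ^ 2 * n *
        ‖∑ ρ ∈ S, c ρ * (1 * (n : ℂ) ^ (-ρ))‖ ^ 2 := by
    refine Finset.sum_le_sum fun n _ ↦ ?_
    refine mul_le_mul_of_nonneg_left ?_ (by positivity)
    have h3 : ∑ ρ ∈ S, c ρ * (χ n * (n : ℂ) ^ (-ρ)) =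
        χ n * ∑ ρ ∈ S, c ρ * (1 * (n : ℂ) ^ (-ρ)) := by
      rw [Finset.mul_sum]
      exact Finset.sum_congr rfl fun ρ _ ↦ by ring
    rw [h3, norm_mul]
    have := χ.norm_le_one n
    gcongr
    exact mul_le_of_le_one_left (norm_nonneg _) this
  have step₂ := sum_mul_sum_mul_conj_sum (zeroRange T) (fun n hn ↦ ne_zero_of_mem_zeroRange hn)
    (fun n ↦ divSum (twistWeight T) n ^ 2) (fun _ ↦ 1) (fun _ ↦ 1) S S c c
  set H := lcmForm 1 ⌊T ^ (1 / 50 : ℝ)⌋₊ (twistWeight T) with hH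
  obtain ⟨r, hr0, hr, hr'⟩ := sum_sum_exp_eq_and_le (B := S) (α := α) (L := L) (a := 15 / 4 * L)
    (b := 37 / 5 * L) hL0 (by positivity) (by linarith) hα1
    (fun ρ hρ ↦ ⟨(hS ρ hρ).2.1, (hS ρ hρ).2.2.1⟩) hc
  have hpow : ∀ (u : ℝ) (s : ℂ), ((T ^ u : ℝ) : ℂ) ^ s = Complex.exp (s * (u * L : ℝ)) := by
    intro u s
    have : ((T ^ u : ℝ) : ℂ) ≠ 0 := by exact_mod_cast (rpow_pos_of_pos hT0 u).ne'
    rw [Complex.cpow_def_of_ne_zero this, ← Complex.ofReal_log (by positivity), log_rpow hT0,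
      mul_comm]
  have step₃ : ‖∑ ρ ∈ S, ∑ ρ' ∈ S, c ρ * conj (c ρ') *
      (∑ n ∈ zeroRange T, ((divSum (twistWeight T) n ^ 2 : ℝ) : ℂ) *
        (1 * conj 1 * (n : ℂ) ^ (-(ρ + conj ρ' - 1))) - H *
        ((Complex.exp ((1 - (ρ + conj ρ' - 1)) * (37 / 5 * L : ℝ)) -
          Complex.exp ((1 - (ρ + conj ρ' - 1)) * (15 / 4 * L : ℝ))) /
        (1 - (ρ + conj ρ' - 1))))‖ ≤ twistError T * (#S * #S) := by
    refine norm_sum_sum_mul_conj_mul_le hc hc fun ρ hρ ρ' hρ' ↦ ?_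
    obtain ⟨e1, e2, e3⟩ := re_and_norm_add_conj_sub_one hα (hS ρ hρ).2 (hS ρ' hρ').2
    have := norm_sum_twist_sq_sub_le hT e1 e2 e3
    rw [hpow, hpow] at this
    simpa only [map_one, one_mul] using this
  have step₄ : ((∑ n ∈ zeroRange T, divSum (twistWeight T) n ^ 2 * n *
        ‖∑ ρ ∈ S, c ρ * (1 * (n : ℂ) ^ (-ρ))‖ ^ 2 - H * r : ℝ) : ℂ) =
      ∑ ρ ∈ S, ∑ ρ' ∈ S, c ρ * conj (c ρ') *
      (∑ n ∈ zeroRange T, ((divSum (twistWeight T) n ^ 2 : ℝ) : ℂ) *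
        (1 * conj 1 * (n : ℂ) ^ (-(ρ + conj ρ' - 1))) - H *
        ((Complex.exp ((1 - (ρ + conj ρ' - 1)) * (37 / 5 * L : ℝ)) -
          Complex.exp ((1 - (ρ + conj ρ' - 1)) * (15 / 4 * L : ℝ))) /
        (1 - (ρ + conj ρ' - 1)))) := by
    simp only [mul_sub, Finset.sum_sub_distrib]
    rw [← step₂, Complex.ofReal_sub, Complex.ofReal_mul, ← hr', Finset.mul_sum]
    congr 1
    · push_cast
      refine Finset.sum_congr rfl fun n _ ↦ ?_
      rw [Complex.mul_conj']
    · refine Finset.sum_congr rfl fun ρ _ ↦ ?_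
      rw [Finset.mul_sum]
      refine Finset.sum_congr rfl fun ρ' _ ↦ ?_
      ring
  rw [← step₄, Complex.norm_real, Real.norm_eq_abs] at step₃
  have step₅ := (le_abs_self _).trans step₃
  have hHr : H * r ≤ C₁ * C₂ * (exp (37 / 5) * (4 / 15)) *
      ((T ^ (37 / 5 : ℝ)) ^ (2 * (1 - α)) * (1 + (1 - α) * L)) * #S := by
    have h3 : ∑ ρ ∈ S, ∑ ρ' ∈ S, 1 / (1 + (L * (ρ.im - ρ'.im)) ^ 2) ≤
        #S * (C₂ * (1 + (1 - α) * L)) := by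
      rw [← nsmul_eq_mul]
      refine Finset.sum_le_card_nsmul _ _ _ fun ρ _ ↦ ?_
      exact h₂ T hT q χ hχ hq α (by linarith) hα1 S
        (fun ρ hρ ↦ ⟨(hS ρ hρ).1, (hS ρ hρ).2.1, (hS ρ hρ).2.2.2⟩) ρ.im
    have h4 : rexp ((2 * (1 - α) + 1 / L) * (37 / 5 * L)) =
        exp (37 / 5) * (T ^ (37 / 5 : ℝ)) ^ (2 * (1 - α)) := by
      rw [← rpow_mul hT0.le, rpow_def_of_pos hT0, ← exp_add]
      congr 1
      field_simp
      ring
    rw [h4] at hr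
    have hsum0 : 0 ≤ ∑ ρ ∈ S, ∑ ρ' ∈ S, 1 / (1 + (L * (ρ.im - ρ'.im)) ^ 2) :=
      Finset.sum_nonneg fun _ _ ↦ Finset.sum_nonneg fun _ _ ↦ by positivity
    calc H * r ≤ C₁ / L * r :=
          mul_le_mul_of_nonneg_right (h₁ T (le_trans (exp_le_exp.2 (by norm_num)) hT)) hr0
      _ ≤ C₁ / L * (exp (37 / 5) * (T ^ (37 / 5 : ℝ)) ^ (2 * (1 - α)) / (15 / 4 * L) * L ^ 2 *
          (#S * (C₂ * (1 + (1 - α) * L)))) := by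
          refine mul_le_mul_of_nonneg_left (hr.trans ?_) (by positivity)
          exact mul_le_mul_of_nonneg_left h3 (by positivity)
      _ = _ := by
          field_simp
  nlinarith

end ZeroDensity

namespace ZeroDensity
open scoped ComplexConjugate Finset
open Filter Topology

/-- `Z l` is, for each primitive character `l ∈ Λ` of conductor at most `T`, a set of zeros of its
`L`-function in the rectangle `α ≤ Re s < 1`, `|Im s| ≤ T`. -/
def IsZeroFamily (T α : ℝ) (Λ : Finset (Σ q : ℕ, DirichletCharacter ℂ q))
    (Z : (Σ q : ℕ, DirichletCharacter ℂ q) → Finset ℂ) : Prop :=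
  ∀ l ∈ Λ, ∃ _ : NeZero l.1, (l.1 : ℝ) ≤ T ∧ l.2.IsPrimitive ∧
    ∀ ρ ∈ Z l, l.2.LFunction ρ = 0 ∧ α ≤ ρ.re ∧ ρ.re < 1 ∧ |ρ.im| ≤ T

theorem eq_one_or_ne_one_of_isPrimitive {q : ℕ} [NeZero q] {χ : DirichletCharacter ℂ q}
    (hχ : χ.IsPrimitive) : q = 1 ∨ χ ≠ 1 := by
  by_cases h : χ = 1
  · left
    rw [DirichletCharacter.isPrimitive_def, h, DirichletCharacter.conductor_one] at hχ
    exact hχ.symm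
  · exact Or.inr h

theorem tendsto_twistError : Tendsto twistError atTop (𝓝 0) := by
  have h1 : Tendsto (fun T : ℝ ↦ T ^ (-(21 / 100) : ℝ)) atTop (𝓝 0) :=
    tendsto_rpow_neg_atTop (by norm_num)
  have h2 : Tendsto (fun T : ℝ ↦ log T / T ^ (21 / 100 : ℝ)) atTop (𝓝 0) :=
    (isLittleO_log_rpow_atTop (by norm_num : (0 : ℝ) < 21 / 100)).tendsto_div_nhds_zero
  have h3 := (h1.const_mul 5).add (h2.const_mul 10)
  rw [mul_zero, mul_zero, add_zero] at h3
  refine h3.congr' ?_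
  filter_upwards [eventually_gt_atTop 0] with T hT
  rw [twistError, rpow_neg hT.le]
  field_simp
  ring

theorem ofReal_norm_sq_sum {ι : Type*} (s : Finset ι) (V : ι → ℂ) :
    ((‖∑ i ∈ s, V i‖ ^ 2 : ℝ) : ℂ) = ∑ i ∈ s, ∑ j ∈ s, V i * conj (V j) := by
  push_cast
  rw [← Complex.mul_conj', map_sum, Finset.sum_mul_sum]

open Classical in
theorem exists_sum_twist_sq_mul_norm_sum_sq_le : ∃ C : ℝ, 0 < C ∧ ∀ T, exp 2 ≤ T →
    ∀ α, 4 / 5 ≤ α → α ≤ 1 → ∀ Λ Z, IsZeroFamily T α Λ Z →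
    ∀ c : (Σ q : ℕ, DirichletCharacter ℂ q) → ℂ → ℂ,
    (∀ l ρ, ‖c l ρ‖ ≤ 1) →
    ∑ n ∈ zeroRange T, divSum (twistWeight T) n ^ 2 * n *
        ‖∑ l ∈ Λ, ∑ ρ ∈ Z l, c l ρ * (l.2 n * (n : ℂ) ^ (-ρ))‖ ^ 2 ≤
      C * ((T ^ (37 / 5 : ℝ)) ^ (2 * (1 - α)) * (1 + (1 - α) * log T)) * ∑ l ∈ Λ, (#(Z l) : ℝ) +
        twistError T * (∑ l ∈ Λ, (#(Z l) : ℝ)) ^ 2 := by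
  obtain ⟨C, hC, h⟩ := exists_sum_twist_sq_mul_norm_sq_le
  refine ⟨C, hC, ?_⟩
  intro T hT α hα hα1 Λ Z hZ c hc
  have hT3 : 3 ≤ T := by linarith [add_one_le_exp (2 : ℝ)]
  set K := C * ((T ^ (37 / 5 : ℝ)) ^ (2 * (1 - α)) * (1 + (1 - α) * log T)) with hK
  set V : (Σ q : ℕ, DirichletCharacter ℂ q) → ℕ → ℂ :=
    fun l n ↦ ∑ ρ ∈ Z l, c l ρ * (l.2 n * (n : ℂ) ^ (-ρ)) with hV
  set A : (Σ q : ℕ, DirichletCharacter ℂ q) → (Σ q : ℕ, DirichletCharacter ℂ q) → ℂ :=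
    fun l l' ↦ ∑ n ∈ zeroRange T, ((divSum (twistWeight T) n ^ 2 * n : ℝ) : ℂ) *
      (V l n * conj (V l' n)) with hA
  have hE := twistError_nonneg (by linarith : 1 ≤ T)
  have hlog : 0 ≤ log T := log_nonneg (by linarith)
  have hK0 : 0 ≤ K := by
    have : 0 ≤ 1 - α := by linarith
    positivity
  have htot : ((∑ n ∈ zeroRange T, divSum (twistWeight T) n ^ 2 * n *
        ‖∑ l ∈ Λ, V l n‖ ^ 2 : ℝ) : ℂ) = ∑ l ∈ Λ, ∑ l' ∈ Λ, A l l' := by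
    rw [Complex.ofReal_sum]
    have h1 : ∀ n ∈ zeroRange T, ((divSum (twistWeight T) n ^ 2 * n *
        ‖∑ l ∈ Λ, V l n‖ ^ 2 : ℝ) : ℂ) = ∑ l ∈ Λ, ∑ l' ∈ Λ,
          ((divSum (twistWeight T) n ^ 2 * n : ℝ) : ℂ) * (V l n * conj (V l' n)) := by
      intro n _
      rw [Complex.ofReal_mul, ofReal_norm_sq_sum, Finset.mul_sum]
      exact Finset.sum_congr rfl fun l _ ↦ Finset.mul_sum _ _ _
    rw [Finset.sum_congr rfl h1, Finset.sum_comm]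
    refine Finset.sum_congr rfl fun l _ ↦ ?_
    rw [Finset.sum_comm]
  have hpair : ∀ l ∈ Λ, ∀ l' ∈ Λ, ‖A l l'‖ ≤
      (if l = l' then K * #(Z l) else 0) + twistError T * (#(Z l) * #(Z l')) := by
    intro l hl l' hl'
    obtain ⟨_, hq, hprim, hz⟩ := hZ l hl
    by_cases hll : l = l'
    · subst hll
      have h1 := h T hT l.1 l.2 (eq_one_or_ne_one_of_isPrimitive hprim) hq α hα hα1 (Z l) hz (c l)
        (fun ρ _ ↦ hc l ρ)
      have h2 : A l l = ((∑ n ∈ zeroRange T, divSum (twistWeight T) n ^ 2 * n *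
          ‖V l n‖ ^ 2 : ℝ) : ℂ) := by
        rw [hA, Complex.ofReal_sum]
        refine Finset.sum_congr rfl fun n _ ↦ ?_
        rw [Complex.mul_conj']
        push_cast
        ring
      rw [h2, Complex.norm_real, Real.norm_of_nonneg (Finset.sum_nonneg fun n _ ↦ by positivity),
        if_pos rfl, ← sq]
      exact h1
    · obtain ⟨_, hq', hprim', hz'⟩ := hZ l' hl'
      rw [if_neg hll, zero_add, hA]
      simp only [hV]
      rw [sum_mul_sum_mul_conj_sum (zeroRange T) (fun n hn ↦ ne_zero_of_mem_zeroRange hn)]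
      refine norm_sum_sum_mul_conj_mul_le (fun ρ _ ↦ hc l ρ) (fun ρ _ ↦ hc l' ρ)
        fun ρ hρ ρ' hρ' ↦ ?_
      obtain ⟨e1, e2, e3⟩ := re_and_norm_add_conj_sub_one hα (hz ρ hρ).2 (hz' ρ' hρ').2
      refine norm_sum_twist_sq_mul_le (by linarith) (a := fun n ↦ l.2 n * conj (l'.2 n)) ?_ ?_ ?_
        e1 e3
      · intro m n
        push_cast
        simp only [map_mul]
        ring
      · intro n
        rw [norm_mul, Complex.norm_conj]
        exact mul_le_one₀ (l.2.norm_le_one _) (norm_nonneg _) (l'.2.norm_le_one _)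
      · exact norm_sum_character_mul_conj_le (by linarith) hll hprim hprim' hq hq'
  have h1 : ∑ n ∈ zeroRange T, divSum (twistWeight T) n ^ 2 * n * ‖∑ l ∈ Λ, V l n‖ ^ 2 ≤
      ‖∑ l ∈ Λ, ∑ l' ∈ Λ, A l l'‖ := by
    rw [← htot, Complex.norm_real]
    exact le_norm_self _
  refine h1.trans ?_
  calc _ ≤ ∑ l ∈ Λ, ∑ l' ∈ Λ,
        ((if l = l' then K * #(Z l) else 0) + twistError T * (#(Z l) * #(Z l'))) :=
        norm_sum_le_of_le _ fun l hl ↦ norm_sum_le_of_le _ fun l' hl' ↦ hpair l hl l' hl'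
    _ = _ := by
        simp only [Finset.sum_add_distrib]
        congr 1
        · rw [Finset.mul_sum]
          refine Finset.sum_congr rfl fun l hl ↦ ?_
          rw [Finset.sum_ite_eq, if_pos hl]
        · rw [sq, Finset.sum_mul_sum]
          simp only [Finset.mul_sum]

theorem sq_mul_sum_card_le {ι : Type*} {Λ : Finset ι} {Z : ι → Finset ℂ} {I : Finset ℕ}
    (hI : ∀ n ∈ I, n ≠ 0) {δ : ℝ} (hδ : 0 ≤ δ) {ξ θ : ℕ → ℝ} {φ : ι → ℂ → ℕ → ℂ} {W G : ℝ}
    (hbig : ∀ l ∈ Λ, ∀ ρ ∈ Z l, δ ≤ ‖∑ n ∈ I, ((ξ n * θ n : ℝ) : ℂ) * φ l ρ n‖)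
    (hW : ∑ n ∈ I, ξ n ^ 2 / n ≤ W) (hG : ∀ c : ι → ℂ → ℂ, (∀ l ρ, ‖c l ρ‖ ≤ 1) →
      ∑ n ∈ I, θ n ^ 2 * n * ‖∑ l ∈ Λ, ∑ ρ ∈ Z l, c l ρ * φ l ρ n‖ ^ 2 ≤ G) :
    (δ * ∑ l ∈ Λ, (#(Z l) : ℝ)) ^ 2 ≤ W * G := by
  set R := ∑ l ∈ Λ, (#(Z l) : ℝ) with hR
  have hR0 : 0 ≤ R := Finset.sum_nonneg fun _ _ ↦ by positivity
  set A : ι → ℂ → ℂ := fun l ρ ↦ ∑ n ∈ I, ((ξ n * θ n : ℝ) : ℂ) * φ l ρ n with hA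
  set c : ι → ℂ → ℂ := fun l ρ ↦ conj (A l ρ) / ‖A l ρ‖ with hc
  have hc1 : ∀ l ρ, ‖c l ρ‖ ≤ 1 := by
    intro l ρ
    rw [hc, norm_div, Complex.norm_conj, Complex.norm_real, norm_norm]
    exact div_self_le_one _
  have hcA : ∀ l ρ, c l ρ * A l ρ = (‖A l ρ‖ : ℂ) := by
    intro l ρ
    by_cases h0 : A l ρ = 0
    · simp [h0]
    · have : (‖A l ρ‖ : ℂ) ≠ 0 := by exact_mod_cast norm_ne_zero_iff.2 h0
      rw [hc, div_mul_eq_mul_div, mul_comm, Complex.mul_conj', sq, mul_div_assoc, div_self this,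
        mul_one]
  set V : ℕ → ℂ := fun n ↦ ∑ l ∈ Λ, ∑ ρ ∈ Z l, c l ρ * φ l ρ n with hV
  have hdual : ((∑ l ∈ Λ, ∑ ρ ∈ Z l, ‖A l ρ‖ : ℝ) : ℂ) =
      ∑ n ∈ I, ((ξ n * θ n : ℝ) : ℂ) * V n := by
    calc _ = ∑ l ∈ Λ, ∑ ρ ∈ Z l, c l ρ * A l ρ := by
          push_cast
          exact Finset.sum_congr rfl fun l _ ↦ Finset.sum_congr rfl fun ρ _ ↦ (hcA l ρ).symm
      _ = ∑ l ∈ Λ, ∑ ρ ∈ Z l, ∑ n ∈ I, ((ξ n * θ n : ℝ) : ℂ) * (c l ρ * φ l ρ n) := by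
          refine Finset.sum_congr rfl fun l _ ↦ Finset.sum_congr rfl fun ρ _ ↦ ?_
          rw [hA, Finset.mul_sum]
          exact Finset.sum_congr rfl fun n _ ↦ by ring
      _ = _ := by
          simp only [hV, Finset.mul_sum]
          rw [Finset.sum_comm (s := I)]
          refine Finset.sum_congr rfl fun l _ ↦ ?_
          rw [Finset.sum_comm (s := I)]
  have hlow : δ * R ≤ ∑ n ∈ I, (|ξ n| / √n) * (|θ n| * √n * ‖V n‖) := by
    calc δ * R = ∑ l ∈ Λ, ∑ ρ ∈ Z l, δ := by
          rw [hR, Finset.mul_sum]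
          refine Finset.sum_congr rfl fun l _ ↦ ?_
          rw [Finset.sum_const, nsmul_eq_mul, mul_comm]
      _ ≤ ∑ l ∈ Λ, ∑ ρ ∈ Z l, ‖A l ρ‖ :=
          Finset.sum_le_sum fun l hl ↦ Finset.sum_le_sum fun ρ hρ ↦ hbig l hl ρ hρ
      _ ≤ ‖((∑ l ∈ Λ, ∑ ρ ∈ Z l, ‖A l ρ‖ : ℝ) : ℂ)‖ := by
          rw [Complex.norm_real]
          exact le_norm_self _
      _ ≤ _ := by
          rw [hdual]
          refine norm_sum_le_of_le _ fun n hn ↦ ?_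
          have hn0 : (0 : ℝ) < n := by exact_mod_cast Nat.pos_of_ne_zero (hI n hn)
          have : √(n : ℝ) ≠ 0 := (sqrt_pos.2 hn0).ne'
          rw [norm_mul, Complex.norm_real, Real.norm_eq_abs, abs_mul]
          apply le_of_eq
          field_simp
  have hf : ∑ n ∈ I, (|ξ n| / √n) ^ 2 ≤ W := by
    refine le_trans (le_of_eq (Finset.sum_congr rfl fun n _ ↦ ?_)) hW
    rw [div_pow, sq_sqrt (by positivity), sq_abs]
  have hg : ∑ n ∈ I, (|θ n| * √n * ‖V n‖) ^ 2 ≤ G := by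
    refine le_trans (le_of_eq (Finset.sum_congr rfl fun n _ ↦ ?_)) (hG c hc1)
    rw [mul_pow, mul_pow, sq_abs, sq_sqrt (by positivity)]
  calc (δ * R) ^ 2 ≤ _ := pow_le_pow_left₀ (mul_nonneg hδ hR0) hlow 2
    _ ≤ _ := Finset.sum_mul_sq_le_sq_mul_sq I _ _
    _ ≤ W * G := mul_le_mul hf hg (Finset.sum_nonneg fun _ _ ↦ sq_nonneg _)
        ((Finset.sum_nonneg fun _ _ ↦ sq_nonneg _).trans hf)

theorem exists_sum_card_le_of_le_norm_sum {δ : ℝ} (hδ : 0 < δ) : ∃ C : ℝ, 0 < C ∧ ∀ᶠ T in atTop,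
    ∀ α, 4 / 5 ≤ α → α ≤ 1 → ∀ Λ Z, IsZeroFamily T α Λ Z → ∀ ξ : ℕ → ℝ,
    (∀ n, n ∈ zeroRange T → |ξ n| ≤ |divSum (mainWeight T) n|) →
    (∀ l ∈ Λ, ∀ ρ ∈ Z l, δ ≤ ‖∑ n ∈ zeroRange T,
      ((ξ n * divSum (twistWeight T) n : ℝ) : ℂ) * (l.2 n * (n : ℂ) ^ (-ρ))‖) →
    ∑ l ∈ Λ, (#(Z l) : ℝ) ≤
      C * ((T ^ (37 / 5 : ℝ)) ^ (2 * (1 - α)) * (1 + (1 - α) * log T)) := by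
  obtain ⟨C₁, hC₁, h₁⟩ := exists_sum_twist_sq_mul_norm_sum_sq_le
  obtain ⟨W, hW, h₂⟩ := exists_sum_mainWeight_le
  refine ⟨2 * W * C₁ / δ ^ 2, by positivity, ?_⟩
  have hsmall : ∀ᶠ T in atTop, twistError T < δ ^ 2 / (2 * W) :=
    tendsto_twistError.eventually_lt_const (by positivity)
  filter_upwards [hsmall, eventually_ge_atTop (exp 2)] with T hTE hT α hα hα1 Λ Z hZ ξ hξ hbig
  have hf : ∑ n ∈ zeroRange T, ξ n ^ 2 / n ≤ W := by
    refine le_trans ?_ (h₂ T (le_trans (exp_le_exp.2 (by norm_num)) hT))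
    refine le_trans (Finset.sum_le_sum (g := fun n : ℕ ↦ divSum (mainWeight T) n ^ 2 / n)
      fun n hn ↦ ?_) (Finset.sum_le_sum_of_subset_of_nonneg ?_ fun n _ _ ↦ by positivity)
    · have := sq_le_sq.2 (hξ n hn)
      gcongr
    · exact Finset.Ioc_subset_Ioc_left (Nat.zero_le _)
  have hmain := sq_mul_sum_card_le (fun n hn ↦ ne_zero_of_mem_zeroRange hn) hδ.le hbig hf
    (h₁ T hT α hα hα1 Λ Z hZ)
  have hT3 : 3 ≤ T := by linarith [add_one_le_exp (2 : ℝ)]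
  have hlog : 0 ≤ log T := log_nonneg (by linarith)
  have hK0 : 0 ≤ (T ^ (37 / 5 : ℝ)) ^ (2 * (1 - α)) * (1 + (1 - α) * log T) := by
    have : 0 ≤ 1 - α := by linarith
    positivity
  have hR0 : 0 ≤ ∑ l ∈ Λ, (#(Z l) : ℝ) := Finset.sum_nonneg fun _ _ ↦ by positivity
  generalize (∑ l ∈ Λ, (#(Z l) : ℝ)) = R at *
  generalize (T ^ (37 / 5 : ℝ)) ^ (2 * (1 - α)) * (1 + (1 - α) * log T) = K at *
  have hWE : W * twistError T ≤ δ ^ 2 / 2 := by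
    rw [lt_div_iff₀ (by positivity)] at hTE
    linarith
  rcases hR0.eq_or_lt with h0 | h0
  · rw [← h0]; positivity
  · have h5 : δ ^ 2 * R ^ 2 ≤ 2 * (W * C₁ * K) * R := by nlinarith [sq_nonneg R]
    have h6 : δ ^ 2 * R ≤ 2 * (W * C₁ * K) := by
      by_contra! hcon
      nlinarith
    rw [div_mul_eq_mul_div, le_div_iff₀ (by positivity)]
    linarith

end ZeroDensity

namespace ZeroDensity
open scoped ComplexConjugate Finset
open Filter Topology

theorem norm_sum_divSum_mul_divSum_le {w v : ℕ → ℝ} {D E : ℕ} (hw : ∀ d, D < d → w d = 0)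
    (hv : ∀ d, E < d → v d = 0) (hw1 : ∀ d, |w d| ≤ 1) (hv1 : ∀ d, |v d| ≤ 1) (f : ℕ → ℂ) {B : ℝ}
    (N : ℕ) (hf : ∀ g, 0 < g → g ≤ D * E → ‖∑ n ∈ Finset.Ioc 0 N with g ∣ n, f n‖ ≤ B) :
    ‖∑ n ∈ Finset.Ioc 0 N, ((divSum w n * divSum v n : ℝ) : ℂ) * f n‖ ≤ D * E * B := by
  have h1 : ∑ n ∈ Finset.Ioc 0 N, ((divSum w n * divSum v n : ℝ) : ℂ) * f n =
      ∑ d ∈ Finset.Ioc 0 D, ∑ e ∈ Finset.Ioc 0 E, ((w d * v e : ℝ) : ℂ) *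
        ∑ n ∈ Finset.Ioc 0 N with d.lcm e ∣ n, f n := by
    have h2 : ∀ n ∈ Finset.Ioc 0 N, ((divSum w n * divSum v n : ℝ) : ℂ) * f n =
        ∑ d ∈ Finset.Ioc 0 D, ∑ e ∈ Finset.Ioc 0 E,
          ((w d * v e : ℝ) : ℂ) * (if d.lcm e ∣ n then f n else 0) := by
      intro n hn
      have hn0 : 0 < n := by rw [Finset.mem_Ioc] at hn; omega
      rw [divSum_eq hw hn0, divSum_eq hv hn0, Finset.sum_filter, Finset.sum_filter,
        Finset.sum_mul_sum]
      push_cast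
      rw [Finset.sum_mul]
      refine Finset.sum_congr rfl fun d _ ↦ ?_
      rw [Finset.sum_mul]
      refine Finset.sum_congr rfl fun e _ ↦ ?_
      by_cases hd : d ∣ n <;> by_cases he : e ∣ n <;> simp [hd, he, Nat.lcm_dvd_iff]
    rw [Finset.sum_congr rfl h2, Finset.sum_comm]
    refine Finset.sum_congr rfl fun d _ ↦ ?_
    rw [Finset.sum_comm]
    refine Finset.sum_congr rfl fun e _ ↦ ?_
    rw [Finset.sum_filter, Finset.mul_sum]
  rw [h1]
  calc _ ≤ ∑ d ∈ Finset.Ioc 0 D, ∑ e ∈ Finset.Ioc 0 E, B := by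
        refine norm_sum_le_of_le _ fun d hd ↦ norm_sum_le_of_le _ fun e he ↦ ?_
        rw [Finset.mem_Ioc] at hd he
        have hB := hf (d.lcm e) (Nat.lcm_pos hd.1 he.1) ((Nat.le_of_dvd (Nat.mul_pos hd.1 he.1)
          (Nat.lcm_dvd_mul d e)).trans (Nat.mul_le_mul hd.2 he.2))
        rw [norm_mul, Complex.norm_real, Real.norm_eq_abs, abs_mul]
        calc _ ≤ 1 * 1 * B :=
              mul_le_mul (mul_le_mul (hw1 d) (hv1 e) (abs_nonneg _) zero_le_one) hB
                (norm_nonneg _) (by norm_num)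
          _ = B := by ring
    _ = D * E * B := by
        rw [Finset.sum_const, Finset.sum_const, Nat.card_Ioc, Nat.card_Ioc, nsmul_eq_mul,
          nsmul_eq_mul]
        simp only [tsub_zero]
        ring

theorem floor_mul_floor_le {T : ℝ} (hT : 1 ≤ T) :
    (⌊T ^ (19 / 5 : ℝ)⌋₊ : ℝ) * ⌊T ^ (1 / 50 : ℝ)⌋₊ ≤ T ^ (191 / 50 : ℝ) := by
  have hT0 : 0 < T := by linarith
  calc (⌊T ^ (19 / 5 : ℝ)⌋₊ : ℝ) * ⌊T ^ (1 / 50 : ℝ)⌋₊ ≤ T ^ (19 / 5 : ℝ) * T ^ (1 / 50 : ℝ) := by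
        gcongr
        · exact Nat.floor_le (by positivity)
        · exact Nat.floor_le (by positivity)
    _ = T ^ (191 / 50 : ℝ) := by
        rw [← rpow_add hT0]
        norm_num

theorem norm_sum_zeroRange_add_le {T : ℝ} (hT : 1 < T) (f : ℕ → ℂ) {B : ℝ}
    (hf : ∀ g : ℕ, 0 < g → (g : ℝ) ≤ T ^ (191 / 50 : ℝ) →
      ‖∑ n ∈ Finset.Ioc 0 ⌊T ^ (37 / 5 : ℝ)⌋₊ with g ∣ n, f n‖ ≤ B) :
    ‖∑ n ∈ zeroRange T, ((divSum (mainWeight T) n * divSum (twistWeight T) n : ℝ) : ℂ) * f n +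
      f 1‖ ≤ T ^ (191 / 50 : ℝ) * B := by
  have hB : 0 ≤ B := (norm_nonneg _).trans (hf 1 one_pos (by
    rw [Nat.cast_one]
    exact one_le_rpow hT.le (by norm_num)))
  have h1 : ∑ n ∈ zeroRange T,
      ((divSum (mainWeight T) n * divSum (twistWeight T) n : ℝ) : ℂ) * f n + f 1 =
      ∑ n ∈ Finset.Ioc 0 ⌊T ^ (37 / 5 : ℝ)⌋₊,
        ((divSum (mainWeight T) n * divSum (twistWeight T) n : ℝ) : ℂ) * f n := by
    have hN : 1 ≤ ⌊T ^ (15 / 4 : ℝ)⌋₊ :=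
      (Nat.one_le_floor_iff _).2 (one_le_rpow hT.le (by norm_num))
    have hNN : ⌊T ^ (15 / 4 : ℝ)⌋₊ ≤ ⌊T ^ (37 / 5 : ℝ)⌋₊ :=
      Nat.floor_mono (rpow_le_rpow_of_exponent_le hT.le (by norm_num))
    rw [← Finset.sum_Ioc_consecutive _ (Nat.zero_le _) hNN, zeroRange, add_comm]
    congr 1
    rw [← Finset.sum_Ioc_consecutive _ (Nat.zero_le 1) hN]
    rw [show Finset.Ioc 0 1 = {1} by rfl, Finset.sum_singleton, divSum_mainWeight_one hT.le,
      divSum_twistWeight_one hT, Finset.sum_eq_zero]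
    · simp
    · intro n hn
      rw [Finset.mem_Ioc] at hn
      rw [divSum_mainWeight_eq_zero hn.1 hn.2]
      simp
  rw [h1]
  refine (norm_sum_divSum_mul_divSum_le (fun d hd ↦ mainWeight_eq_zero hT.le hd)
    (fun d hd ↦ twistWeight_eq_zero hd) (abs_mainWeight_le hT) (abs_twistWeight_le hT) f _
    (B := B) ?_).trans ?_
  · intro g hg hgD
    refine hf g hg (le_trans ?_ (floor_mul_floor_le hT.le))
    exact_mod_cast hgD
  · exact mul_le_mul_of_nonneg_right (floor_mul_floor_le hT.le) hB

theorem natCast_rpow_neg_mul_div_rpow_neg {g : ℕ} (hg : 0 < g) {X : ℝ} (hX : 0 < X) (σ : ℝ) :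
    (g : ℝ) ^ (-σ) * (X / g) ^ (-σ) = X ^ (-σ) := by
  have hg0 : (0 : ℝ) < g := by exact_mod_cast hg
  rw [← mul_rpow hg0.le (by positivity), mul_div_cancel₀ _ hg0.ne']

theorem norm_sum_dvd_character_le {q : ℕ} [NeZero q] {χ : DirichletCharacter ℂ q} (hχ : χ ≠ 1)
    {ρ : ℂ} (hρ : χ.LFunction ρ = 0) (hρ0 : 0 < ρ.re) (hρ1 : ρ.re ≤ 1) {X : ℝ} {g : ℕ}
    (hg : 0 < g) (hgX : (g : ℝ) ≤ X) :
    ‖∑ n ∈ Finset.Ioc 0 ⌊X⌋₊ with g ∣ n, χ n * (n : ℂ) ^ (-ρ)‖ ≤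
      q * (‖ρ‖ / ρ.re) * (2 * X ^ (-ρ.re)) := by
  have hg0 : (0 : ℝ) < g := by exact_mod_cast hg
  rw [sum_Ioc_filter_dvd _ _ hg]
  have h1 : ∀ m : ℕ, χ (g * m : ℕ) * ((g * m : ℕ) : ℂ) ^ (-ρ) =
      χ g * (g : ℂ) ^ (-ρ) * (χ m * (m : ℂ) ^ (-ρ)) := by
    intro m
    push_cast
    rw [map_mul, Complex.natCast_mul_natCast_cpow]
    ring
  simp only [h1]
  rw [← Finset.mul_sum, norm_mul, norm_mul]
  have hM : ⌊X⌋₊ / g = ⌊X / g⌋₊ := (Nat.floor_div_natCast X g).symm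
  have h1X : 1 ≤ X / g := by rwa [le_div_iff₀ hg0, one_mul]
  have hM0 : 0 < ⌊X / g⌋₊ := Nat.floor_pos.2 h1X
  have h2 := norm_LFunction_sub_sum_le hχ hρ0 hM0
  rw [hρ, zero_sub, norm_neg] at h2
  rw [hM]
  have h3 : ‖(g : ℂ) ^ (-ρ)‖ = (g : ℝ) ^ (-ρ.re) := by
    have := norm_cpow_neg hg0 ρ
    rwa [Complex.ofReal_natCast] at this
  calc _ ≤ 1 * (g : ℝ) ^ (-ρ.re) * (q * (‖ρ‖ / ρ.re) * (⌊X / g⌋₊ : ℝ) ^ (-ρ.re)) := by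
        rw [h3]
        exact mul_le_mul (mul_le_mul_of_nonneg_right (χ.norm_le_one _) (by positivity)) h2
          (norm_nonneg _) (by positivity)
    _ ≤ 1 * (g : ℝ) ^ (-ρ.re) * (q * (‖ρ‖ / ρ.re) * (2 * (X / g) ^ (-ρ.re))) := by
        gcongr
        exact floor_rpow_neg_le hρ0.le hρ1 h1X
    _ = q * (‖ρ‖ / ρ.re) * (2 * ((g : ℝ) ^ (-ρ.re) * (X / g) ^ (-ρ.re))) := by ring
    _ = _ := by rw [natCast_rpow_neg_mul_div_rpow_neg hg (by linarith)]

theorem norm_sum_dvd_zeta_le {κ : ℝ} {ρ : ℂ} (hρ : riemannZeta ρ = 0)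
    (hρ0 : 1 / 2 ≤ ρ.re) (hρ1 : ρ.re ≤ 1) (hne : ρ ≠ 1) (hκ : ‖2 - ρ‖ ≤ κ * ‖1 - ρ‖) {X : ℝ}
    {g : ℕ} (hg : 0 < g) (hgX : (g : ℝ) ≤ X) :
    ‖∑ n ∈ Finset.Ioc 0 ⌊X⌋₊ with g ∣ n,
      (n : ℂ) ^ (-ρ) * (1 - (2 - ρ) / (1 - ρ) * ((n : ℝ) / X : ℝ))‖ ≤
      (κ + 10 * (‖ρ‖ + 1) * (1 + log X)) * X ^ (-ρ.re) := by
  have hg0 : (0 : ℝ) < g := by exact_mod_cast hg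
  have hgc : (g : ℂ) ≠ 0 := by exact_mod_cast hg.ne'
  have hX : 0 < X := by linarith
  have hXc : (X : ℂ) ≠ 0 := by exact_mod_cast hX.ne'
  rw [sum_Ioc_filter_dvd _ _ hg]
  have h1 : ∀ m : ℕ, ((g * m : ℕ) : ℂ) ^ (-ρ) *
        (1 - (2 - ρ) / (1 - ρ) * (((g * m : ℕ) : ℝ) / X : ℝ)) =
      (g : ℂ) ^ (-ρ) * ((m : ℂ) ^ (-ρ) * (1 - (2 - ρ) / (1 - ρ) * (m / (X / g : ℝ)))) := by
    intro m
    have : (((g * m : ℕ) : ℝ) / X : ℝ) = ((m : ℂ) / (X / g : ℝ)) := by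
      push_cast
      field_simp
    rw [this]
    push_cast
    rw [Complex.natCast_mul_natCast_cpow]
    ring
  simp only [h1]
  rw [← Finset.mul_sum, norm_mul]
  have hM : ⌊X⌋₊ / g = ⌊X / g⌋₊ := (Nat.floor_div_natCast X g).symm
  have h1X : 1 ≤ X / g := by rwa [le_div_iff₀ hg0, one_mul]
  have h2 := norm_sum_zeta_zero_le hρ0 hρ1 hne hρ hκ h1X
  rw [hM]
  have h3 : ‖(g : ℂ) ^ (-ρ)‖ = (g : ℝ) ^ (-ρ.re) := by
    have := norm_cpow_neg hg0 ρ
    rwa [Complex.ofReal_natCast] at this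
  have h4 : log (X / g) ≤ log X := by
    refine log_le_log (by positivity) (div_le_self hX.le ?_)
    exact_mod_cast hg
  calc _ ≤ (g : ℝ) ^ (-ρ.re) * ((κ + 10 * (‖ρ‖ + 1) * (1 + log X)) * (X / g) ^ (-ρ.re)) := by
        rw [h3]
        refine mul_le_mul_of_nonneg_left (h2.trans ?_) (by positivity)
        gcongr
    _ = (κ + 10 * (‖ρ‖ + 1) * (1 + log X)) * ((g : ℝ) ^ (-ρ.re) * (X / g) ^ (-ρ.re)) := by ring
    _ = _ := by rw [natCast_rpow_neg_mul_div_rpow_neg hg (by linarith)]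

theorem exists_norm_two_sub_le : ∃ κ : ℝ, 1 ≤ κ ∧ ∀ ρ : ℂ, ρ ≠ 1 → riemannZeta ρ = 0 →
    ‖2 - ρ‖ ≤ κ * ‖1 - ρ‖ := by
  have h1 : ∀ᶠ s in 𝓝 (1 : ℂ), zetaOne s ≠ 0 :=
    differentiable_zetaOne.continuous.continuousAt.eventually_ne zetaOne_one_ne_zero
  obtain ⟨η, hη, h⟩ := Metric.eventually_nhds_iff.1 h1
  refine ⟨1 / η + 1, by linarith [one_div_pos.2 hη], fun ρ hne hρ ↦ ?_⟩
  have h2 : η ≤ ‖1 - ρ‖ := by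
    by_contra! hlt
    refine h (y := ρ) (by rw [dist_comm, dist_eq_norm]; exact hlt) ?_
    rw [zetaOne_apply hne, hρ, mul_zero]
  calc ‖2 - ρ‖ = ‖1 + (1 - ρ)‖ := by ring_nf
    _ ≤ 1 + ‖1 - ρ‖ := (norm_add_le _ _).trans (by rw [norm_one])
    _ ≤ 1 / η * ‖1 - ρ‖ + ‖1 - ρ‖ := by
        gcongr
        rw [one_div, ← div_eq_inv_mul, one_le_div hη]
        exact h2
    _ = _ := by ring

end ZeroDensity

namespace ZeroDensity
open scoped Finset
open Filter Topology

theorem norm_le_add_one {T : ℝ} {ρ : ℂ} (h0 : 0 ≤ ρ.re) (h1 : ρ.re ≤ 1) (hT : |ρ.im| ≤ T) :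
    ‖ρ‖ ≤ T + 1 := by
  have := Complex.norm_le_abs_re_add_abs_im ρ
  rw [abs_of_nonneg h0] at this
  linarith

theorem rpow_rpow_neg_re_le {T σ : ℝ} (hT : 1 ≤ T) (hσ : 4 / 5 ≤ σ) :
    (T ^ (37 / 5 : ℝ)) ^ (-σ) ≤ T ^ (-(148 / 25) : ℝ) := by
  rw [← rpow_mul (by linarith)]
  exact rpow_le_rpow_of_exponent_le hT (by linarith)

theorem eventually_half_le_norm_sum_character : ∀ᶠ T : ℝ in atTop, ∀ (q : ℕ) [NeZero q]
    (χ : DirichletCharacter ℂ q), χ ≠ 1 → (q : ℝ) ≤ T → ∀ ρ : ℂ, χ.LFunction ρ = 0 →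
    4 / 5 ≤ ρ.re → ρ.re < 1 → |ρ.im| ≤ T →
    1 / 2 ≤ ‖∑ n ∈ zeroRange T, ((divSum (mainWeight T) n * divSum (twistWeight T) n : ℝ) : ℂ) *
      (χ n * (n : ℂ) ^ (-ρ))‖ := by
  have hlim : Tendsto (fun T : ℝ ↦ 5 * T ^ (-(1 / 10) : ℝ)) atTop (𝓝 0) := by
    have := (tendsto_rpow_neg_atTop (by norm_num : (0 : ℝ) < 1 / 10)).const_mul 5
    rwa [mul_zero] at this
  filter_upwards [hlim.eventually_le_const (by norm_num : (0 : ℝ) < 1 / 2), eventually_gt_atTop 1]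
    with T hT hT1 q _ χ hχ hq ρ hρ h0 h1 hi
  have hT0 : 0 < T := by linarith
  have h2 := norm_sum_zeroRange_add_le hT1 (fun n ↦ χ n * (n : ℂ) ^ (-ρ))
    (fun g hg hgT ↦ norm_sum_dvd_character_le hχ hρ (by linarith) h1.le hg
      (hgT.trans (rpow_le_rpow_of_exponent_le hT1.le (by norm_num))))
  have h3 : T ^ (191 / 50 : ℝ) * (q * (‖ρ‖ / ρ.re) * (2 * (T ^ (37 / 5 : ℝ)) ^ (-ρ.re))) ≤
      1 / 2 := by
    have h4 : ‖ρ‖ / ρ.re ≤ 5 / 2 * T := by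
      rw [div_le_iff₀ (by linarith)]
      have := norm_le_add_one (by linarith) h1.le hi
      nlinarith
    have h5 := rpow_rpow_neg_re_le hT1.le h0
    have hre : 0 < ρ.re := by linarith
    calc _ ≤ T ^ (191 / 50 : ℝ) * (T * (5 / 2 * T) * (2 * T ^ (-(148 / 25) : ℝ))) := by gcongr
      _ = 5 * (T ^ (191 / 50 : ℝ) * (T ^ (1 : ℝ) * T ^ (1 : ℝ)) * T ^ (-(148 / 25) : ℝ)) := by
          rw [rpow_one]; ring
      _ = 5 * T ^ (-(1 / 10) : ℝ) := by
          rw [← rpow_add hT0, ← rpow_add hT0, ← rpow_add hT0]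
          norm_num
      _ ≤ 1 / 2 := hT
  have h6 := h2.trans h3
  simp only [Nat.cast_one, map_one, Complex.one_cpow, mul_one] at h6
  have h7 := norm_sub_le_norm_add (1 : ℂ) (∑ n ∈ zeroRange T,
    ((divSum (mainWeight T) n * divSum (twistWeight T) n : ℝ) : ℂ) * (χ n * (n : ℂ) ^ (-ρ)))
  rw [add_comm (1 : ℂ), norm_one] at h7
  linarith

theorem exists_eventually_le_norm_sum_zeta : ∃ δ : ℝ, 0 < δ ∧ ∀ᶠ T : ℝ in atTop, ∀ ρ : ℂ,
    riemannZeta ρ = 0 → 4 / 5 ≤ ρ.re → ρ.re < 1 → |ρ.im| ≤ T →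
    δ ≤ ‖∑ n ∈ zeroRange T, ((divSum (mainWeight T) n * divSum (twistWeight T) n : ℝ) : ℂ) *
      (n : ℂ) ^ (-ρ)‖ ∨
    δ ≤ ‖∑ n ∈ zeroRange T, ((divSum (mainWeight T) n * (n / T ^ (37 / 5 : ℝ)) *
      divSum (twistWeight T) n : ℝ) : ℂ) * (n : ℂ) ^ (-ρ)‖ := by
  obtain ⟨κ, hκ1, hκ⟩ := exists_norm_two_sub_le
  refine ⟨1 / (4 * κ), by positivity, ?_⟩
  have hlim : Tendsto (fun T : ℝ ↦ (κ + 30) * T ^ (-(11 / 10) : ℝ) +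
      222 * (log T / T ^ (11 / 10 : ℝ))) atTop (𝓝 0) := by
    have h1 := (tendsto_rpow_neg_atTop (by norm_num : (0 : ℝ) < 11 / 10)).const_mul (κ + 30)
    have h2 : Tendsto (fun T : ℝ ↦ log T / T ^ (11 / 10 : ℝ)) atTop (𝓝 0) :=
      (isLittleO_log_rpow_atTop (by norm_num : (0 : ℝ) < 11 / 10)).tendsto_div_nhds_zero
    have h3 := h1.add (h2.const_mul 222)
    rwa [mul_zero, mul_zero, add_zero] at h3
  filter_upwards [hlim.eventually_le_const (by norm_num : (0 : ℝ) < 1 / 4), eventually_gt_atTop 1,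
    eventually_ge_atTop (4 * κ)] with T hT hT1 hTκ ρ hρ h0 h1 hi
  have hT0 : 0 < T := by linarith
  have hne : ρ ≠ 1 := by rintro rfl; simp at h1
  set X := T ^ (37 / 5 : ℝ) with hX
  have hXT : T ≤ X := by
    calc T = T ^ (1 : ℝ) := (rpow_one T).symm
      _ ≤ X := rpow_le_rpow_of_exponent_le hT1.le (by norm_num)
  have hlog := log_nonneg hT1.le
  have hlogX : log X = 37 / 5 * log T := log_rpow hT0 _
  set κ' := (2 - ρ) / (1 - ρ) with hκ'
  have hκ'1 : ‖κ'‖ ≤ κ := by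
    rw [hκ', norm_div, div_le_iff₀ (norm_pos_iff.2 (sub_ne_zero.2 hne.symm))]
    exact hκ ρ hne hρ
  have h2 := norm_sum_zeroRange_add_le hT1
    (fun n ↦ (n : ℂ) ^ (-ρ) * (1 - κ' * ((n : ℝ) / X : ℝ)))
    (fun g hg hgT ↦ norm_sum_dvd_zeta_le hρ (by linarith) h1.le hne (hκ ρ hne hρ) hg
      (hgT.trans (rpow_le_rpow_of_exponent_le hT1.le (by norm_num))))
  have h3 : T ^ (191 / 50 : ℝ) * ((κ + 10 * (‖ρ‖ + 1) * (1 + log X)) * X ^ (-ρ.re)) ≤ 1 / 4 := by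
    have h4 := norm_le_add_one (by linarith) h1.le hi
    have h5 : X ^ (-ρ.re) ≤ T ^ (-(148 / 25) : ℝ) := rpow_rpow_neg_re_le hT1.le h0
    have h6 : κ + 10 * (‖ρ‖ + 1) * (1 + log X) ≤ T * (κ + 30 + 222 * log T) := by
      rw [hlogX]
      have h7 : ‖ρ‖ + 1 ≤ 3 * T := by linarith
      have h8 : 10 * (‖ρ‖ + 1) * (1 + 37 / 5 * log T) ≤ 10 * (3 * T) * (1 + 37 / 5 * log T) := by
        gcongr
      nlinarith
    calc _ ≤ T ^ (191 / 50 : ℝ) * ((T * (κ + 30 + 222 * log T)) * T ^ (-(148 / 25) : ℝ)) := by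
          gcongr
      _ = (κ + 30 + 222 * log T) *
          (T ^ (191 / 50 : ℝ) * T ^ (1 : ℝ) * T ^ (-(148 / 25) : ℝ)) := by
          rw [rpow_one]; ring
      _ = (κ + 30 + 222 * log T) * T ^ (-(11 / 10) : ℝ) := by
          rw [← rpow_add hT0, ← rpow_add hT0]
          norm_num
      _ = (κ + 30) * T ^ (-(11 / 10) : ℝ) + 222 * (log T / T ^ (11 / 10 : ℝ)) := by
          rw [rpow_neg hT0.le]
          ring
      _ ≤ 1 / 4 := hT
  have h6 := h2.trans h3
  have hX0 : 0 < X := by linarith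
  have hκX : ‖κ' * ((1 : ℝ) / X : ℝ)‖ ≤ 1 / 4 := by
    rw [norm_mul, Complex.norm_real, Real.norm_of_nonneg (by positivity), mul_one_div,
      div_le_iff₀ hX0]
    linarith
  have hsplit : ∑ n ∈ zeroRange T,
      ((divSum (mainWeight T) n * divSum (twistWeight T) n : ℝ) : ℂ) *
        ((n : ℂ) ^ (-ρ) * (1 - κ' * ((n : ℝ) / X : ℝ))) =
      ∑ n ∈ zeroRange T, ((divSum (mainWeight T) n * divSum (twistWeight T) n : ℝ) : ℂ) *
        (n : ℂ) ^ (-ρ) - κ' * ∑ n ∈ zeroRange T, ((divSum (mainWeight T) n * (n / X) *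
        divSum (twistWeight T) n : ℝ) : ℂ) * (n : ℂ) ^ (-ρ) := by
    rw [Finset.mul_sum, ← Finset.sum_sub_distrib]
    refine Finset.sum_congr rfl fun n _ ↦ ?_
    push_cast
    ring
  simp only [hsplit] at h6
  generalize (∑ n ∈ zeroRange T, ((divSum (mainWeight T) n * divSum (twistWeight T) n : ℝ) : ℂ) *
        (n : ℂ) ^ (-ρ)) = S₁ at *
  generalize (∑ n ∈ zeroRange T, ((divSum (mainWeight T) n * (n / X) *
        divSum (twistWeight T) n : ℝ) : ℂ) * (n : ℂ) ^ (-ρ)) = S₂ at *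
  simp only [Nat.cast_one, Complex.one_cpow, one_mul] at h6
  by_contra! hcon
  have hδ1 : 1 / (4 * κ) ≤ 1 / 4 := by
    rw [div_le_div_iff₀ (by positivity) (by norm_num)]
    linarith
  have hS₂ : ‖κ' * S₂‖ ≤ 1 / 4 := by
    rw [norm_mul]
    calc _ ≤ κ * (1 / (4 * κ)) := mul_le_mul hκ'1 hcon.2.le (norm_nonneg _) (by linarith)
      _ = 1 / 4 := by field_simp
  have : (1 : ℂ) = (S₁ - κ' * S₂ + (1 - κ' * ((1 : ℝ) / X : ℝ))) - S₁ + κ' * S₂ +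
      κ' * ((1 : ℝ) / X : ℝ) := by ring
  have h8 : (1 : ℝ) ≤ 1 / 4 + ‖S₁‖ + 1 / 4 + 1 / 4 := by
    calc (1 : ℝ) = ‖(1 : ℂ)‖ := norm_one.symm
      _ ≤ _ := by
        rw [this]
        refine (norm_add_le _ _).trans (add_le_add ((norm_add_le _ _).trans
          (add_le_add ((norm_sub_le _ _).trans (add_le_add h6 le_rfl)) hS₂)) hκX)
  linarith [hcon.1]

open Classical in
theorem exists_sum_card_zeroFamily_le : ∃ C : ℝ, 0 < C ∧ ∀ᶠ T in atTop,
    ∀ α, 4 / 5 ≤ α → α ≤ 1 → ∀ Λ Z, IsZeroFamily T α Λ Z →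
    ∑ l ∈ Λ, (#(Z l) : ℝ) ≤
      C * ((T ^ (37 / 5 : ℝ)) ^ (2 * (1 - α)) * (1 + (1 - α) * log T)) := by
  obtain ⟨δ, hδ, hdet⟩ := exists_eventually_le_norm_sum_zeta
  obtain ⟨C₁, hC₁, h₁⟩ := exists_sum_card_le_of_le_norm_sum (by norm_num : (0 : ℝ) < 1 / 2)
  obtain ⟨C₂, hC₂, h₂⟩ := exists_sum_card_le_of_le_norm_sum hδ
  refine ⟨C₁ + 2 * C₂, by positivity, ?_⟩
  filter_upwards [hdet, h₁, h₂, eventually_half_le_norm_sum_character, eventually_gt_atTop 1]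
    with T hdet h₁ h₂ hchar hT α hα hα1 Λ Z hZ
  have hsub : ∀ Λ' ⊆ Λ, ∀ Z', (∀ l, Z' l ⊆ Z l) → IsZeroFamily T α Λ' Z' := by
    intro Λ' hΛ Z' hZ' l hl
    obtain ⟨i, hq, hp, hz⟩ := hZ l (hΛ hl)
    exact ⟨i, hq, hp, fun ρ hρ ↦ hz ρ (hZ' l hρ)⟩
  set P : (Σ q : ℕ, DirichletCharacter ℂ q) → ℂ → Prop := fun l ρ ↦
    δ ≤ ‖∑ n ∈ zeroRange T, ((divSum (mainWeight T) n * divSum (twistWeight T) n : ℝ) : ℂ) *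
      (l.2 n * (n : ℂ) ^ (-ρ))‖ with hP
  have hsum : ∑ l ∈ Λ, (#(Z l) : ℝ) = ∑ l ∈ Λ with l.1 ≠ 1, (#(Z l) : ℝ) +
      (∑ l ∈ Λ with l.1 = 1, (#{ρ ∈ Z l | P l ρ} : ℝ) +
        ∑ l ∈ Λ with l.1 = 1, (#{ρ ∈ Z l | ¬ P l ρ} : ℝ)) := by
    rw [← Finset.sum_filter_add_sum_filter_not Λ (fun l ↦ l.1 = 1), add_comm,
      ← Finset.sum_add_distrib]
    congr 1
    refine Finset.sum_congr rfl fun l _ ↦ ?_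
    rw [← Finset.card_filter_add_card_filter_not (s := Z l) (P l)]
    push_cast
    rfl
  have key₁ := h₁ α hα hα1 {l ∈ Λ | l.1 ≠ 1} Z (hsub _ (Finset.filter_subset _ _) Z fun _ ↦ subset_rfl)
    (fun n ↦ divSum (mainWeight T) n) (fun _ _ ↦ le_rfl) (by
      intro l hl ρ hρ
      rw [Finset.mem_filter] at hl
      obtain ⟨_, hq, hp, hz⟩ := hZ l hl.1
      obtain ⟨z1, z2, z3, z4⟩ := hz ρ hρ
      exact hchar l.1 l.2 ((eq_one_or_ne_one_of_isPrimitive hp).resolve_left hl.2) hq ρ z1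
        (hα.trans z2) z3 z4)
  have key₂ := h₂ α hα hα1 {l ∈ Λ | l.1 = 1} (fun l ↦ {ρ ∈ Z l | P l ρ})
    (hsub _ (Finset.filter_subset _ _) _ fun l ↦ Finset.filter_subset _ _)
    (fun n ↦ divSum (mainWeight T) n) (fun _ _ ↦ le_rfl)
    (fun l _ ρ hρ ↦ (Finset.mem_filter.1 hρ).2)
  have key₃ := h₂ α hα hα1 {l ∈ Λ | l.1 = 1} (fun l ↦ {ρ ∈ Z l | ¬ P l ρ})
    (hsub _ (Finset.filter_subset _ _) _ fun l ↦ Finset.filter_subset _ _)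
    (fun n ↦ divSum (mainWeight T) n * (n / T ^ (37 / 5 : ℝ))) (by
      intro n hn
      rw [zeroRange, Finset.mem_Ioc] at hn
      rw [abs_mul]
      refine mul_le_of_le_one_right (abs_nonneg _) ?_
      rw [abs_of_nonneg (by positivity), div_le_one (by positivity)]
      exact (Nat.cast_le.2 hn.2).trans (Nat.floor_le (by positivity))) (by
      rintro ⟨q, χ⟩ hl ρ hρ
      rw [Finset.mem_filter] at hl hρ
      obtain ⟨hl, rfl : q = 1⟩ := hl
      obtain ⟨_, hq, hp, hz⟩ := hZ _ hl
      obtain ⟨z1, z2, z3, z4⟩ := hz ρ hρ.1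
      have hχ : ∀ n : ℕ, χ n = 1 := fun n ↦ by
        rw [Subsingleton.elim (n : ZMod 1) 1, map_one]
      have hPρ := hρ.2
      simp only [hP, hχ, one_mul] at hPρ ⊢
      simp only [DirichletCharacter.LFunction_modOne_eq] at z1
      exact (hdet ρ z1 (hα.trans z2) z3 z4).resolve_left hPρ)
  rw [hsum]
  linarith

end ZeroDensity

namespace ZeroDensity
open scoped Finset
open Filter Topology

theorem gammaFactor_ne_zero {q : ℕ} (χ : DirichletCharacter ℂ q) {s : ℂ} (hs : 0 ≤ s.re)
    (hs0 : s ≠ 0) : χ.gammaFactor s ≠ 0 := by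
  rw [DirichletCharacter.gammaFactor]
  split_ifs
  · rw [Ne, Complex.Gammaℝ_eq_zero_iff]
    rintro ⟨n, rfl⟩
    simp only [Complex.neg_re, Complex.mul_re, Complex.re_ofNat, Complex.natCast_re,
      Complex.im_ofNat, Complex.natCast_im, mul_zero, sub_zero] at hs
    have hn : (n : ℝ) = 0 := le_antisymm (by linarith) (Nat.cast_nonneg n)
    rw [Nat.cast_eq_zero] at hn
    simp [hn] at hs0
  · rw [Ne, Complex.Gammaℝ_eq_zero_iff]
    rintro ⟨n, hn⟩
    have := congrArg Complex.re hn
    simp only [Complex.neg_re, Complex.mul_re, Complex.re_ofNat, Complex.natCast_re,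
      Complex.im_ofNat, Complex.natCast_im, mul_zero, sub_zero, Complex.add_re,
      Complex.one_re] at this
    linarith [(Nat.cast_nonneg n : (0 : ℝ) ≤ n)]

theorem isPrimitive_inv {q : ℕ} {χ : DirichletCharacter ℂ q} (hχ : χ.IsPrimitive) :
    χ⁻¹.IsPrimitive := by
  rw [DirichletCharacter.isPrimitive_def, DirichletCharacter.conductor_inv]
  exact hχ

theorem LFunction_inv_one_sub_eq_zero {q : ℕ} [NeZero q] {χ : DirichletCharacter ℂ q}
    (hχ : χ.IsPrimitive) {s : ℂ} (hs : 0 ≤ s.re) (hs0 : s ≠ 0) (hs1 : s.re < 1)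
    (h : χ.LFunction s = 0) : χ⁻¹.LFunction (1 - s) = 0 := by
  rw [χ.LFunction_eq_completed_div_gammaFactor s (Or.inl hs0), div_eq_zero_iff] at h
  have h1 := h.resolve_right (gammaFactor_ne_zero χ hs hs0)
  have h2 : 1 - s ≠ 0 := by
    intro h3
    rw [sub_eq_zero] at h3
    simp [← h3] at hs1
  rw [χ⁻¹.LFunction_eq_completed_div_gammaFactor _ (Or.inl h2),
    (isPrimitive_inv hχ).completedLFunction_one_sub s, inv_inv, h1, mul_zero, zero_div]

theorem exists_finite_zeros_and_zerosCount_le : ∃ C : ℝ, 0 < C ∧ ∀ T, 2 ≤ T →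
    ∀ (q : ℕ) [NeZero q] (χ : DirichletCharacter ℂ q), χ.IsPrimitive → (q : ℝ) ≤ T →
    ∀ α, 0 ≤ α → {s : ℂ | χ.LFunction s = 0 ∧ α ≤ s.re ∧ s.re ≤ 1 ∧ |s.im| ≤ T}.Finite ∧
      (zerosCount χ α T : ℝ) ≤ C * (T * (1 + log T)) := by
  obtain ⟨C, hC, h⟩ := exists_card_zeros_le
  refine ⟨2 * C + 1, by positivity, ?_⟩
  intro T hT q _ χ hχ hq α hα
  have hlog : 0 ≤ log T := log_nonneg (by linarith)
  have hK0 : 0 ≤ C * (T * (1 + log T)) := by positivity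
  have hhalf : ∀ ψ : DirichletCharacter ℂ q, ψ.IsPrimitive →
      {s : ℂ | ψ.LFunction s = 0 ∧ 1 / 2 ≤ s.re ∧ |s.im| ≤ T}.Finite ∧
      ({s : ℂ | ψ.LFunction s = 0 ∧ 1 / 2 ≤ s.re ∧ |s.im| ≤ T}.ncard : ℝ) ≤
        C * (T * (1 + log T)) := by
    intro ψ hψ
    have h1 : ∀ S : Finset ℂ,
        (S : Set ℂ) ⊆ {s : ℂ | ψ.LFunction s = 0 ∧ 1 / 2 ≤ s.re ∧ |s.im| ≤ T} →
        (#S : ℝ) ≤ C * (T * (1 + log T)) := fun S hS ↦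
      h T hT q ψ (eq_one_or_ne_one_of_isPrimitive hψ) hq S fun ρ hρ ↦ hS hρ
    have hfin : {s : ℂ | ψ.LFunction s = 0 ∧ 1 / 2 ≤ s.re ∧ |s.im| ≤ T}.Finite := by
      by_contra hinf
      obtain ⟨S, hS, hcard⟩ :=
        Set.Infinite.exists_subset_card_eq hinf (⌊C * (T * (1 + log T))⌋₊ + 1)
      have h2 := h1 S hS
      rw [hcard] at h2
      push_cast at h2
      linarith [Nat.lt_floor_add_one (C * (T * (1 + log T)))]
    refine ⟨hfin, ?_⟩
    rw [Set.ncard_eq_toFinset_card _ hfin]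
    exact h1 _ (by simp)
  obtain ⟨f1, c1⟩ := hhalf χ hχ
  obtain ⟨f2, c2⟩ := hhalf χ⁻¹ (isPrimitive_inv hχ)
  set A := {s : ℂ | χ.LFunction s = 0 ∧ 1 / 2 ≤ s.re ∧ |s.im| ≤ T}
  set B := {s : ℂ | χ⁻¹.LFunction s = 0 ∧ 1 / 2 ≤ s.re ∧ |s.im| ≤ T}
  have hsub : {s : ℂ | χ.LFunction s = 0 ∧ α ≤ s.re ∧ s.re ≤ 1 ∧ |s.im| ≤ T} ⊆
      A ∪ ((fun s ↦ 1 - s) '' B ∪ {0}) := by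
    rintro s ⟨z, hs, -, hi⟩
    by_cases hs2 : 1 / 2 ≤ s.re
    · exact Or.inl ⟨z, hs2, hi⟩
    · right
      by_cases hs0 : s = 0
      · exact Or.inr hs0
      · refine Or.inl ⟨1 - s, ⟨LFunction_inv_one_sub_eq_zero hχ (hα.trans hs) hs0 (by linarith) z,
          ?_, ?_⟩, sub_sub_cancel _ _⟩
        · rw [Complex.sub_re, Complex.one_re]
          linarith
        · rw [Complex.sub_im, Complex.one_im, zero_sub, abs_neg]
          exact hi
  have hfin : (A ∪ ((fun s ↦ 1 - s) '' B ∪ {0})).Finite :=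
    f1.union ((f2.image _).union (Set.finite_singleton _))
  refine ⟨hfin.subset hsub, ?_⟩
  have hcard : zerosCount χ α T ≤ A.ncard + (B.ncard + 1) := by
    refine (Set.ncard_le_ncard hsub hfin).trans ((Set.ncard_union_le _ _).trans ?_)
    refine Nat.add_le_add_left ((Set.ncard_union_le _ _).trans ?_) _
    rw [Set.ncard_singleton]
    exact Nat.add_le_add_right (Set.ncard_image_le f2) _
  have hcard' : (zerosCount χ α T : ℝ) ≤ A.ncard + (B.ncard + 1) := by exact_mod_cast hcard
  have h1 : 1 ≤ T * (1 + log T) := by nlinarith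
  linarith

open scoped Classical in
/-- The number of zeros in `α ≤ Re s ≤ 1`, `|Im s| ≤ T` of the `L`-functions of all primitive
characters modulo `q`. -/
noncomputable def primitiveZerosCount (q : ℕ) (α T : ℝ) : ℝ :=
  if hq : q = 0 then 0 else
    haveI : NeZero q := ⟨hq⟩
    ∑ χ ∈ Finset.univ.filter (fun χ : DirichletCharacter ℂ q => χ.IsPrimitive),
      (zerosCount χ α T : ℝ)

open scoped Classical in
theorem primitiveZerosCount_eq (q : ℕ) [hq : NeZero q] (α T : ℝ) :
    primitiveZerosCount q α T =
      ∑ χ ∈ Finset.univ.filter (fun χ : DirichletCharacter ℂ q => χ.IsPrimitive),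
        (zerosCount χ α T : ℝ) :=
  dif_neg hq.out

/-- The number of zeros in `α ≤ Re s ≤ 1`, `|Im s| ≤ T` of the `L`-functions of all primitive
characters of conductor at most `T`. -/
noncomputable def totalZerosCount (α T : ℝ) : ℝ :=
  ∑ q ∈ Finset.Icc 1 ⌊T⌋₊, primitiveZerosCount q α T

open scoped Classical in
theorem exists_totalZerosCount_le : ∃ C : ℝ, 0 < C ∧ ∀ T, 2 ≤ T → ∀ α, 0 ≤ α →
    totalZerosCount α T ≤ C * (T ^ 3 * (1 + log T)) := by
  obtain ⟨C, hC, h⟩ := exists_finite_zeros_and_zerosCount_le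
  refine ⟨C, hC, fun T hT α hα ↦ ?_⟩
  have hlog : 0 ≤ log T := log_nonneg (by linarith)
  have hK0 : 0 ≤ C * (T * (1 + log T)) := by positivity
  have hfl : (⌊T⌋₊ : ℝ) ≤ T := Nat.floor_le (by linarith)
  calc totalZerosCount α T ≤
        ∑ q ∈ Finset.Icc 1 ⌊T⌋₊, T * (C * (T * (1 + log T))) := by
        refine Finset.sum_le_sum fun q hq ↦ ?_
        have hq1 := Finset.mem_Icc.mp hq
        have : NeZero q := ⟨by omega⟩
        have hqT : (q : ℝ) ≤ T := (Nat.cast_le.2 hq1.2).trans hfl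
        rw [primitiveZerosCount_eq]
        refine (Finset.sum_le_card_nsmul _ _ (C * (T * (1 + log T))) fun χ hχ ↦ ?_).trans ?_
        · exact (h T hT q χ (Finset.mem_filter.1 hχ).2 hqT α hα).2
        · rw [nsmul_eq_mul]
          refine mul_le_mul_of_nonneg_right (le_trans ?_ hqT) hK0
          rw [Nat.cast_le]
          refine (Finset.card_filter_le _ _).trans ?_
          rw [Finset.card_univ, ← Nat.card_eq_fintype_card,
            DirichletCharacter.card_eq_totient_of_hasEnoughRootsOfUnity]
          exact Nat.totient_le _
    _ = ⌊T⌋₊ * (T * (C * (T * (1 + log T)))) := by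
        rw [Finset.sum_const, Nat.card_Icc, nsmul_eq_mul,
          Nat.add_sub_cancel]
    _ ≤ T * (T * (C * (T * (1 + log T)))) := by gcongr
    _ = _ := by ring

theorem re_lt_one_of_LFunction_eq_zero {q : ℕ} [NeZero q] {χ : DirichletCharacter ℂ q}
    (hχ : χ.IsPrimitive) {s : ℂ} (hs : χ.LFunction s = 0) : s.re < 1 := by
  by_contra! h
  rcases eq_one_or_ne_one_of_isPrimitive hχ with rfl | h1
  · rw [DirichletCharacter.LFunction_modOne_eq] at hs
    exact riemannZeta_ne_zero_of_one_le_re h hs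
  · exact χ.LFunction_ne_zero_of_one_le_re (Or.inl h1) h hs

open scoped Classical in
theorem exists_zeroFamily_totalZerosCount_eq {T α : ℝ} (hT : 2 ≤ T) (hα : 0 ≤ α) :
    ∃ Λ Z, IsZeroFamily T α Λ Z ∧ totalZerosCount α T = ∑ l ∈ Λ, (#(Z l) : ℝ) := by
  obtain ⟨C, hC, h⟩ := exists_finite_zeros_and_zerosCount_le
  have hfl : (⌊T⌋₊ : ℝ) ≤ T := Nat.floor_le (by linarith)
  set U : (Σ q : ℕ, DirichletCharacter ℂ q) → Set ℂ := fun l ↦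
    {s | ∃ _ : NeZero l.1, l.2.LFunction s = 0 ∧ α ≤ s.re ∧ s.re ≤ 1 ∧ |s.im| ≤ T}
  have hne : ∀ q : {x // x ∈ Finset.Icc 1 ⌊T⌋₊}, NeZero q.1 := fun q ↦
    ⟨by have := Finset.mem_Icc.mp q.2; omega⟩
  set Λ₀ : Finset (Σ q : {x // x ∈ Finset.Icc 1 ⌊T⌋₊}, DirichletCharacter ℂ q.1) :=
    (Finset.Icc 1 ⌊T⌋₊).attach.sigma fun q ↦
      haveI : NeZero q.1 := ⟨by have := Finset.mem_Icc.mp q.2; omega⟩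
      Finset.univ.filter (fun χ : DirichletCharacter ℂ q.1 => χ.IsPrimitive) with hΛ₀
  set F : (Σ q : {x // x ∈ Finset.Icc 1 ⌊T⌋₊}, DirichletCharacter ℂ q.1) →
    (Σ q : ℕ, DirichletCharacter ℂ q) := fun l ↦ ⟨l.1.1, l.2⟩ with hF
  have hFinj : Function.Injective F := by
    rintro ⟨⟨q, hq⟩, χ⟩ ⟨⟨q', hq'⟩, χ'⟩ hll
    simp only [hF, Sigma.mk.injEq] at hll
    obtain ⟨rfl, hχ⟩ := hll
    rw [eq_of_heq hχ]
  have hUeq : ∀ (q : ℕ) [NeZero q] (χ : DirichletCharacter ℂ q),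
      U ⟨q, χ⟩ = {s : ℂ | χ.LFunction s = 0 ∧ α ≤ s.re ∧ s.re ≤ 1 ∧ |s.im| ≤ T} := by
    intro q hq χ
    ext s
    exact ⟨fun ⟨_, hs⟩ ↦ hs, fun hs ↦ ⟨hq, hs⟩⟩
  set Z : (Σ q : ℕ, DirichletCharacter ℂ q) → Finset ℂ := fun l ↦
    if hU : (U l).Finite then hU.toFinset else ∅ with hZ
  refine ⟨Λ₀.image F, Z, ?_, ?_⟩
  · intro l hl
    rw [Finset.mem_image] at hl
    obtain ⟨⟨q, χ⟩, hl', rfl⟩ := hl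
    rw [hΛ₀, Finset.mem_sigma] at hl'
    have hp := (Finset.mem_filter.1 hl'.2).2
    have := hne q
    refine ⟨hne q, (Nat.cast_le.2 (Finset.mem_Icc.1 q.2).2).trans hfl, hp, fun ρ hρ ↦ ?_⟩
    simp only [hZ] at hρ
    split_ifs at hρ with hU
    · rw [Set.Finite.mem_toFinset] at hρ
      obtain ⟨_, h1, h2, h3, h4⟩ := hρ
      exact ⟨h1, h2, re_lt_one_of_LFunction_eq_zero hp h1, h4⟩
    · simp at hρ
  · rw [Finset.sum_image fun _ _ _ _ h ↦ hFinj h, hΛ₀, Finset.sum_sigma, totalZerosCount,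
      ← Finset.sum_attach]
    refine Finset.sum_congr rfl fun q _ ↦ ?_
    have := hne q
    rw [primitiveZerosCount_eq]
    refine Finset.sum_congr rfl fun χ hχ ↦ ?_
    have hp := (Finset.mem_filter.1 hχ).2
    have hfin := (h T hT q.1 χ hp ((Nat.cast_le.2 (Finset.mem_Icc.1 q.2).2).trans hfl) α hα).1
    rw [← hUeq] at hfin
    simp only [hZ, hF]
    rw [dif_pos hfin, ← Set.ncard_eq_toFinset_card _ hfin, hUeq, zerosCount]

theorem exists_eventually_totalZerosCount_le : ∃ C : ℝ, 0 < C ∧ ∀ᶠ T : ℝ in atTop,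
    ∀ α, 4 / 5 ≤ α → α ≤ 1 → totalZerosCount α T ≤ C * T ^ (15 * (1 - α)) := by
  obtain ⟨C, hC, h⟩ := exists_sum_card_zeroFamily_le
  refine ⟨5 * C, by positivity, ?_⟩
  filter_upwards [h, eventually_ge_atTop 2] with T h hT α hα hα1
  obtain ⟨Λ, Z, hZ, heq⟩ := exists_zeroFamily_totalZerosCount_eq hT (by linarith : 0 ≤ α)
  have hT0 : 0 < T := by linarith
  rw [heq]
  refine (h α hα hα1 Λ Z hZ).trans ?_
  have h1 : 1 + (1 - α) * log T ≤ 5 * T ^ (1 / 5 * (1 - α)) := by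
    rw [rpow_def_of_pos hT0]
    have h2 := add_one_le_exp (log T * (1 / 5 * (1 - α)))
    linarith
  calc _ ≤ C * ((T ^ (37 / 5 : ℝ)) ^ (2 * (1 - α)) * (5 * T ^ (1 / 5 * (1 - α)))) := by gcongr
    _ = 5 * C * T ^ (15 * (1 - α)) := by
        rw [← rpow_mul hT0.le, mul_left_comm _ (5 : ℝ), ← rpow_add hT0]
        ring_nf

theorem exists_totalZerosCount_le_rpow {ε : ℝ} (hε : 0 < ε) : ∃ C : ℝ, 0 < C ∧ ∀ T, 2 ≤ T →
    ∀ α, 0 ≤ α → α ≤ 1 → totalZerosCount α T ≤ C * T ^ ((15 + ε) * (1 - α)) := by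
  obtain ⟨C₁, hC₁, h₁⟩ := exists_totalZerosCount_le
  obtain ⟨C₂, hC₂, h₂⟩ := exists_eventually_totalZerosCount_le
  obtain ⟨T₀, h₂⟩ := eventually_atTop.1 h₂
  have hT₀ : 0 ≤ C₁ * (max T₀ 2 ^ 3 * (1 + log (max T₀ 2))) := by
    have := log_nonneg (one_le_two.trans (le_max_right T₀ 2))
    positivity
  set K := C₁ * (max T₀ 2 ^ 3 * (1 + log (max T₀ 2))) with hK
  refine ⟨C₁ * (1 + 5 / ε) + C₂ + K, by positivity, fun T hT α hα hα1 ↦ ?_⟩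
  have hT0 : 0 < T := by linarith
  have hpow1 : 1 ≤ T ^ ((15 + ε) * (1 - α)) :=
    one_le_rpow (by linarith) (mul_nonneg (by positivity) (by linarith))
  have hA : 0 ≤ C₁ * (1 + 5 / ε) := by positivity
  have hlog := log_nonneg (by linarith : 1 ≤ T)
  rcases le_total α (4 / 5) with hα' | hα'
  · have h3 : 1 + log T ≤ (1 + 5 / ε) * T ^ (ε / 5) := by
      have h4 := log_le_rpow_div hT0.le (by positivity : 0 < ε / 5)
      have h5 : 1 ≤ T ^ (ε / 5) := one_le_rpow (by linarith) (by positivity)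
      have h6 : T ^ (ε / 5) / (ε / 5) = 5 / ε * T ^ (ε / 5) := by field_simp
      linarith
    calc totalZerosCount α T ≤ C₁ * (T ^ 3 * (1 + log T)) := h₁ T hT α hα
      _ ≤ C₁ * (T ^ 3 * ((1 + 5 / ε) * T ^ (ε / 5))) := by gcongr
      _ = C₁ * (1 + 5 / ε) * T ^ (3 + ε / 5) := by
          rw [rpow_add hT0, rpow_ofNat]
          ring
      _ ≤ C₁ * (1 + 5 / ε) * T ^ ((15 + ε) * (1 - α)) := by
          refine mul_le_mul_of_nonneg_left (rpow_le_rpow_of_exponent_le (by linarith) ?_) hA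
          nlinarith
      _ ≤ _ := by
          refine mul_le_mul_of_nonneg_right ?_ (by linarith)
          linarith
  · rcases le_total T₀ T with hTT | hTT
    · calc totalZerosCount α T ≤ C₂ * T ^ (15 * (1 - α)) := h₂ T hTT α hα' hα1
        _ ≤ C₂ * T ^ ((15 + ε) * (1 - α)) := by
            refine mul_le_mul_of_nonneg_left (rpow_le_rpow_of_exponent_le (by linarith) ?_) hC₂.le
            nlinarith
        _ ≤ _ := by
            refine mul_le_mul_of_nonneg_right ?_ (by linarith)
            linarith
    · have hTm : T ≤ max T₀ 2 := hTT.trans (le_max_left _ _)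
      calc totalZerosCount α T ≤ C₁ * (T ^ 3 * (1 + log T)) := h₁ T hT α hα
        _ ≤ K := by
            rw [hK]
            gcongr
        _ ≤ K * T ^ ((15 + ε) * (1 - α)) := le_mul_of_one_le_right hT₀ hpow1
        _ ≤ _ := by
            refine mul_le_mul_of_nonneg_right ?_ (by linarith)
            linarith

end ZeroDensity

open scoped Classical in
/-- Zero-density estimate: `∑_{q ≤ T} ∑*_{χ mod q} N(α, T, χ) ≤ C(ε)·T^{(15+ε)(1−α)}`
uniformly for `0 ≤ α ≤ 1`, where the inner sum runs over primitive characters. -/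
theorem zero_density_estimate :
    ∀ ε : ℝ, 0 < ε → ∃ C : ℝ, 0 < C ∧
      ∀ T : ℝ, 2 ≤ T → ∀ α : ℝ, 0 ≤ α → α ≤ 1 →
        ((∑ q ∈ (Finset.Icc 1 ⌊T⌋₊).attach,
            haveI : NeZero q.1 := ⟨by have := Finset.mem_Icc.mp q.2; omega⟩
            ∑ χ ∈ Finset.univ.filter
                (fun χ : DirichletCharacter ℂ q.1 => χ.IsPrimitive),
              (zerosCount χ α T : ℝ))
          ≤ C * T ^ ((15 + ε) * (1 - α))) := by
  intro ε hε
  obtain ⟨C, hC, h⟩ := ZeroDensity.exists_totalZerosCount_le_rpow hε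
  refine ⟨C, hC, fun T hT α hα hα1 ↦ le_of_eq_of_le ?_ (h T hT α hα hα1)⟩
  refine Eq.trans ?_ (Finset.sum_attach _ (ZeroDensity.primitiveZerosCount · α T))
  refine Finset.sum_congr rfl fun q _ ↦ ?_
  have : NeZero q.1 := ⟨by have := Finset.mem_Icc.mp q.2; omega⟩
  exact (ZeroDensity.primitiveZerosCount_eq q.1 α T).symm
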